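/- arXiv:2106.01568 — 2 statements merged into one kernel-verified Lean document; each statement's English description precedes it below -/
import Mathlib

section
/- Fix a > 0, γ ∈ [1,2], ν > 0, constants 0 < ς̲₀ ≤ ς̄₀ and Ē > 0. There exist positive constants C and α, depending only on (a, γ, ν, ς̄₀, ς̲₀, Ē), with the following property: for every global smooth solution (η, w) of the 1D isentropic compressible Navier–Stokes system on [0,∞) × T whose initial data satisfy ς̲₀ ≤ η₀ ≤ ς̄₀, ∫_T η₀ dx = 1, ∫_T η₀ w₀ dx = 0 and E₀₀ := ∫_T ( (1/2) η₀ w₀² + P(η₀) ) dx ≤ Ē, one has for all t ≥ 0: ‖w(t,·)‖_{H¹(T)} + ‖w(t,·)‖_{C^{0,1/2}(T)} ≤ C E₁₀^{1/2} e^{−α t}, where E₁₀ := ‖η₀ − 1‖²_{H¹(T)} + ‖w₀‖²_{H¹(T)}. -/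
open MeasureTheory

/-- The pressure potential `P` associated with the pressure law `p(s) = a s^γ`. -/
noncomputable def Ppot (a γ : ℝ) (s : ℝ) : ℝ :=
  if γ = 1 then a * (s * Real.log s + 1) else a * s ^ γ / (γ - 1)

/-- Square of the Sobolev `H^k` norm on the torus `𝕋 = ℝ/ℤ` of a `1`-periodic
function `f : ℝ → ℝ`: `‖f‖²_{H^k} = ∑_{0 ≤ j ≤ k} ∫_𝕋 (∂ₓ^j f)²`. -/
noncomputable def HSq (k : ℕ) (f : ℝ → ℝ) : ℝ :=
  ∑ j ∈ Finset.range (k + 1), ∫ x in (0:ℝ)..1, (deriv^[j] f x) ^ 2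

open Classical in
/-- The Hölder `C^{0,1/2}` norm on the torus `𝕋 = ℝ/ℤ` of a `1`-periodic
function `f : ℝ → ℝ`:
`‖f‖ = sup_x |f(x)| + sup_{x ≠ x'} |f(x) - f(x')| / d(x,x')^{1/2}`,
with `d` the distance on `𝕋`. -/
noncomputable def holderHalfNorm (f : ℝ → ℝ) : ℝ :=
  (⨆ x : ℝ, |f x|) +
    ⨆ q : ℝ × ℝ,
      if (q.1 : AddCircle (1:ℝ)) = (q.2 : AddCircle (1:ℝ)) then 0
      else |f q.1 - f q.2| /
        Real.sqrt (dist ((q.1 : AddCircle (1:ℝ))) ((q.2 : AddCircle (1:ℝ))))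

namespace NavierStokesDecay

open Set Filter Topology
open scoped ContDiff

/-! ### Partial derivatives -/

/-- Partial derivative in the first (time) variable. -/
noncomputable def pt (f : ℝ → ℝ → ℝ) (t x : ℝ) : ℝ := deriv (fun s => f s x) t

/-- Partial derivative in the second (space) variable. -/
noncomputable def px (f : ℝ → ℝ → ℝ) (t x : ℝ) : ℝ := deriv (f t) x

section Partial

variable {f : ℝ → ℝ → ℝ}

lemma hasDerivAt_fst (hf : ContDiff ℝ ∞ (Function.uncurry f)) (t x : ℝ) :
    HasDerivAt (fun s => f s x) (fderiv ℝ (Function.uncurry f) (t, x) (1, 0)) t :=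
  ((hf.differentiable (by simp)) (t, x)).hasFDerivAt.comp_hasDerivAt (f := fun s => (s, x)) t
    ((hasDerivAt_id t).prodMk (hasDerivAt_const t x))

lemma hasDerivAt_snd (hf : ContDiff ℝ ∞ (Function.uncurry f)) (t x : ℝ) :
    HasDerivAt (f t) (fderiv ℝ (Function.uncurry f) (t, x) (0, 1)) x :=
  ((hf.differentiable (by simp)) (t, x)).hasFDerivAt.comp_hasDerivAt x
    ((hasDerivAt_const x t).prodMk (hasDerivAt_id x))

lemma hasDerivAt_pt (hf : ContDiff ℝ ∞ (Function.uncurry f)) (t x : ℝ) :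
    HasDerivAt (fun s => f s x) (pt f t x) t :=
  (hasDerivAt_fst hf t x).differentiableAt.hasDerivAt

lemma hasDerivAt_px (hf : ContDiff ℝ ∞ (Function.uncurry f)) (t x : ℝ) :
    HasDerivAt (f t) (px f t x) x :=
  (hasDerivAt_snd hf t x).differentiableAt.hasDerivAt

lemma uncurry_pt (hf : ContDiff ℝ ∞ (Function.uncurry f)) :
    Function.uncurry (pt f) = fun z => fderiv ℝ (Function.uncurry f) z (1, 0) :=
  funext fun z => (hasDerivAt_fst hf z.1 z.2).deriv

lemma uncurry_px (hf : ContDiff ℝ ∞ (Function.uncurry f)) :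
    Function.uncurry (px f) = fun z => fderiv ℝ (Function.uncurry f) z (0, 1) :=
  funext fun z => (hasDerivAt_snd hf z.1 z.2).deriv

lemma contDiff_pt (hf : ContDiff ℝ ∞ (Function.uncurry f)) :
    ContDiff ℝ ∞ (Function.uncurry (pt f)) := by
  rw [uncurry_pt hf]
  exact (hf.fderiv_right (by simp)).clm_apply contDiff_const

lemma contDiff_px (hf : ContDiff ℝ ∞ (Function.uncurry f)) :
    ContDiff ℝ ∞ (Function.uncurry (px f)) := by
  rw [uncurry_px hf]
  exact (hf.fderiv_right (by simp)).clm_apply contDiff_const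

lemma pt_px_comm (hf : ContDiff ℝ ∞ (Function.uncurry f)) (t x : ℝ) :
    pt (px f) t x = px (pt f) t x := by
  have hd : HasFDerivAt (fderiv ℝ (Function.uncurry f))
      (fderiv ℝ (fderiv ℝ (Function.uncurry f)) (t, x)) (t, x) :=
    ((hf.fderiv_right (m := ∞) (by simp)).differentiable (by simp) (t, x)).hasFDerivAt
  have hs := second_derivative_symmetric
    (fun y => ((hf.differentiable (by simp)) y).hasFDerivAt) hd (1, 0) (0, 1)
  have key : ∀ u v : ℝ × ℝ,
      fderiv ℝ (fun z => fderiv ℝ (Function.uncurry f) z v) (t, x) u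
        = fderiv ℝ (fderiv ℝ (Function.uncurry f)) (t, x) u v := fun u v => by
    rw [(hd.clm_apply (hasFDerivAt_const v (t, x))).fderiv]
    simp
  have h1 : pt (px f) t x = fderiv ℝ (Function.uncurry (px f)) (t, x) (1, 0) :=
    congrFun (uncurry_pt (contDiff_px hf)) (t, x)
  have h2 : px (pt f) t x = fderiv ℝ (Function.uncurry (pt f)) (t, x) (0, 1) :=
    congrFun (uncurry_px (contDiff_pt hf)) (t, x)
  rw [h1, h2, uncurry_px hf, uncurry_pt hf, key, key, hs]

lemma px_periodic (h : ∀ t x : ℝ, f t (x + 1) = f t x) (t x : ℝ) :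
    px f t (x + 1) = px f t x := by
  have : f t = fun y => f t (y + 1) := funext fun y => (h t y).symm
  unfold px
  conv_rhs => rw [this]
  rw [deriv_comp_add_const]

lemma pt_periodic (h : ∀ t x : ℝ, f t (x + 1) = f t x) (t x : ℝ) :
    pt f t (x + 1) = pt f t x := by
  simp only [pt, h]

end Partial

/-! ### Differentiation of integrals over a period -/

lemma hasDerivAt_integral_of_continuousOn {f f' : ℝ → ℝ → ℝ} {S : Set ℝ} (hS : IsOpen S)
    (hf : ContinuousOn (fun z : ℝ × ℝ => f z.1 z.2) (S ×ˢ univ))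
    (hf' : ContinuousOn (fun z : ℝ × ℝ => f' z.1 z.2) (S ×ˢ univ))
    (hd : ∀ s ∈ S, ∀ x, HasDerivAt (fun s => f s x) (f' s x) s)
    {t : ℝ} (ht : t ∈ S) (u v : ℝ) :
    HasDerivAt (fun s => ∫ x in u..v, f s x) (∫ x in u..v, f' t x) t := by
  have slice : ∀ {g : ℝ → ℝ → ℝ}, ContinuousOn (fun z : ℝ × ℝ => g z.1 z.2) (S ×ˢ univ) →
      ∀ s ∈ S, Continuous (g s) := fun {g} hg s hs =>
    hg.comp_continuous (f := fun x => (s, x)) (by fun_prop) fun x => ⟨hs, mem_univ x⟩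
  obtain ⟨ε, hε, hball⟩ := Metric.nhds_basis_closedBall.mem_iff.mp (hS.mem_nhds ht)
  obtain ⟨C, hC⟩ := ((isCompact_closedBall t ε).prod isCompact_uIcc).exists_bound_of_continuousOn
    (f := fun z : ℝ × ℝ => f' z.1 z.2) (s := Metric.closedBall t ε ×ˢ uIcc u v)
    (hf'.mono (prod_mono hball (subset_univ _)))
  refine (intervalIntegral.hasDerivAt_integral_of_dominated_loc_of_deriv_le
    (bound := fun _ => C) (F' := f') (Metric.closedBall_mem_nhds t hε) ?_
    ((slice hf t ht).intervalIntegrable _ _) (slice hf' t ht).aestronglyMeasurable ?_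
    intervalIntegrable_const ?_).2
  · filter_upwards [hS.mem_nhds ht] with s hs
    exact (slice hf s hs).aestronglyMeasurable
  · exact ae_of_all _ fun x hx s hs => hC (s, x) ⟨hs, uIoc_subset_uIcc hx⟩
  · exact ae_of_all _ fun x _ s hs => hd s (hball hs) x

/-- Balance law: if `∂ₜ f` equals `g` up to an exact derivative of a periodic flux, then
`∫ g` is the time derivative of `∫ f`. -/
lemma hasDerivAt_integral_of_flux {f f' : ℝ → ℝ → ℝ} {S : Set ℝ} (hS : IsOpen S)
    (hf : ContinuousOn (fun z : ℝ × ℝ => f z.1 z.2) (S ×ˢ univ))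
    (hf' : ContinuousOn (fun z : ℝ × ℝ => f' z.1 z.2) (S ×ˢ univ))
    (hd : ∀ s ∈ S, ∀ x, HasDerivAt (fun s => f s x) (f' s x) s)
    {t : ℝ} (ht : t ∈ S) {G g : ℝ → ℝ} (hg : Continuous g)
    (hG : ∀ x, HasDerivAt G (f' t x - g x) x) (hG01 : G 1 = G 0) :
    HasDerivAt (fun s => ∫ x in (0:ℝ)..1, f s x) (∫ x in (0:ℝ)..1, g x) t := by
  have hc : Continuous (f' t) :=
    hf'.comp_continuous (f := fun x => (t, x)) (by fun_prop) fun x => ⟨ht, mem_univ x⟩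
  have h0 : ∫ x in (0:ℝ)..1, (f' t x - g x) = 0 := by
    rw [intervalIntegral.integral_eq_sub_of_hasDerivAt (fun x _ => hG x)
      ((hc.sub hg).intervalIntegrable _ _), hG01, sub_self]
  rw [intervalIntegral.integral_sub (hc.intervalIntegrable _ _) (hg.intervalIntegrable _ _),
    sub_eq_zero] at h0
  rw [← h0]
  exact hasDerivAt_integral_of_continuousOn hS hf hf' hd ht 0 1

lemma le_initial_of_hasDerivAt_nonpos {f f' : ℝ → ℝ} (hd : ∀ t, 0 ≤ t → HasDerivAt f (f' t) t)
    (hf' : ∀ t, 0 ≤ t → f' t ≤ 0) {t : ℝ} (ht : 0 ≤ t) : f t ≤ f 0 := by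
  refine antitoneOn_of_deriv_nonpos (convex_Ici 0)
    (fun s hs => (hd s hs).continuousAt.continuousWithinAt)
    (fun s hs => ?_) (fun s hs => ?_) self_mem_Ici ht ht
  all_goals rw [interior_Ici] at hs
  · exact (hd s (le_of_lt hs)).differentiableAt.differentiableWithinAt
  · rw [(hd s (le_of_lt hs)).deriv]
    exact hf' s (le_of_lt hs)

lemma eq_initial_of_hasDerivAt_zero {f : ℝ → ℝ} (hd : ∀ t, 0 ≤ t → HasDerivAt f 0 t)
    {t : ℝ} (ht : 0 ≤ t) : f t = f 0 := by
  refine le_antisymm (le_initial_of_hasDerivAt_nonpos hd (fun _ _ => le_rfl) ht) ?_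
  have := le_initial_of_hasDerivAt_nonpos (f := fun s => - f s) (f' := fun _ => 0)
    (fun s hs => neg_zero (G := ℝ) ▸ (hd s hs).neg) (fun _ _ => le_rfl) ht
  linarith

/-! ### One-dimensional Sobolev inequalities -/

lemma sq_sub_le_mul_integral_sq {f f' : ℝ → ℝ} (hd : ∀ x, HasDerivAt f (f' x) x)
    (hc : Continuous f') {x y : ℝ} (hxy : y ≤ x) :
    (f x - f y) ^ 2 ≤ (x - y) * ∫ z in y..x, f' z ^ 2 := by
  rcases hxy.eq_or_lt with rfl | hlt
  · simp
  have hpos : 0 < x - y := sub_pos.mpr hlt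
  set m := (f x - f y) / (x - y) with hm
  have hi : ∫ z in y..x, f' z = f x - f y :=
    intervalIntegral.integral_eq_sub_of_hasDerivAt (fun z _ => hd z) (hc.intervalIntegrable _ _)
  have h0 : 0 ≤ ∫ z in y..x, (f' z - m) ^ 2 :=
    intervalIntegral.integral_nonneg hxy fun z _ => sq_nonneg _
  have h1 : ∫ z in y..x, (f' z - m) ^ 2
      = (∫ z in y..x, f' z ^ 2) - 2 * m * (f x - f y) + m ^ 2 * (x - y) := by
    have : ∀ z, (f' z - m) ^ 2 = f' z ^ 2 - 2 * m * f' z + m ^ 2 := fun z => by ring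
    simp_rw [this]
    rw [intervalIntegral.integral_add ((by fun_prop : Continuous _).intervalIntegrable _ _)
        ((by fun_prop : Continuous _).intervalIntegrable _ _),
      intervalIntegral.integral_sub ((by fun_prop : Continuous _).intervalIntegrable _ _)
        ((by fun_prop : Continuous _).intervalIntegrable _ _),
      intervalIntegral.integral_const_mul, hi, intervalIntegral.integral_const, smul_eq_mul]
    ring
  have hmx : m * (x - y) = f x - f y := div_mul_cancel₀ _ hpos.ne'
  rw [h1] at h0
  have := mul_nonneg hpos.le h0
  nlinarith

lemma integral_mono_subinterval {g : ℝ → ℝ} (hg : Continuous g) (h0 : ∀ x, 0 ≤ g x)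
    {y x u v : ℝ} (h1 : u ≤ y) (h2 : y ≤ x) (h3 : x ≤ v) :
    ∫ z in y..x, g z ≤ ∫ z in u..v, g z :=
  intervalIntegral.integral_mono_interval h1 h2 h3 (ae_of_all _ h0) (hg.intervalIntegrable _ _)

lemma abs_sub_le_integral_abs {f f' : ℝ → ℝ} (hd : ∀ x, HasDerivAt f (f' x) x)
    (hc : Continuous f') {x y : ℝ} (hx : x ∈ Icc (0:ℝ) 1) (hy : y ∈ Icc (0:ℝ) 1) :
    |f x - f y| ≤ ∫ z in (0:ℝ)..1, |f' z| := by
  wlog h : y ≤ x generalizing x y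
  · rw [abs_sub_comm]
    exact this hy hx (le_of_not_ge h)
  rw [← intervalIntegral.integral_eq_sub_of_hasDerivAt (fun z _ => hd z)
    (hc.intervalIntegrable y x)]
  exact (intervalIntegral.abs_integral_le_integral_abs h).trans
    (integral_mono_subinterval hc.abs (fun _ => abs_nonneg _) hy.1 h hx.2)

lemma abs_sub_le_sqrt_integral_sq {f f' : ℝ → ℝ} (hd : ∀ x, HasDerivAt f (f' x) x)
    (hc : Continuous f') {x y : ℝ} (hx : x ∈ Icc (0:ℝ) 1) (hy : y ∈ Icc (0:ℝ) 1) :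
    |f x - f y| ≤ √(∫ z in (0:ℝ)..1, f' z ^ 2) := by
  wlog h : y ≤ x generalizing x y
  · rw [abs_sub_comm]
    exact this hy hx (le_of_not_ge h)
  refine Real.abs_le_sqrt ((sq_sub_le_mul_integral_sq hd hc h).trans ?_)
  have h1 := integral_mono_subinterval (g := fun z => f' z ^ 2) (by fun_prop)
    (fun _ => sq_nonneg _) hy.1 h hx.2
  have h2 : 0 ≤ ∫ z in y..x, f' z ^ 2 := intervalIntegral.integral_nonneg h fun z _ => sq_nonneg _
  calc (x - y) * ∫ z in y..x, f' z ^ 2 ≤ 1 * ∫ z in y..x, f' z ^ 2 := by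
        gcongr; linarith [hx.2, hy.1]
    _ ≤ _ := by rwa [one_mul]

/-- A function with zero weighted mean is bounded by its oscillation. -/
lemma abs_le_of_weighted_mean_zero {ρ f : ℝ → ℝ} {K : ℝ} (hρ : Continuous ρ) (hf : Continuous f)
    (hρ0 : ∀ y, 0 ≤ ρ y) (hρ1 : ∫ y in (0:ℝ)..1, ρ y = 1)
    (hm : ∫ y in (0:ℝ)..1, ρ y * f y = 0) {x : ℝ}
    (hK : ∀ y ∈ Icc (0:ℝ) 1, |f x - f y| ≤ K) : |f x| ≤ K := by
  have h1 : f x = ∫ y in (0:ℝ)..1, ρ y * (f x - f y) := by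
    simp_rw [mul_sub]
    rw [intervalIntegral.integral_sub ((by fun_prop : Continuous _).intervalIntegrable _ _)
      ((by fun_prop : Continuous _).intervalIntegrable _ _), hm,
      intervalIntegral.integral_mul_const, hρ1]
    ring
  have h2 : ∫ y in (0:ℝ)..1, ρ y * K = K := by
    rw [intervalIntegral.integral_mul_const, hρ1, one_mul]
  rw [h1]
  refine (intervalIntegral.abs_integral_le_integral_abs zero_le_one).trans ?_
  refine le_trans ?_ h2.le
  refine intervalIntegral.integral_mono_on zero_le_one
    ((by fun_prop : Continuous _).intervalIntegrable _ _)
    ((by fun_prop : Continuous _).intervalIntegrable _ _) fun y hy => ?_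
  rw [abs_mul, abs_of_nonneg (hρ0 y)]
  exact mul_le_mul_of_nonneg_left (hK y hy) (hρ0 y)

lemma holderHalfNorm_le {f f' : ℝ → ℝ} (hd : ∀ x, HasDerivAt f (f' x) x)
    (hc : Continuous f') (hp : ∀ x, f (x + 1) = f x) (hp' : ∀ x, f' (x + 1) = f' x) {K : ℝ}
    (hK : ∀ x ∈ Icc (0:ℝ) 1, |f x| ≤ K) (hK0 : 0 ≤ K) :
    holderHalfNorm f ≤ K + √(∫ z in (0:ℝ)..1, f' z ^ 2) := by
  have hper : Function.Periodic f 1 := hp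
  refine add_le_add (Real.iSup_le (fun x => ?_) hK0)
    (Real.iSup_le (fun q => ?_) (Real.sqrt_nonneg _))
  · obtain ⟨y, hy, hxy⟩ := hper.exists_mem_Ico₀ one_pos x
    rw [hxy]
    exact hK y ⟨hy.1, hy.2.le⟩
  split_ifs with hq
  · exact Real.sqrt_nonneg _
  have key : ∀ x y : ℝ, |x - y| ≤ 1 → (f x - f y) ^ 2 ≤ |x - y| * ∫ z in (0:ℝ)..1, f' z ^ 2 := by
    intro x y hxy
    wlog h : y ≤ x generalizing x y
    · rw [abs_sub_comm, ← neg_sub, neg_sq]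
      exact this y x (by rwa [abs_sub_comm]) (le_of_not_ge h)
    have hp2 : Function.Periodic (fun z => f' z ^ 2) 1 := fun z => by simp only [hp']
    rw [abs_of_nonneg (sub_nonneg.mpr h)] at hxy ⊢
    refine (sq_sub_le_mul_integral_sq hd hc h).trans
      (mul_le_mul_of_nonneg_left ?_ (sub_nonneg.mpr h))
    have h1 := integral_mono_subinterval (g := fun z => f' z ^ 2) (v := y + 1) (by fun_prop)
      (fun _ => sq_nonneg _) le_rfl h (by linarith)
    have h2 := hp2.intervalIntegral_add_eq y 0
    rw [zero_add] at h2
    exact h1.trans h2.le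
  have hdist : dist ((q.1 : AddCircle (1:ℝ))) ((q.2 : AddCircle (1:ℝ)))
      = |q.1 - (q.2 + round (q.1 - q.2))| := by
    rw [dist_eq_norm, ← AddCircle.coe_sub, AddCircle.norm_eq]
    simp [sub_sub]
  have hpos : 0 < dist ((q.1 : AddCircle (1:ℝ))) ((q.2 : AddCircle (1:ℝ))) := dist_pos.mpr hq
  rw [div_le_iff₀ (Real.sqrt_pos.mpr hpos), ← Real.sqrt_mul
    (intervalIntegral.integral_nonneg zero_le_one fun z _ => sq_nonneg _)]
  have hshift : f q.2 = f (q.2 + round (q.1 - q.2)) := by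
    have := hper.int_mul (round (q.1 - q.2)) q.2
    rw [mul_one] at this
    exact this.symm
  refine Real.abs_le_sqrt ?_
  rw [hshift, hdist, mul_comm]
  refine key _ _ ?_
  rw [← sub_sub]
  exact (abs_sub_round _).trans (by norm_num)

/-! ### The relative pressure potential -/

/-- The specific relative potential `h(s) = ∫₁ˢ a (σ^γ - 1) / σ² dσ`, so that `s * h s` is the
pressure potential relative to the constant state `1`. -/
noncomputable def relPot (a γ s : ℝ) : ℝ :=
  if γ = 1 then a * (Real.log s + s⁻¹ - 1) else a * ((s ^ (γ - 1) - 1) / (γ - 1) + s⁻¹ - 1)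

lemma rpow_eq_mul_rpow_sub_one {s : ℝ} (hs : 0 < s) (γ : ℝ) : s ^ γ = s * s ^ (γ - 1) := by
  rw [Real.rpow_sub_one hs.ne']
  field_simp

lemma relPot_one (a γ : ℝ) : relPot a γ 1 = 0 := by
  unfold relPot
  split_ifs <;> simp

lemma hasDerivAt_relPot (a γ : ℝ) {s : ℝ} (hs : 0 < s) :
    HasDerivAt (relPot a γ) (a * (s ^ γ - 1) / s ^ 2) s := by
  by_cases h : γ = 1
  · have hf : relPot a γ = fun s => a * (Real.log s + s⁻¹ - 1) := by
      funext s; simp [relPot, h]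
    rw [hf]
    refine HasDerivAt.congr_deriv ((((Real.hasDerivAt_log hs.ne').add
      (hasDerivAt_inv hs.ne')).sub_const 1).const_mul a) ?_
    rw [h, Real.rpow_one]
    field_simp
    ring
  · have hf : relPot a γ = fun s => a * ((s ^ (γ - 1) - 1) / (γ - 1) + s⁻¹ - 1) := by
      funext s; simp [relPot, h]
    have h' : γ - 1 ≠ 0 := sub_ne_zero.mpr h
    rw [hf]
    refine HasDerivAt.congr_deriv ((((((Real.hasDerivAt_rpow_const (p := γ - 1)
      (Or.inl hs.ne')).sub_const 1).div_const (γ - 1)).add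
      (hasDerivAt_inv hs.ne')).sub_const 1).const_mul a) ?_
    rw [rpow_eq_mul_rpow_sub_one hs γ, rpow_eq_mul_rpow_sub_one hs (γ - 1)]
    field_simp
    ring

lemma nonneg_of_deriv_mul_sub_nonneg {f f' : ℝ → ℝ} {c b : ℝ}
    (hd : ∀ s ∈ Icc c b, HasDerivAt f (f' s) s) (h1 : f 1 = 0) (hc : c ≤ 1) (hb : 1 ≤ b)
    (hf' : ∀ s ∈ Icc c b, 0 ≤ f' s * (s - 1)) {s : ℝ} (hs : s ∈ Icc c b) : 0 ≤ f s := by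
  rcases lt_trichotomy s 1 with h | h | h
  · have hsub : ∀ r ∈ Icc s 1, r ∈ Icc c b := fun r hr => ⟨hs.1.trans hr.1, hr.2.trans hb⟩
    obtain ⟨ξ, hξ, he⟩ := exists_hasDerivAt_eq_slope f f' h
      (fun r hr => (hd r (hsub r hr)).continuousAt.continuousWithinAt)
      (fun r hr => hd r (hsub r (Ioo_subset_Icc_self hr)))
    have := hf' ξ (hsub ξ (Ioo_subset_Icc_self hξ))
    have hle : f' ξ ≤ 0 := by nlinarith [hξ.2]
    rw [he, h1, div_le_iff₀ (by linarith)] at hle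
    linarith
  · rw [h, h1]
  · have hsub : ∀ r ∈ Icc 1 s, r ∈ Icc c b := fun r hr => ⟨hc.trans hr.1, hr.2.trans hs.2⟩
    obtain ⟨ξ, hξ, he⟩ := exists_hasDerivAt_eq_slope f f' h
      (fun r hr => (hd r (hsub r hr)).continuousAt.continuousWithinAt)
      (fun r hr => hd r (hsub r (Ioo_subset_Icc_self hr)))
    have := hf' ξ (hsub ξ (Ioo_subset_Icc_self hξ))
    have hle : 0 ≤ f' ξ := by nlinarith [hξ.1]
    rw [he, h1, le_div_iff₀ (by linarith)] at hle
    linarith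

section Pressure

variable {a γ : ℝ}

lemma rpow_sub_one_mul_ge (hγ1 : 1 ≤ γ) {s : ℝ} (hs : 0 < s) :
    (s - 1) ^ 2 ≤ (s ^ γ - 1) * (s - 1) := by
  rcases le_total 1 s with h | h
  · have : s ≤ s ^ γ := Real.self_le_rpow_of_one_le h hγ1
    nlinarith
  · have : s ^ γ ≤ s := Real.rpow_le_self_of_le_one hs.le h hγ1
    nlinarith

lemma abs_rpow_sub_one_le (hγ1 : 1 ≤ γ) (hγ2 : γ ≤ 2) {s : ℝ} (hs : 0 < s) :
    |s ^ γ - 1| ≤ (s + 1) * |s - 1| := by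
  rcases le_total 1 s with h | h
  · have h1 : s ≤ s ^ γ := Real.self_le_rpow_of_one_le h hγ1
    have h2 : s ^ γ ≤ s ^ (2:ℝ) := Real.rpow_le_rpow_of_exponent_le h hγ2
    rw [Real.rpow_two] at h2
    rw [abs_of_nonneg (by linarith), abs_of_nonneg (by linarith)]
    nlinarith
  · have h1 : s ^ γ ≤ s := Real.rpow_le_self_of_le_one hs.le h hγ1
    have h2 : s ^ (2:ℝ) ≤ s ^ γ := Real.rpow_le_rpow_of_exponent_ge hs h hγ2
    rw [Real.rpow_two] at h2
    rw [abs_of_nonpos (by linarith), abs_of_nonpos (by linarith)]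
    nlinarith

lemma relPot_lower (ha : 0 < a) (hγ1 : 1 ≤ γ) {b s : ℝ} (hb : 1 ≤ b) (hs : 0 < s) (hsb : s ≤ b) :
    a / (2 * b ^ 2) * (s - 1) ^ 2 ≤ relPot a γ s := by
  have hmin : 0 < min s 1 := lt_min hs one_pos
  rw [← sub_nonneg]
  refine nonneg_of_deriv_mul_sub_nonneg (c := min s 1) (b := b)
    (f := fun s => relPot a γ s - a / (2 * b ^ 2) * (s - 1) ^ 2)
    (f' := fun s => a * (s ^ γ - 1) / s ^ 2 - a / b ^ 2 * (s - 1))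
    (fun r hr => ?_) (by simp [relPot_one]) (min_le_right _ _) hb (fun r hr => ?_)
    ⟨min_le_left _ _, hsb⟩
  · refine HasDerivAt.congr_deriv ((hasDerivAt_relPot a γ (hmin.trans_le hr.1)).sub
      ((((hasDerivAt_id r).sub_const 1).pow 2).const_mul (a / (2 * b ^ 2)))) ?_
    simp only [id]
    field_simp
    ring
  · have hr0 : 0 < r := hmin.trans_le hr.1
    have h1 := rpow_sub_one_mul_ge hγ1 hr0
    have h2 : 1 / b ^ 2 ≤ 1 / r ^ 2 :=
      one_div_le_one_div_of_le (by positivity) (pow_le_pow_left₀ hr0.le hr.2 2)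
    have h3 : 1 / b ^ 2 * (r - 1) ^ 2 ≤ 1 / r ^ 2 * ((r ^ γ - 1) * (r - 1)) :=
      mul_le_mul h2 h1 (sq_nonneg _) (by positivity)
    have h4 := mul_nonneg ha.le (sub_nonneg.mpr h3)
    refine h4.trans_eq ?_
    field_simp

lemma relPot_nonneg (ha : 0 < a) (hγ1 : 1 ≤ γ) {s : ℝ} (hs : 0 < s) : 0 ≤ relPot a γ s :=
  le_trans (by positivity) (relPot_lower ha hγ1 (le_max_right s 1) hs (le_max_left s 1))

lemma relPot_upper (ha : 0 < a) (hγ1 : 1 ≤ γ) (hγ2 : γ ≤ 2) {c b s : ℝ} (hc0 : 0 < c)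
    (hc : c ≤ 1) (hb : 1 ≤ b) (hs : s ∈ Icc c b) :
    relPot a γ s ≤ a * (b + 1) / (2 * c ^ 2) * (s - 1) ^ 2 := by
  rw [← sub_nonneg]
  refine nonneg_of_deriv_mul_sub_nonneg (c := c) (b := b)
    (f := fun s => a * (b + 1) / (2 * c ^ 2) * (s - 1) ^ 2 - relPot a γ s)
    (f' := fun s => a * (b + 1) / c ^ 2 * (s - 1) - a * (s ^ γ - 1) / s ^ 2)
    (fun r hr => ?_) (by simp [relPot_one]) hc hb (fun r hr => ?_) hs
  · refine HasDerivAt.congr_deriv (((((hasDerivAt_id r).sub_const 1).pow 2).const_mul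
      (a * (b + 1) / (2 * c ^ 2))).sub
      (hasDerivAt_relPot a γ (hc0.trans_le hr.1))) ?_
    simp only [id]
    field_simp
    ring
  · have hr0 : 0 < r := hc0.trans_le hr.1
    have h1 : (r ^ γ - 1) * (r - 1) ≤ (b + 1) * (r - 1) ^ 2 := by
      calc (r ^ γ - 1) * (r - 1) ≤ |r ^ γ - 1| * |r - 1| := by
            rw [← abs_mul]; exact le_abs_self _
        _ ≤ (r + 1) * |r - 1| * |r - 1| := by
            gcongr; exact abs_rpow_sub_one_le hγ1 hγ2 hr0
        _ = (r + 1) * (r - 1) ^ 2 := by rw [mul_assoc, abs_mul_abs_self, sq]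
        _ ≤ (b + 1) * (r - 1) ^ 2 := by gcongr; exact hr.2
    have h2 : 1 / r ^ 2 ≤ 1 / c ^ 2 :=
      one_div_le_one_div_of_le (by positivity) (pow_le_pow_left₀ hc0.le hr.1 2)
    have h0 : 0 ≤ (r ^ γ - 1) * (r - 1) := (sq_nonneg _).trans (rpow_sub_one_mul_ge hγ1 hr0)
    have h3 : 1 / r ^ 2 * ((r ^ γ - 1) * (r - 1)) ≤ 1 / c ^ 2 * ((b + 1) * (r - 1) ^ 2) :=
      mul_le_mul h2 h1 h0 (by positivity)
    have h4 := mul_nonneg ha.le (sub_nonneg.mpr h3)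
    refine h4.trans_eq ?_
    field_simp

lemma pressure_le_relPot (ha : 0 < a) (hγ1 : 1 ≤ γ) (hγ2 : γ ≤ 2) {s : ℝ} (hs : 0 < s) :
    a * s ^ γ ≤ s * relPot a γ s + 2 * a * s + a := by
  rcases le_total 1 s with h | h
  · have key : 0 ≤ relPot a γ s - a * s ^ (γ - 1) - a * s⁻¹ + 2 * a := by
      refine nonneg_of_deriv_mul_sub_nonneg (c := 1) (b := s)
        (f := fun s => relPot a γ s - a * s ^ (γ - 1) - a * s⁻¹ + 2 * a)
        (f' := fun s => a * (2 - γ) * s ^ (γ - 2))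
        (fun r hr => ?_) (by simp [relPot_one]; ring) le_rfl h (fun r hr => ?_) ⟨h, le_rfl⟩
      · have hr0 : 0 < r := one_pos.trans_le hr.1
        refine HasDerivAt.congr_deriv ((((hasDerivAt_relPot a γ hr0).sub
          ((Real.hasDerivAt_rpow_const (p := γ - 1) (Or.inl hr0.ne')).const_mul a)).sub
          ((hasDerivAt_inv hr0.ne').const_mul a)).add_const (2 * a)) ?_
        have e : γ - 1 - 1 = γ - 2 := by ring
        rw [rpow_eq_mul_rpow_sub_one hr0 γ, rpow_eq_mul_rpow_sub_one hr0 (γ - 1), e]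
        field_simp
        ring
      · have hr0 : 0 < r := one_pos.trans_le hr.1
        have : 0 ≤ 2 - γ := by linarith
        have : 0 ≤ r - 1 := by linarith [hr.1]
        positivity
    have h2 := mul_nonneg hs.le key
    have h3 : s * (relPot a γ s - a * s ^ (γ - 1) - a * s⁻¹ + 2 * a)
        = s * relPot a γ s - a * s ^ γ - a + 2 * a * s := by
      rw [rpow_eq_mul_rpow_sub_one hs γ]
      field_simp
    linarith
  · have h1 : s ^ γ ≤ 1 := Real.rpow_le_one hs.le h (by linarith)
    have h2 := mul_nonneg hs.le (relPot_nonneg ha hγ1 hs)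
    have h3 := mul_pos ha hs
    nlinarith

lemma pressure_ge_tangent (ha : 0 < a) (hγ1 : 1 ≤ γ) {s : ℝ} (hs : 0 < s) :
    a + a * γ * (s - 1) ≤ a * s ^ γ := by
  have := one_add_mul_self_le_rpow_one_add (s := s - 1) (by linarith) hγ1
  rw [add_sub_cancel] at this
  nlinarith

lemma Ppot_nonneg (ha : 0 < a) (hγ1 : 1 ≤ γ) {s : ℝ} (hs : 0 < s) : 0 ≤ Ppot a γ s := by
  unfold Ppot
  split_ifs with h
  · have h1 := Real.one_sub_inv_le_log_of_pos hs
    have h2 : s * (1 - s⁻¹) ≤ s * Real.log s := mul_le_mul_of_nonneg_left h1 hs.le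
    have h3 : s * (1 - s⁻¹) = s - 1 := by field_simp
    exact mul_nonneg ha.le (by linarith)
  · have : 0 ≤ γ - 1 := by linarith
    positivity

end Pressure

/-! ### Truncated squares -/

lemma hasDerivAt_max_zero_sq (y : ℝ) :
    HasDerivAt (fun y : ℝ => (max y 0) ^ 2) (2 * max y 0) y := by
  rcases lt_trichotomy y 0 with h | h | h
  · rw [max_eq_right h.le, mul_zero]
    refine (hasDerivAt_const y (0:ℝ)).congr_of_eventuallyEq ?_
    filter_upwards [Iio_mem_nhds h] with z hz
    rw [max_eq_right (le_of_lt hz)]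
    norm_num
  · subst h
    rw [max_self, mul_zero]
    refine HasDerivAt.congr_deriv (f' := 2 * 0) ?_ (by norm_num)
    rw [hasDerivAt_iff_isLittleO_nhds_zero]
    simp only [zero_add, max_self, mul_zero, smul_zero, sub_zero]
    have : (fun h : ℝ => h ^ 2) =o[𝓝 0] fun h => h := by
      simpa using Asymptotics.isLittleO_pow_pow (𝕜 := ℝ) (show 1 < 2 by norm_num)
    refine Asymptotics.IsBigO.trans_isLittleO (Asymptotics.IsBigO.of_bound 1 ?_) this
    filter_upwards with z
    rcases le_total z 0 with hz | hz
    · rw [max_eq_right hz]; simp; positivity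
    · rw [max_eq_left hz]; simp
  · rw [max_eq_left h.le]
    refine HasDerivAt.congr_of_eventuallyEq (f := fun y => y ^ 2) ?_ ?_
    · simpa using hasDerivAt_pow 2 y
    filter_upwards [Ioi_mem_nhds h] with z hz
    rw [max_eq_left (le_of_lt hz)]

/-! ### Mean-zero primitives -/

/-- The primitive in the space variable which has zero mean over `[0, 1]`. -/
noncomputable def zprim (f : ℝ → ℝ → ℝ) (t x : ℝ) : ℝ :=
  (∫ y in (0:ℝ)..x, f t y) - ∫ z in (0:ℝ)..1, ∫ y in (0:ℝ)..z, f t y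

section Zprim

variable {f : ℝ → ℝ → ℝ}

lemma continuous_slice (hf : Continuous (Function.uncurry f)) (t : ℝ) : Continuous (f t) :=
  hf.comp (f := fun x => (t, x)) (by fun_prop)

lemma continuous_prim (hf : Continuous (Function.uncurry f)) :
    Continuous (fun z : ℝ × ℝ => ∫ y in (0:ℝ)..z.2, f z.1 y) :=
  intervalIntegral.continuous_parametric_primitive_of_continuous hf

lemma continuous_zprim (hf : Continuous (Function.uncurry f)) :
    Continuous (fun z : ℝ × ℝ => zprim f z.1 z.2) := by
  refine (continuous_prim hf).sub ?_
  have : Continuous (Function.uncurry fun t x => ∫ y in (0:ℝ)..x, f t y) := continuous_prim hf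
  exact (intervalIntegral.continuous_parametric_intervalIntegral_of_continuous (a₀ := 0) this
    (s := fun _ => 1) continuous_const).comp continuous_fst

lemma hasDerivAt_zprim_space (hf : Continuous (Function.uncurry f)) (t x : ℝ) :
    HasDerivAt (zprim f t) (f t x) x :=
  (intervalIntegral.integral_hasDerivAt_right ((continuous_slice hf t).intervalIntegrable _ _)
    ((continuous_slice hf t).stronglyMeasurableAtFilter _ _)
    (continuous_slice hf t).continuousAt).sub_const _

lemma hasDerivAt_zprim_time (hf : ContDiff ℝ ∞ (Function.uncurry f)) (t x : ℝ) :
    HasDerivAt (fun s => zprim f s x) (zprim (pt f) t x) t := by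
  have h1 : ∀ s y : ℝ, HasDerivAt (fun s => ∫ z in (0:ℝ)..y, f s z)
      (∫ z in (0:ℝ)..y, pt f s z) s := fun s y =>
    hasDerivAt_integral_of_continuousOn (S := univ) isOpen_univ hf.continuous.continuousOn
      (contDiff_pt hf).continuous.continuousOn (fun r _ z => hasDerivAt_pt hf r z) (mem_univ s) 0 y
  exact (h1 t x).sub (hasDerivAt_integral_of_continuousOn (S := univ) isOpen_univ
    (continuous_prim hf.continuous).continuousOn
    (continuous_prim (contDiff_pt hf).continuous).continuousOn (fun r _ z => h1 r z)
    (mem_univ t) 0 1)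

lemma integral_zprim (hf : Continuous (Function.uncurry f)) (t : ℝ) :
    ∫ x in (0:ℝ)..1, zprim f t x = 0 := by
  have hc : Continuous fun x => ∫ y in (0:ℝ)..x, f t y :=
    (continuous_prim hf).comp (f := fun x => (t, x)) (by fun_prop)
  unfold zprim
  rw [intervalIntegral.integral_sub (hc.intervalIntegrable _ _) intervalIntegrable_const]
  simp

lemma zprim_eq_of_hasDerivAt (hf : Continuous (Function.uncurry f)) {t : ℝ} {Q : ℝ → ℝ}
    (hQ : ∀ x, HasDerivAt Q (f t x) x) (x : ℝ) :
    zprim f t x = Q x - ∫ y in (0:ℝ)..1, Q y := by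
  have hi : ∀ x, ∫ y in (0:ℝ)..x, f t y = Q x - Q 0 := fun x =>
    intervalIntegral.integral_eq_sub_of_hasDerivAt (fun z _ => hQ z)
      ((continuous_slice hf t).intervalIntegrable _ _)
  have hc : Continuous Q := continuous_iff_continuousAt.mpr fun x => (hQ x).continuousAt
  simp only [zprim, hi]
  rw [intervalIntegral.integral_sub (hc.intervalIntegrable _ _) intervalIntegrable_const]
  simp

lemma zprim_one (t : ℝ) (h : ∫ y in (0:ℝ)..1, f t y = 0) : zprim f t 1 = zprim f t 0 := by
  simp [zprim, h]

end Zprim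

/-! ### Global smooth solutions and their balance laws -/

/-- Global smooth solutions of the isentropic compressible Navier–Stokes system on the torus, with
unit mass and zero momentum. -/
structure IsSol (a γ ν : ℝ) (η w : ℝ → ℝ → ℝ) : Prop where
  smooth_η : ContDiff ℝ ∞ (Function.uncurry η)
  smooth_w : ContDiff ℝ ∞ (Function.uncurry w)
  per_η : ∀ t x : ℝ, η t (x + 1) = η t x
  per_w : ∀ t x : ℝ, w t (x + 1) = w t x
  pos : ∀ t x : ℝ, 0 ≤ t → 0 < η t x
  mass : ∀ t x : ℝ, 0 ≤ t →
    deriv (fun s => η s x) t + deriv (fun y => η t y * w t y) x = 0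
  mom : ∀ t x : ℝ, 0 ≤ t →
    η t x * (deriv (fun s => w s x) t + w t x * deriv (w t) x)
      - ν * deriv (deriv (w t)) x + deriv (fun y => a * η t y ^ γ) x = 0
  unit_mass : (∫ x in (0:ℝ)..1, η 0 x) = 1
  zero_mom : (∫ x in (0:ℝ)..1, η 0 x * w 0 x) = 0

namespace IsSol

variable {a γ ν : ℝ} {η w : ℝ → ℝ → ℝ}

lemma hasDerivAt_pow_space (hs : IsSol a γ ν η w) {t : ℝ} (x : ℝ) (hp : 0 < η t x) :
    HasDerivAt (fun y => η t y ^ γ) (γ * η t x ^ (γ - 1) * px η t x) x :=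
  ((hasDerivAt_px hs.smooth_η t x).rpow_const (Or.inl hp.ne')).congr_deriv (by ring)

lemma hasDerivAt_pow_time (hs : IsSol a γ ν η w) {t : ℝ} (x : ℝ) (hp : 0 < η t x) :
    HasDerivAt (fun s => η s x ^ γ) (γ * η t x ^ (γ - 1) * pt η t x) t :=
  ((hasDerivAt_pt hs.smooth_η t x).rpow_const (Or.inl hp.ne')).congr_deriv (by ring)

lemma mass_eq (hs : IsSol a γ ν η w) {t : ℝ} (ht : 0 ≤ t) (x : ℝ) :
    pt η t x = -(px η t x * w t x + η t x * px w t x) := by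
  have h := hs.mass t x ht
  have h' : deriv (fun y => η t y * w t y) x = px η t x * w t x + η t x * px w t x :=
    ((hasDerivAt_px hs.smooth_η t x).mul (hasDerivAt_px hs.smooth_w t x)).deriv
  rw [h'] at h
  exact eq_neg_of_add_eq_zero_left h

lemma mom_eq (hs : IsSol a γ ν η w) {t : ℝ} (ht : 0 ≤ t) (x : ℝ) :
    ν * px (px w) t x = η t x * (pt w t x + w t x * px w t x)
      + a * (γ * η t x ^ (γ - 1) * px η t x) := by
  have h := hs.mom t x ht
  rw [((hs.hasDerivAt_pow_space x (hs.pos t x ht)).const_mul a).deriv] at h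
  change η t x * (pt w t x + w t x * px w t x) - ν * px (px w) t x + _ = 0 at h
  linarith

/-- The open set of times at which the density is positive. -/
def posTimes (η : ℝ → ℝ → ℝ) : Set ℝ := {t | ∀ x, 0 < η t x}

lemma isOpen_posTimes (hs : IsSol a γ ν η w) : IsOpen (posTimes η) := by
  have hred : posTimes η = {t | ∀ x ∈ Icc (0:ℝ) 1, 0 < η t x} := by
    ext t
    refine ⟨fun h x _ => h x, fun h x => ?_⟩
    obtain ⟨y, hy, hxy⟩ := (show Function.Periodic (η t) 1 from hs.per_η t).exists_mem_Ico₀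
      one_pos x
    rw [hxy]
    exact h y ⟨hy.1, hy.2.le⟩
  rw [hred, isOpen_iff_mem_nhds]
  intro t ht
  exact isCompact_Icc.eventually_forall_of_forall_eventually fun y hy =>
    (hs.smooth_η.continuous.tendsto (t, y)).eventually_const_lt (ht y hy)

lemma mem_posTimes (hs : IsSol a γ ν η w) {t : ℝ} (ht : 0 ≤ t) : t ∈ posTimes η :=
  fun x => hs.pos t x ht

lemma cont_η (hs : IsSol a γ ν η w) : Continuous (fun z : ℝ × ℝ => η z.1 z.2) :=
  hs.smooth_η.continuous

lemma cont_w (hs : IsSol a γ ν η w) : Continuous (fun z : ℝ × ℝ => w z.1 z.2) :=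
  hs.smooth_w.continuous

lemma cont_ηt (hs : IsSol a γ ν η w) : Continuous (fun z : ℝ × ℝ => pt η z.1 z.2) :=
  (contDiff_pt hs.smooth_η).continuous

lemma cont_wt (hs : IsSol a γ ν η w) : Continuous (fun z : ℝ × ℝ => pt w z.1 z.2) :=
  (contDiff_pt hs.smooth_w).continuous

lemma cont_wx (hs : IsSol a γ ν η w) : Continuous (fun z : ℝ × ℝ => px w z.1 z.2) :=
  (contDiff_px hs.smooth_w).continuous

lemma cont_wtx (hs : IsSol a γ ν η w) : Continuous (fun z : ℝ × ℝ => pt (px w) z.1 z.2) :=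
  (contDiff_pt (contDiff_px hs.smooth_w)).continuous

lemma contOn_pow (hs : IsSol a γ ν η w) (p : ℝ) :
    ContinuousOn (fun z : ℝ × ℝ => η z.1 z.2 ^ p) (posTimes η ×ˢ univ) :=
  hs.cont_η.continuousOn.rpow_const fun z hz => Or.inl (hz.1 z.2).ne'

lemma contOn_relPot (hs : IsSol a γ ν η w) :
    ContinuousOn (fun z : ℝ × ℝ => relPot a γ (η z.1 z.2)) (posTimes η ×ˢ univ) := fun z hz =>
  (ContinuousAt.comp (f := fun z : ℝ × ℝ => η z.1 z.2)
    (hasDerivAt_relPot a γ (hz.1 z.2)).continuousAt hs.cont_η.continuousAt).continuousWithinAt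

lemma slice_pow (hs : IsSol a γ ν η w) (p : ℝ) {t : ℝ} (ht : 0 ≤ t) :
    Continuous (fun x => η t x ^ p) :=
  (continuous_slice hs.smooth_η.continuous t).rpow_const fun x => Or.inl (hs.pos t x ht).ne'

lemma at_one (h : ∀ t x : ℝ, η t (x + 1) = η t x) (t : ℝ) : η t 1 = η t 0 := by
  simpa using h t 0

/-- The energy relative to the constant state `(1, 0)`. -/
noncomputable def energy (a γ : ℝ) (η w : ℝ → ℝ → ℝ) (t : ℝ) : ℝ :=
  ∫ x in (0:ℝ)..1, (1 / 2 * (η t x * w t x ^ 2) + η t x * relPot a γ (η t x))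

lemma hasDerivAt_energy (hs : IsSol a γ ν η w) {t : ℝ} (ht : 0 ≤ t) :
    HasDerivAt (energy a γ η w) (∫ x in (0:ℝ)..1, -ν * px w t x ^ 2) t := by
  have c1 := hs.cont_η.continuousOn (s := posTimes η ×ˢ univ)
  have c2 := hs.cont_w.continuousOn (s := posTimes η ×ˢ univ)
  have c3 := hs.cont_ηt.continuousOn (s := posTimes η ×ˢ univ)
  have c4 := hs.cont_wt.continuousOn (s := posTimes η ×ˢ univ)
  have c5 := hs.contOn_relPot
  have c6 := hs.contOn_pow γ
  have c7 := continuous_slice (contDiff_px hs.smooth_w).continuous t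
  refine hasDerivAt_integral_of_flux hs.isOpen_posTimes
    (f' := fun t x => 1 / 2 * (pt η t x * w t x ^ 2 + η t x * (2 * w t x * pt w t x))
      + (pt η t x * relPot a γ (η t x)
        + η t x * (a * (η t x ^ γ - 1) / η t x ^ 2 * pt η t x)))
    (G := fun x => ν * (w t x * px w t x) - (1 / 2 * (η t x * w t x ^ 2)
      + η t x * relPot a γ (η t x) + a * (η t x ^ γ - 1)) * w t x)
    (by fun_prop) ?_ (fun s hs' x => ?_) (hs.mem_posTimes ht) (by fun_prop) (fun x => ?_) ?_
  · have hne : ∀ z ∈ posTimes η ×ˢ (univ : Set ℝ), η z.1 z.2 ^ 2 ≠ 0 := fun z hz =>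
      pow_ne_zero 2 (hz.1 z.2).ne'
    exact (((c3.mul (c2.pow 2)).add (c1.mul ((c2.const_mul 2).mul c4))).const_mul (1 / 2)).add
      ((c3.mul c5).add (c1.mul ((((c6.sub continuousOn_const).const_mul a).div (c1.pow 2) hne).mul
        c3)))
  · have h1 := hasDerivAt_pt hs.smooth_η s x
    have h2 := hasDerivAt_pt hs.smooth_w s x
    have h3 := (hasDerivAt_relPot a γ (hs' x)).comp s h1
    exact (((h1.mul (h2.pow 2)).const_mul (1 / 2)).add (h1.mul h3)).congr_deriv (by simp)
  · have hp := hs.pos t x ht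
    have h1 := hasDerivAt_px hs.smooth_η t x
    have h2 := hasDerivAt_px hs.smooth_w t x
    have h3 := (hasDerivAt_relPot a γ hp).comp x h1
    have h4 := hasDerivAt_px (contDiff_px hs.smooth_w) t x
    have h5 := hs.hasDerivAt_pow_space x hp
    refine HasDerivAt.congr_deriv (((h2.mul h4).const_mul ν).sub
      (((((h1.mul (h2.pow 2)).const_mul (1 / 2)).add (h1.mul h3)).add
        ((h5.sub_const 1).const_mul a)).mul h2)) ?_
    have e1 := hs.mass_eq ht x
    have e2 := hs.mom_eq ht x
    rw [e1]
    simp only [Function.comp_apply, Pi.mul_apply, Pi.add_apply, Pi.pow_apply]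
    rw [rpow_eq_mul_rpow_sub_one hp γ]
    generalize η t x ^ (γ - 1) = r at *
    generalize relPot a γ (η t x) = h at *
    field_simp
    linear_combination (2 * w t x * η t x) * e2
  · simp only [at_one hs.per_η, at_one hs.per_w, at_one (px_periodic hs.per_w)]

lemma integral_density (hs : IsSol a γ ν η w) {t : ℝ} (ht : 0 ≤ t) :
    ∫ x in (0:ℝ)..1, η t x = 1 := by
  refine Eq.trans ?_ hs.unit_mass
  refine eq_initial_of_hasDerivAt_zero (f := fun t => ∫ x in (0:ℝ)..1, η t x) (fun t ht => ?_) ht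
  have := hasDerivAt_integral_of_flux isOpen_univ (f := η) (f' := pt η) (g := fun _ => 0)
    (G := fun x => -(η t x * w t x))
    hs.cont_η.continuousOn hs.cont_ηt.continuousOn (fun s _ x => hasDerivAt_pt hs.smooth_η s x)
    (mem_univ t) continuous_const (fun x => ?_) (by simp only [at_one hs.per_η, at_one hs.per_w])
  · simpa using this
  · refine HasDerivAt.congr_deriv
      ((hasDerivAt_px hs.smooth_η t x).mul (hasDerivAt_px hs.smooth_w t x)).neg ?_
    rw [hs.mass_eq ht x, sub_zero]

/-- The momentum density. -/
def momentum (η w : ℝ → ℝ → ℝ) (t x : ℝ) : ℝ := η t x * w t x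

lemma smooth_momentum (hs : IsSol a γ ν η w) :
    ContDiff ℝ ∞ (Function.uncurry (momentum η w)) := hs.smooth_η.mul hs.smooth_w

/-- The momentum equation in conservation form. -/
lemma hasDerivAt_momentum_flux (hs : IsSol a γ ν η w) {t : ℝ} (ht : 0 ≤ t) (x : ℝ) :
    HasDerivAt (fun x => ν * px w t x - a * η t x ^ γ - η t x * w t x ^ 2)
      (pt (momentum η w) t x) x := by
  have hp := hs.pos t x ht
  have h1 := hasDerivAt_px hs.smooth_η t x
  have h2 := hasDerivAt_px hs.smooth_w t x
  have h4 := hasDerivAt_px (contDiff_px hs.smooth_w) t x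
  have h5 := hs.hasDerivAt_pow_space x hp
  have h6 : pt (momentum η w) t x = pt η t x * w t x + η t x * pt w t x :=
    ((hasDerivAt_pt hs.smooth_η t x).mul (hasDerivAt_pt hs.smooth_w t x)).deriv
  refine HasDerivAt.congr_deriv (((h4.const_mul ν).sub (h5.const_mul a)).sub
    (h1.mul (h2.pow 2))) ?_
  have e1 := hs.mass_eq ht x
  have e2 := hs.mom_eq ht x
  rw [h6, e1]
  linear_combination e2

lemma integral_momentum (hs : IsSol a γ ν η w) {t : ℝ} (ht : 0 ≤ t) :
    ∫ x in (0:ℝ)..1, momentum η w t x = 0 := by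
  refine Eq.trans ?_ hs.zero_mom
  refine eq_initial_of_hasDerivAt_zero (f := fun t => ∫ x in (0:ℝ)..1, momentum η w t x)
    (fun t ht => ?_) ht
  have := hasDerivAt_integral_of_flux isOpen_univ (g := fun _ => 0)
    hs.smooth_momentum.continuous.continuousOn
    (contDiff_pt hs.smooth_momentum).continuous.continuousOn
    (fun s _ x => hasDerivAt_pt hs.smooth_momentum s x)
    (mem_univ t) continuous_const
    (fun x => by simpa using hs.hasDerivAt_momentum_flux ht x)
    (by simp only [at_one hs.per_η, at_one hs.per_w, at_one (px_periodic hs.per_w)])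
  simpa using this

/-- The mean-zero primitive of the momentum. -/
noncomputable def phi (η w : ℝ → ℝ → ℝ) : ℝ → ℝ → ℝ := zprim (momentum η w)

/-- The mean momentum flux. -/
noncomputable def meanFlux (a γ : ℝ) (η w : ℝ → ℝ → ℝ) (t : ℝ) : ℝ :=
  ∫ x in (0:ℝ)..1, (a * η t x ^ γ + η t x * w t x ^ 2)

/-- Time derivative of the mean-zero primitive of the momentum. -/
noncomputable def phit (η w : ℝ → ℝ → ℝ) : ℝ → ℝ → ℝ := zprim (pt (momentum η w))

lemma integral_px (hs : IsSol a γ ν η w) (t : ℝ) : ∫ x in (0:ℝ)..1, px w t x = 0 := by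
  rw [intervalIntegral.integral_eq_sub_of_hasDerivAt
    (fun x _ => hasDerivAt_px hs.smooth_w t x)
    ((continuous_slice (contDiff_px hs.smooth_w).continuous t).intervalIntegrable _ _),
    at_one hs.per_w, sub_self]

lemma phit_eq (hs : IsSol a γ ν η w) {t : ℝ} (ht : 0 ≤ t) (x : ℝ) :
    phit η w t x = ν * px w t x - a * η t x ^ γ - η t x * w t x ^ 2 + meanFlux a γ η w t := by
  have c1 := continuous_slice hs.smooth_η.continuous t
  have c2 := continuous_slice hs.smooth_w.continuous t
  have c3 := continuous_slice (contDiff_px hs.smooth_w).continuous t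
  have c4 := hs.slice_pow γ ht
  have h := zprim_eq_of_hasDerivAt (contDiff_pt hs.smooth_momentum).continuous
    (hs.hasDerivAt_momentum_flux ht) x
  have h1 : ∫ y in (0:ℝ)..1, (ν * px w t y - a * η t y ^ γ - η t y * w t y ^ 2)
      = - meanFlux a γ η w t := by
    have : ∀ y, ν * px w t y - a * η t y ^ γ - η t y * w t y ^ 2
        = ν * px w t y - (a * η t y ^ γ + η t y * w t y ^ 2) := fun y => by ring
    simp_rw [this]
    rw [intervalIntegral.integral_sub ((by fun_prop : Continuous _).intervalIntegrable _ _)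
      ((by fun_prop : Continuous _).intervalIntegrable _ _),
      intervalIntegral.integral_const_mul, hs.integral_px, meanFlux]
    ring
  rw [phit, h, h1]
  ring

/-! ### Uniform bounds on the density -/

/-- The quantity `ν log η + φ`, transported along the flow up to lower order terms. -/
noncomputable def transported (ν : ℝ) (η w : ℝ → ℝ → ℝ) (t x : ℝ) : ℝ :=
  ν * Real.log (η t x) + phi η w t x

lemma phi_one (hs : IsSol a γ ν η w) {t : ℝ} (ht : 0 ≤ t) : phi η w t 1 = phi η w t 0 :=
  zprim_one t (hs.integral_momentum ht)

lemma slice_phi (hs : IsSol a γ ν η w) (t : ℝ) : Continuous (phi η w t) :=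
  (continuous_zprim hs.smooth_momentum.continuous).comp (f := fun x => (t, x)) (by fun_prop)

lemma cont_phi (hs : IsSol a γ ν η w) : Continuous (fun z : ℝ × ℝ => phi η w z.1 z.2) :=
  continuous_zprim hs.smooth_momentum.continuous

lemma cont_phit (hs : IsSol a γ ν η w) : Continuous (fun z : ℝ × ℝ => phit η w z.1 z.2) :=
  continuous_zprim (contDiff_pt hs.smooth_momentum).continuous

lemma contOn_transported (hs : IsSol a γ ν η w) :
    ContinuousOn (fun z : ℝ × ℝ => transported ν η w z.1 z.2) (posTimes η ×ˢ univ) :=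
  ((hs.cont_η.continuousOn.log fun z hz => (hz.1 z.2).ne').const_mul ν).add
    hs.cont_phi.continuousOn

lemma hasDerivAt_integral_transported (hs : IsSol a γ ν η w) {g g' : ℝ → ℝ}
    (hg : ∀ y, HasDerivAt g (g' y) y) (hg' : Continuous g') {t : ℝ} (ht : 0 ≤ t) :
    HasDerivAt (fun t => ∫ x in (0:ℝ)..1, η t x * g (transported ν η w t x))
      (∫ x in (0:ℝ)..1, η t x *
        (g' (transported ν η w t x) * (meanFlux a γ η w t - a * η t x ^ γ))) t := by
  have hgc : Continuous g := continuous_iff_continuousAt.mpr fun y => (hg y).continuousAt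
  have c1 := hs.cont_η.continuousOn (s := posTimes η ×ˢ univ)
  have c3 := hs.cont_ηt.continuousOn (s := posTimes η ×ˢ univ)
  have c4 := hs.cont_phit.continuousOn (s := posTimes η ×ˢ univ)
  have c5 := hs.contOn_transported
  have cX : Continuous (transported ν η w t) :=
    c5.comp_continuous (f := fun x => (t, x)) (by fun_prop)
      fun x => ⟨hs.mem_posTimes ht, mem_univ x⟩
  have c6 := continuous_slice hs.smooth_η.continuous t
  have c7 := hs.slice_pow γ ht
  refine hasDerivAt_integral_of_flux hs.isOpen_posTimes
    (f' := fun t x => pt η t x * g (transported ν η w t x)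
      + η t x * (g' (transported ν η w t x) * (ν * (pt η t x / η t x) + phit η w t x)))
    (G := fun x => -(η t x * w t x * g (transported ν η w t x)))
    (c1.mul (hgc.comp_continuousOn c5)) ?_ (fun s hs' x => ?_) (hs.mem_posTimes ht)
    (by fun_prop) (fun x => ?_) ?_
  · exact (c3.mul (hgc.comp_continuousOn c5)).add (c1.mul ((hg'.comp_continuousOn c5).mul
      (((c3.div c1 fun z hz => (hz.1 z.2).ne').const_mul ν).add c4)))
  · have h1 := hasDerivAt_pt hs.smooth_η s x
    have h2 : HasDerivAt (fun s => transported ν η w s x)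
        (ν * (pt η s x / η s x) + phit η w s x) s :=
      ((h1.log (hs' x).ne').const_mul ν).add (hasDerivAt_zprim_time hs.smooth_momentum s x)
    exact h1.mul ((hg _).comp s h2)
  · have hp := hs.pos t x ht
    have h1 := hasDerivAt_px hs.smooth_η t x
    have h2 := hasDerivAt_px hs.smooth_w t x
    have h3 : HasDerivAt (transported ν η w t)
        (ν * (px η t x / η t x) + momentum η w t x) x :=
      ((h1.log hp.ne').const_mul ν).add
        (hasDerivAt_zprim_space hs.smooth_momentum.continuous t x)
    refine HasDerivAt.congr_deriv ((h1.mul h2).mul ((hg _).comp x h3)).neg ?_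
    rw [hs.phit_eq ht x, hs.mass_eq ht x, momentum]
    simp only [Function.comp_apply, Pi.mul_apply]
    field_simp
    ring
  · simp only [transported, at_one hs.per_η, at_one hs.per_w, hs.phi_one ht]

/-- Invariant region principle for the transported quantity. -/
lemma transported_invariant (hs : IsSol a γ ν η w) {g g' : ℝ → ℝ}
    (hg : ∀ y, HasDerivAt g (g' y) y) (hg' : Continuous g') (hg0 : ∀ y, 0 ≤ g y)
    (hinit : ∀ x ∈ Icc (0:ℝ) 1, g (transported ν η w 0 x) = 0)
    (hsign : ∀ t, 0 ≤ t → ∀ x ∈ Icc (0:ℝ) 1,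
      g' (transported ν η w t x) * (meanFlux a γ η w t - a * η t x ^ γ) ≤ 0)
    {t : ℝ} (ht : 0 ≤ t) {x : ℝ} (hx : x ∈ Icc (0:ℝ) 1) : g (transported ν η w t x) = 0 := by
  have hgc : Continuous g := continuous_iff_continuousAt.mpr fun y => (hg y).continuousAt
  have hle := le_initial_of_hasDerivAt_nonpos
    (fun t ht => hs.hasDerivAt_integral_transported hg hg' ht) (fun t ht => by
      rw [← neg_nonneg, ← intervalIntegral.integral_neg]
      refine intervalIntegral.integral_nonneg zero_le_one fun x hx => ?_
      exact neg_nonneg.mpr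
        (mul_nonpos_of_nonneg_of_nonpos (hs.pos t x ht).le (hsign t ht x hx))) ht
  have h0 : ∫ x in (0:ℝ)..1, η 0 x * g (transported ν η w 0 x) = 0 := by
    rw [intervalIntegral.integral_congr (g := fun _ => 0)]
    · simp
    · intro x hx
      rw [uIcc_of_le zero_le_one] at hx
      simp only [hinit x hx, mul_zero]
  have cX : Continuous (transported ν η w t) :=
    hs.contOn_transported.comp_continuous (f := fun x => (t, x)) (by fun_prop)
      fun x => ⟨hs.mem_posTimes ht, mem_univ x⟩
  have c6 := continuous_slice hs.smooth_η.continuous t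
  by_contra hne
  have hpos : 0 < ∫ x in (0:ℝ)..1, η t x * g (transported ν η w t x) :=
    intervalIntegral.integral_pos zero_lt_one (by fun_prop)
      (fun y _ => mul_nonneg (hs.pos t y ht).le (hg0 _))
      ⟨x, hx, mul_pos (hs.pos t x ht) ((hg0 _).lt_of_ne' hne)⟩
  linarith

lemma slice_relPot (hs : IsSol a γ ν η w) {t : ℝ} (ht : 0 ≤ t) :
    Continuous (fun x => relPot a γ (η t x)) :=
  hs.contOn_relPot.comp_continuous (f := fun x => (t, x)) (by fun_prop)
    fun x => ⟨hs.mem_posTimes ht, mem_univ x⟩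

lemma energy_le_initial (hs : IsSol a γ ν η w) (hν : 0 < ν) {t : ℝ} (ht : 0 ≤ t) :
    energy a γ η w t ≤ energy a γ η w 0 := by
  refine le_initial_of_hasDerivAt_nonpos (fun t ht => hs.hasDerivAt_energy ht) (fun t _ => ?_) ht
  rw [intervalIntegral.integral_const_mul]
  have : 0 ≤ ∫ x in (0:ℝ)..1, px w t x ^ 2 :=
    intervalIntegral.integral_nonneg zero_le_one fun x _ => sq_nonneg _
  nlinarith

lemma abs_phi_le (hs : IsSol a γ ν η w) (t : ℝ) {x : ℝ} (hx : x ∈ Icc (0:ℝ) 1) :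
    |phi η w t x| ≤ ∫ y in (0:ℝ)..1, |momentum η w t y| := by
  refine abs_le_of_weighted_mean_zero (ρ := fun _ => 1) continuous_const (hs.slice_phi t)
    (fun _ => zero_le_one) (by simp) ?_ fun y hy =>
    abs_sub_le_integral_abs (f' := momentum η w t)
      (hasDerivAt_zprim_space hs.smooth_momentum.continuous t)
      (continuous_slice hs.smooth_momentum.continuous t) hx hy
  simp only [one_mul]
  exact integral_zprim hs.smooth_momentum.continuous t

lemma abs_phi_le_energy (hs : IsSol a γ ν η w) (ha : 0 < a) (hγ1 : 1 ≤ γ) {t : ℝ} (ht : 0 ≤ t)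
    {x : ℝ} (hx : x ∈ Icc (0:ℝ) 1) : |phi η w t x| ≤ 1 + energy a γ η w t := by
  refine (hs.abs_phi_le t hx).trans ?_
  have c1 := continuous_slice hs.smooth_η.continuous t
  have c2 := continuous_slice hs.smooth_w.continuous t
  have c3 := continuous_slice hs.smooth_momentum.continuous t
  have c4 := hs.slice_relPot ht
  have h : ∫ y in (0:ℝ)..1, (η t y + (1 / 2 * (η t y * w t y ^ 2)
      + η t y * relPot a γ (η t y))) = 1 + energy a γ η w t := by
    rw [intervalIntegral.integral_add (c1.intervalIntegrable _ _)
      ((by fun_prop : Continuous _).intervalIntegrable _ _), hs.integral_density ht, energy]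
  rw [← h]
  refine intervalIntegral.integral_mono_on zero_le_one (c3.abs.intervalIntegrable _ _)
    ((by fun_prop : Continuous _).intervalIntegrable _ _) fun y _ => ?_
  have hp := hs.pos t y ht
  have h1 := mul_nonneg hp.le (relPot_nonneg ha hγ1 hp)
  have h2 : |w t y| ≤ 1 + 1 / 2 * w t y ^ 2 := by
    rw [← sq_abs (w t y)]
    nlinarith [sq_nonneg (|w t y| - 1)]
  rw [momentum, abs_mul, abs_of_pos hp]
  nlinarith [mul_le_mul_of_nonneg_left h2 hp.le]

lemma meanFlux_le (hs : IsSol a γ ν η w) (ha : 0 < a) (hγ1 : 1 ≤ γ) (hγ2 : γ ≤ 2) {t : ℝ}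
    (ht : 0 ≤ t) : meanFlux a γ η w t ≤ 3 * a + 2 * energy a γ η w t := by
  have c1 := continuous_slice hs.smooth_η.continuous t
  have c2 := continuous_slice hs.smooth_w.continuous t
  have c3 := hs.slice_pow γ ht
  have c4 := hs.slice_relPot ht
  have h : ∫ x in (0:ℝ)..1, (a + 2 * a * η t x
      + 2 * (1 / 2 * (η t x * w t x ^ 2) + η t x * relPot a γ (η t x)))
      = 3 * a + 2 * energy a γ η w t := by
    rw [intervalIntegral.integral_add ((by fun_prop : Continuous _).intervalIntegrable _ _)
      ((by fun_prop : Continuous _).intervalIntegrable _ _),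
      intervalIntegral.integral_add ((by fun_prop : Continuous _).intervalIntegrable _ _)
      ((by fun_prop : Continuous _).intervalIntegrable _ _),
      intervalIntegral.integral_const_mul, intervalIntegral.integral_const_mul,
      hs.integral_density ht, intervalIntegral.integral_const, energy]
    simp only [smul_eq_mul]
    ring
  rw [← h]
  refine intervalIntegral.integral_mono_on zero_le_one
    ((by fun_prop : Continuous _).intervalIntegrable _ _)
    ((by fun_prop : Continuous _).intervalIntegrable _ _) fun y _ => ?_
  have hp := hs.pos t y ht
  have h1 := mul_nonneg hp.le (relPot_nonneg ha hγ1 hp)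
  have h2 := pressure_le_relPot ha hγ1 hγ2 hp
  linarith

lemma le_meanFlux (hs : IsSol a γ ν η w) (ha : 0 < a) (hγ1 : 1 ≤ γ) {t : ℝ}
    (ht : 0 ≤ t) : a ≤ meanFlux a γ η w t := by
  have c1 := continuous_slice hs.smooth_η.continuous t
  have c2 := continuous_slice hs.smooth_w.continuous t
  have c3 := hs.slice_pow γ ht
  have h : ∫ x in (0:ℝ)..1, (a + a * γ * (η t x - 1)) = a := by
    rw [intervalIntegral.integral_add ((by fun_prop : Continuous _).intervalIntegrable _ _)
      ((by fun_prop : Continuous _).intervalIntegrable _ _),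
      intervalIntegral.integral_const_mul, intervalIntegral.integral_sub
      ((by fun_prop : Continuous _).intervalIntegrable _ _) intervalIntegrable_const,
      hs.integral_density ht]
    simp
  refine h.symm.le.trans ?_
  refine intervalIntegral.integral_mono_on zero_le_one
    ((by fun_prop : Continuous _).intervalIntegrable _ _)
    ((by fun_prop : Continuous _).intervalIntegrable _ _) fun y _ => ?_
  have hp := hs.pos t y ht
  have h1 := mul_nonneg hp.le (sq_nonneg (w t y))
  have h2 := pressure_ge_tangent ha hγ1 hp
  linarith

lemma density_upper (hs : IsSol a γ ν η w) (ha : 0 < a) (hγ1 : 1 ≤ γ) (hγ2 : γ ≤ 2) (hν : 0 < ν)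
    {E b : ℝ} (hE : energy a γ η w 0 ≤ E) (hb : 1 ≤ b) (hb' : 3 + 2 * E / a ≤ b)
    (hη : ∀ x, η 0 x ≤ b) {t : ℝ} (ht : 0 ≤ t) {x : ℝ} (hx : x ∈ Icc (0:ℝ) 1) :
    η t x ≤ Real.exp ((ν * Real.log b + 2 * (1 + E)) / ν) := by
  have hφ : ∀ t, 0 ≤ t → ∀ x ∈ Icc (0:ℝ) 1, |phi η w t x| ≤ 1 + E := fun t ht x hx =>
    (hs.abs_phi_le_energy ha hγ1 ht hx).trans (by linarith [hs.energy_le_initial hν ht])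
  set K := ν * Real.log b + (1 + E) with hK
  have hb0 : 0 < b := one_pos.trans_le hb
  have h0 := hs.transported_invariant (g := fun y => (max (y - K) 0) ^ 2)
    (g' := fun y => 2 * max (y - K) 0)
    (fun y => (hasDerivAt_max_zero_sq (y - K)).comp_sub_const y K)
    (by fun_prop) (fun y => sq_nonneg _) (fun x hx => ?_) (fun t ht x hx => ?_) ht hx
  · have h1 : transported ν η w t x ≤ K := by
      by_contra! h
      rw [max_eq_left (by linarith)] at h0
      have := pow_pos (sub_pos.mpr h) 2
      linarith
    have h2 := (abs_le.mp (hφ t ht x hx)).1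
    rw [transported] at h1
    rw [← Real.log_le_iff_le_exp (hs.pos t x ht), le_div_iff₀ hν]
    linarith
  · have h1 := Real.log_le_log (hs.pos 0 x le_rfl) (hη x)
    have h2 := (abs_le.mp (hφ 0 le_rfl x hx)).2
    have h3 : transported ν η w 0 x ≤ K := by
      rw [transported]
      nlinarith
    simp only [max_eq_right (sub_nonpos.mpr h3)]
    norm_num
  · rcases le_total (transported ν η w t x) K with h | h
    · simp only [max_eq_right (sub_nonpos.mpr h)]
      simp
    · have h2 := (abs_le.mp (hφ t ht x hx)).2
      rw [transported] at h
      have hp := hs.pos t x ht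
      have h3 : b ≤ η t x := by
        rw [← Real.log_le_log_iff hb0 hp]
        nlinarith
      have h4 : η t x ≤ η t x ^ γ := Real.self_le_rpow_of_one_le (hb.trans h3) hγ1
      have h5 := hs.meanFlux_le ha hγ1 hγ2 ht
      have h6 := hs.energy_le_initial hν ht
      have h7 : a * (3 + 2 * E / a) ≤ a * η t x ^ γ :=
        mul_le_mul_of_nonneg_left (hb'.trans (h3.trans h4)) ha.le
      have h8 : a * (3 + 2 * E / a) = 3 * a + 2 * E := by field_simp
      exact mul_nonpos_of_nonneg_of_nonpos (by positivity) (by linarith)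

lemma density_lower (hs : IsSol a γ ν η w) (ha : 0 < a) (hγ1 : 1 ≤ γ) (hν : 0 < ν)
    {E c : ℝ} (hE : energy a γ η w 0 ≤ E) (hc0 : 0 < c) (hc : c ≤ 1)
    (hη : ∀ x, c ≤ η 0 x) {t : ℝ} (ht : 0 ≤ t) {x : ℝ} (hx : x ∈ Icc (0:ℝ) 1) :
    Real.exp ((ν * Real.log c - 2 * (1 + E)) / ν) ≤ η t x := by
  have hφ : ∀ t, 0 ≤ t → ∀ x ∈ Icc (0:ℝ) 1, |phi η w t x| ≤ 1 + E := fun t ht x hx =>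
    (hs.abs_phi_le_energy ha hγ1 ht hx).trans (by linarith [hs.energy_le_initial hν ht])
  set K := ν * Real.log c - (1 + E) with hK
  have h0 := hs.transported_invariant (g := fun y => (max (K - y) 0) ^ 2)
    (g' := fun y => -(2 * max (K - y) 0))
    (fun y => (hasDerivAt_max_zero_sq (K - y)).comp_const_sub K y)
    (by fun_prop) (fun y => sq_nonneg _) (fun x hx => ?_) (fun t ht x hx => ?_) ht hx
  · have h1 : K ≤ transported ν η w t x := by
      by_contra! h
      rw [max_eq_left (by linarith)] at h0
      have := pow_pos (sub_pos.mpr h) 2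
      linarith
    have h2 := (abs_le.mp (hφ t ht x hx)).2
    rw [transported] at h1
    rw [← Real.le_log_iff_exp_le (hs.pos t x ht), div_le_iff₀ hν]
    linarith
  · have h1 := Real.log_le_log hc0 (hη x)
    have h2 := (abs_le.mp (hφ 0 le_rfl x hx)).1
    have h3 : K ≤ transported ν η w 0 x := by
      rw [transported]
      nlinarith
    simp only [max_eq_right (sub_nonpos.mpr h3)]
    norm_num
  · rcases le_total K (transported ν η w t x) with h | h
    · simp only [max_eq_right (sub_nonpos.mpr h)]
      simp
    · have h2 := (abs_le.mp (hφ t ht x hx)).1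
      rw [transported] at h
      have hp := hs.pos t x ht
      have h3 : η t x ≤ c := by
        rw [← Real.log_le_log_iff hp hc0]
        nlinarith
      have h4 : η t x ^ γ ≤ 1 := Real.rpow_le_one hp.le (h3.trans hc) (by linarith)
      have h5 := hs.le_meanFlux ha hγ1 ht
      have h6 : a * η t x ^ γ ≤ a * 1 := mul_le_mul_of_nonneg_left h4 ha.le
      refine mul_nonpos_of_nonpos_of_nonneg (neg_nonpos.mpr (by positivity)) (by linarith)

lemma energy_initial_le (hs : IsSol a γ ν η w) (ha : 0 < a) (hγ1 : 1 ≤ γ) (hγ2 : γ ≤ 2)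
    {Ebar c b : ℝ} (hc0 : 0 < c) (hc : c ≤ 1) (hb : 1 ≤ b)
    (hη : ∀ x, η 0 x ∈ Icc c b)
    (hE : (∫ x in (0:ℝ)..1, ((1 / 2) * η 0 x * (w 0 x) ^ 2 + Ppot a γ (η 0 x))) ≤ Ebar) :
    energy a γ η w 0 ≤ Ebar + b * (a * (b + 1) / (2 * c ^ 2) * b ^ 2) := by
  have c1 := continuous_slice hs.smooth_η.continuous 0
  have c2 := continuous_slice hs.smooth_w.continuous 0
  have c4 := hs.slice_relPot le_rfl
  have c5 : Continuous fun x => Ppot a γ (η 0 x) := by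
    unfold Ppot
    by_cases h : γ = 1
    · simp only [h, if_true]
      exact continuous_const.mul
        ((c1.mul (c1.log fun x => (hs.pos 0 x le_rfl).ne')).add continuous_const)
    · simp only [h, if_false]
      exact (continuous_const.mul (hs.slice_pow γ le_rfl)).div_const _
  set K := b * (a * (b + 1) / (2 * c ^ 2) * b ^ 2)
  have hK : ∫ x in (0:ℝ)..1, (((1 / 2) * η 0 x * (w 0 x) ^ 2 + Ppot a γ (η 0 x)) + K)
      = (∫ x in (0:ℝ)..1, ((1 / 2) * η 0 x * (w 0 x) ^ 2 + Ppot a γ (η 0 x))) + K := by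
    rw [intervalIntegral.integral_add ((by fun_prop : Continuous _).intervalIntegrable _ _)
      intervalIntegrable_const]
    simp
  refine le_trans ?_ (hK.le.trans (by linarith))
  refine intervalIntegral.integral_mono_on zero_le_one
    ((by fun_prop : Continuous _).intervalIntegrable _ _)
    ((by fun_prop : Continuous _).intervalIntegrable _ _) fun y _ => ?_
  have hp := hs.pos 0 y le_rfl
  have h1 := Ppot_nonneg ha hγ1 hp
  have h2 := relPot_upper ha hγ1 hγ2 hc0 hc hb (hη y)
  have h3 : (η 0 y - 1) ^ 2 ≤ b ^ 2 :=
    sq_le_sq' (by linarith) (by linarith [(hη y).2])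
  have h4 : η 0 y * relPot a γ (η 0 y) ≤ K := by
    have : relPot a γ (η 0 y) ≤ a * (b + 1) / (2 * c ^ 2) * b ^ 2 :=
      h2.trans (mul_le_mul_of_nonneg_left h3 (by positivity))
    exact mul_le_mul (hη y).2 this (relPot_nonneg ha hγ1 hp) (by linarith)
  linarith

/-! ### Lyapunov functional -/

/-- The dissipation `∫ (∂ₓ w)²`. -/
noncomputable def dissip (w : ℝ → ℝ → ℝ) (t : ℝ) : ℝ := ∫ x in (0:ℝ)..1, px w t x ^ 2

/-- The density fluctuation `∫ (η - 1)²`. -/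
noncomputable def fluct (η : ℝ → ℝ → ℝ) (t : ℝ) : ℝ := ∫ x in (0:ℝ)..1, (η t x - 1) ^ 2

/-- The correction functional `∫ φ (η - 1)`, which yields the decay of the density fluctuation. -/
noncomputable def corrector (η w : ℝ → ℝ → ℝ) (t : ℝ) : ℝ :=
  ∫ x in (0:ℝ)..1, phi η w t x * (η t x - 1)

/-- The gradient functional `∫ (ν/2 (∂ₓ w)² - (p(η) - p(1)) ∂ₓ w)`. -/
noncomputable def gradFunctional (a γ ν : ℝ) (η w : ℝ → ℝ → ℝ) (t : ℝ) : ℝ :=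
  ∫ x in (0:ℝ)..1, (ν / 2 * px w t x ^ 2 - a * (η t x ^ γ - 1) * px w t x)

lemma dissip_nonneg (w : ℝ → ℝ → ℝ) (t : ℝ) : 0 ≤ dissip w t :=
  intervalIntegral.integral_nonneg zero_le_one fun _ _ => sq_nonneg _

lemma fluct_nonneg (η : ℝ → ℝ → ℝ) (t : ℝ) : 0 ≤ fluct η t :=
  intervalIntegral.integral_nonneg zero_le_one fun _ _ => sq_nonneg _

lemma hasDerivAt_corrector (hs : IsSol a γ ν η w) {t : ℝ} (ht : 0 ≤ t) :
    HasDerivAt (corrector η w) (∫ x in (0:ℝ)..1,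
      ((ν * px w t x - a * (η t x ^ γ - 1)) * (η t x - 1) + η t x * w t x ^ 2)) t := by
  have c1 := continuous_slice hs.smooth_η.continuous t
  have c2 := continuous_slice hs.smooth_w.continuous t
  have c3 := continuous_slice (contDiff_px hs.smooth_w).continuous t
  have c4 := hs.slice_pow γ ht
  have d1 := hs.cont_η
  have d2 := hs.cont_phi
  have d3 := hs.cont_phit
  have d4 := hs.cont_ηt
  have h := hasDerivAt_integral_of_flux isOpen_univ
    (f := fun t x => phi η w t x * (η t x - 1))
    (f' := fun t x => phit η w t x * (η t x - 1) + phi η w t x * pt η t x)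
    (G := fun x => -(phi η w t x * (η t x * w t x)))
    (g := fun x => ((ν * px w t x - a * (η t x ^ γ - 1)) * (η t x - 1) + η t x * w t x ^ 2)
      + (meanFlux a γ η w t - a) * (η t x - 1))
    (Continuous.continuousOn (by fun_prop)) (Continuous.continuousOn (by fun_prop))
    (fun s _ x => (hasDerivAt_zprim_time hs.smooth_momentum s x).mul
      ((hasDerivAt_pt hs.smooth_η s x).sub_const 1))
    (mem_univ t) (by fun_prop) (fun x => ?_)
    (by simp only [at_one hs.per_η, at_one hs.per_w, hs.phi_one ht])
  · refine h.congr_deriv ?_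
    rw [intervalIntegral.integral_add ((by fun_prop : Continuous _).intervalIntegrable _ _)
      ((by fun_prop : Continuous _).intervalIntegrable _ _), intervalIntegral.integral_const_mul,
      intervalIntegral.integral_sub (c1.intervalIntegrable _ _) intervalIntegrable_const,
      hs.integral_density ht]
    simp
  · refine HasDerivAt.congr_deriv
      ((hasDerivAt_zprim_space hs.smooth_momentum.continuous t x).mul
        ((hasDerivAt_px hs.smooth_η t x).mul (hasDerivAt_px hs.smooth_w t x))).neg ?_
    rw [hs.phit_eq ht x, hs.mass_eq ht x, momentum, phi]
    simp only [Pi.mul_apply]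
    ring

lemma hasDerivAt_gradFunctional (hs : IsSol a γ ν η w) (hν : 0 < ν) {t : ℝ} (ht : 0 ≤ t) :
    HasDerivAt (gradFunctional a γ ν η w) (∫ x in (0:ℝ)..1,
      (-(η t x * (pt w t x + w t x * px w t x) ^ 2)
        + η t x * (pt w t x + w t x * px w t x) * (w t x * px w t x)
        - a * (η t x ^ γ - 1) * px w t x ^ 2
        - 1 / ν * (a * (η t x ^ γ - 1) * w t x * (η t x * (pt w t x + w t x * px w t x)))
        + 1 / (2 * ν) * (px w t x * (a * (η t x ^ γ - 1)) ^ 2)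
        + γ * (a * η t x ^ γ) * px w t x ^ 2)) t := by
  have c1 := continuous_slice hs.smooth_η.continuous t
  have c2 := continuous_slice hs.smooth_w.continuous t
  have c3 := continuous_slice (contDiff_px hs.smooth_w).continuous t
  have c4 := hs.slice_pow γ ht
  have c5 := continuous_slice (contDiff_pt hs.smooth_w).continuous t
  have d1 := hs.contOn_pow γ
  have d2 := hs.contOn_pow (γ - 1)
  have d3 := hs.cont_wx.continuousOn (s := posTimes η ×ˢ univ)
  have d4 := hs.cont_wtx.continuousOn (s := posTimes η ×ˢ univ)
  have d5 := hs.cont_ηt.continuousOn (s := posTimes η ×ˢ univ)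
  refine hasDerivAt_integral_of_flux hs.isOpen_posTimes
    (f' := fun t x => ν / 2 * (2 * px w t x * pt (px w) t x)
      - (a * (γ * η t x ^ (γ - 1) * pt η t x) * px w t x
        + a * (η t x ^ γ - 1) * pt (px w) t x))
    (G := fun x => (ν * px w t x - a * (η t x ^ γ - 1)) * pt w t x
      + a * (η t x ^ γ - 1) * (w t x * px w t x)
      - 1 / (2 * ν) * (w t x * (a * (η t x ^ γ - 1)) ^ 2))
    (by fun_prop) (by fun_prop) (fun s hs' x => ?_) (hs.mem_posTimes ht) (by fun_prop)
    (fun x => ?_) ?_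
  · have h1 := hasDerivAt_pt (contDiff_px hs.smooth_w) s x
    have h2 := hs.hasDerivAt_pow_time x (hs' x)
    exact (((h1.pow 2).const_mul (ν / 2)).sub (((h2.sub_const 1).const_mul a).mul h1)).congr_deriv
      (by simp)
  · have hp := hs.pos t x ht
    have h2 := hasDerivAt_px hs.smooth_w t x
    have h3 := hasDerivAt_px (contDiff_pt hs.smooth_w) t x
    have h4 := hasDerivAt_px (contDiff_px hs.smooth_w) t x
    have h5 := ((hs.hasDerivAt_pow_space x hp).sub_const 1).const_mul a
    refine HasDerivAt.congr_deriv (((((h4.const_mul ν).sub h5).mul h3).add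
      (h5.mul (h2.mul h4))).sub ((h2.mul (h5.pow 2)).const_mul (1 / (2 * ν)))) ?_
    have e1 := hs.mass_eq ht x
    have e2 := hs.mom_eq ht x
    rw [pt_px_comm hs.smooth_w, e1]
    have e3 : px (px w) t x = (η t x * (pt w t x + w t x * px w t x)
      + a * (γ * η t x ^ (γ - 1) * px η t x)) / ν := by
      rw [← e2]; field_simp
    simp only [Pi.mul_apply, Pi.sub_apply, Pi.pow_apply]
    rw [e3, rpow_eq_mul_rpow_sub_one hp γ]
    generalize η t x ^ (γ - 1) = r at *
    field_simp
    ring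
  · simp only [at_one hs.per_η, at_one hs.per_w, at_one (px_periodic hs.per_w),
      at_one (pt_periodic hs.per_w)]

/-! ### Estimates for the Lyapunov functional -/

lemma abs_velocity_le (hs : IsSol a γ ν η w) {t : ℝ} (ht : 0 ≤ t) {x : ℝ}
    (hx : x ∈ Icc (0:ℝ) 1) : |w t x| ≤ √(dissip w t) := by
  have c1 := continuous_slice hs.smooth_η.continuous t
  have c2 := continuous_slice hs.smooth_w.continuous t
  have c3 := continuous_slice (contDiff_px hs.smooth_w).continuous t
  exact abs_le_of_weighted_mean_zero c1 c2 (fun y => (hs.pos t y ht).le) (hs.integral_density ht)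
    (hs.integral_momentum ht) fun y hy =>
      abs_sub_le_sqrt_integral_sq (hasDerivAt_px hs.smooth_w t) c3 hx hy

lemma sq_velocity_le (hs : IsSol a γ ν η w) {t : ℝ} (ht : 0 ≤ t) {x : ℝ}
    (hx : x ∈ Icc (0:ℝ) 1) : w t x ^ 2 ≤ dissip w t := by
  rw [← Real.sq_sqrt (dissip_nonneg w t)]
  exact sq_le_sq' (neg_le_of_abs_le (hs.abs_velocity_le ht hx))
    (le_of_abs_le (hs.abs_velocity_le ht hx))

lemma sq_phi_le (hs : IsSol a γ ν η w) {t : ℝ} (ht : 0 ≤ t) {x : ℝ}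
    (hx : x ∈ Icc (0:ℝ) 1) : phi η w t x ^ 2 ≤ dissip w t := by
  have c1 := continuous_slice hs.smooth_η.continuous t
  have c3 := continuous_slice hs.smooth_momentum.continuous t
  have h : |phi η w t x| ≤ √(dissip w t) := by
    refine (hs.abs_phi_le t hx).trans ?_
    calc ∫ y in (0:ℝ)..1, |momentum η w t y|
        ≤ ∫ y in (0:ℝ)..1, η t y * √(dissip w t) := by
          refine intervalIntegral.integral_mono_on zero_le_one
            ((by fun_prop : Continuous _).intervalIntegrable _ _)
            ((by fun_prop : Continuous _).intervalIntegrable _ _) fun y hy => ?_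
          rw [momentum, abs_mul, abs_of_pos (hs.pos t y ht)]
          exact mul_le_mul_of_nonneg_left (hs.abs_velocity_le ht hy) (hs.pos t y ht).le
      _ = √(dissip w t) := by
          rw [intervalIntegral.integral_mul_const, hs.integral_density ht, one_mul]
  rw [← Real.sq_sqrt (dissip_nonneg w t)]
  exact sq_le_sq' (neg_le_of_abs_le h) (le_of_abs_le h)

/-- Integrating a pointwise bound by `α (∂ₓ w)² + β (η - 1)² + δ`. -/
lemma integral_le_of_pointwise (hs : IsSol a γ ν η w) {t α β δ : ℝ} {F : ℝ → ℝ}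
    (hF : Continuous F)
    (h : ∀ x ∈ Icc (0:ℝ) 1, F x ≤ α * px w t x ^ 2 + β * (η t x - 1) ^ 2 + δ) :
    ∫ x in (0:ℝ)..1, F x ≤ α * dissip w t + β * fluct η t + δ := by
  have c1 := continuous_slice hs.smooth_η.continuous t
  have c3 := continuous_slice (contDiff_px hs.smooth_w).continuous t
  refine (intervalIntegral.integral_mono_on zero_le_one (hF.intervalIntegrable _ _)
    ((by fun_prop : Continuous _).intervalIntegrable _ _) h).trans_eq ?_
  rw [intervalIntegral.integral_add ((by fun_prop : Continuous _).intervalIntegrable _ _)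
      intervalIntegrable_const,
    intervalIntegral.integral_add ((by fun_prop : Continuous _).intervalIntegrable _ _)
      ((by fun_prop : Continuous _).intervalIntegrable _ _),
    intervalIntegral.integral_const_mul, intervalIntegral.integral_const_mul, dissip, fluct]
  simp

lemma abs_pressure_le (hs : IsSol a γ ν η w) (ha : 0 < a) (hγ1 : 1 ≤ γ) (hγ2 : γ ≤ 2) {b t x : ℝ}
    (ht : 0 ≤ t) (hb : η t x ≤ b) :
    |a * (η t x ^ γ - 1)| ≤ a * (b + 1) * |η t x - 1| := by
  rw [abs_mul, abs_of_pos ha, mul_assoc]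
  refine mul_le_mul_of_nonneg_left ((abs_rpow_sub_one_le hγ1 hγ2 (hs.pos t x ht)).trans ?_) ha.le
  gcongr

lemma deriv_corrector_le (hs : IsSol a γ ν η w) (ha : 0 < a) (hγ1 : 1 ≤ γ)
    {b t : ℝ} (ht : 0 ≤ t) (hb : ∀ x ∈ Icc (0:ℝ) 1, η t x ≤ b) :
    (∫ x in (0:ℝ)..1,
      ((ν * px w t x - a * (η t x ^ γ - 1)) * (η t x - 1) + η t x * w t x ^ 2))
      ≤ (ν ^ 2 / (2 * a) + b) * dissip w t - a / 2 * fluct η t := by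
  have c1 := continuous_slice hs.smooth_η.continuous t
  have c2 := continuous_slice hs.smooth_w.continuous t
  have c3 := continuous_slice (contDiff_px hs.smooth_w).continuous t
  have c4 := hs.slice_pow γ ht
  refine (hs.integral_le_of_pointwise (α := ν ^ 2 / (2 * a)) (β := -(a / 2))
    (δ := b * dissip w t) (by fun_prop) fun x hx => ?_).trans_eq (by ring)
  have h1 := mul_le_mul_of_nonneg_left (rpow_sub_one_mul_ge hγ1 (hs.pos t x ht)) ha.le
  have h2 := mul_le_mul (hb x hx) (hs.sq_velocity_le ht hx) (sq_nonneg _)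
    ((hs.pos t x ht).le.trans (hb x hx))
  have h3 : ν * px w t x * (η t x - 1)
      ≤ ν ^ 2 / (2 * a) * px w t x ^ 2 + a / 2 * (η t x - 1) ^ 2 := by
    have h := mul_nonneg (inv_pos.2 (mul_pos two_pos ha)).le
      (sq_nonneg (ν * px w t x - a * (η t x - 1)))
    refine sub_nonneg.1 (h.trans_eq ?_)
    field_simp
    ring
  linarith

/-- The constant in front of the density fluctuation in `deriv_gradFunctional_le`. -/
noncomputable def fluctConst (a ν b : ℝ) : ℝ :=
  (a * (b + 1) * b) ^ 2 * (a * (b + 1)) ^ 2 / (4 * ν)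

/-- The constant in front of the dissipation in `deriv_gradFunctional_le`. -/
noncomputable def dissipConst (a ν b : ℝ) : ℝ :=
  3 * (a * (b + 1) * b) + 2 * a + 1 / (4 * ν) + b * (a * (b + 1) * b) ^ 2 / ν ^ 2

lemma deriv_gradFunctional_le (hs : IsSol a γ ν η w) (ha : 0 < a) (hγ1 : 1 ≤ γ) (hγ2 : γ ≤ 2)
    (hν : 0 < ν) {b t : ℝ} (ht : 0 ≤ t) (hb1 : 1 ≤ b) (hb : ∀ x ∈ Icc (0:ℝ) 1, η t x ≤ b) :
    (∫ x in (0:ℝ)..1,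
      (-(η t x * (pt w t x + w t x * px w t x) ^ 2)
        + η t x * (pt w t x + w t x * px w t x) * (w t x * px w t x)
        - a * (η t x ^ γ - 1) * px w t x ^ 2
        - 1 / ν * (a * (η t x ^ γ - 1) * w t x * (η t x * (pt w t x + w t x * px w t x)))
        + 1 / (2 * ν) * (px w t x * (a * (η t x ^ γ - 1)) ^ 2)
        + γ * (a * η t x ^ γ) * px w t x ^ 2))
      ≤ dissipConst a ν b * dissip w t + fluctConst a ν b * fluct η t
        + b * dissip w t ^ 2 := by
  have c1 := continuous_slice hs.smooth_η.continuous t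
  have c2 := continuous_slice hs.smooth_w.continuous t
  have c3 := continuous_slice (contDiff_px hs.smooth_w).continuous t
  have c4 := hs.slice_pow γ ht
  have c5 := continuous_slice (contDiff_pt hs.smooth_w).continuous t
  refine (hs.integral_le_of_pointwise
    (α := 3 * (a * (b + 1) * b) + 2 * a + 1 / (4 * ν) + b * dissip w t)
    (β := fluctConst a ν b) (δ := b * (a * (b + 1) * b) ^ 2 / ν ^ 2 * dissip w t)
    (by fun_prop) fun x hx => ?_).trans_eq (by rw [dissipConst]; ring)
  have hpos := hs.pos t x ht
  have hP : 0 ≤ a * η t x ^ γ := mul_nonneg ha.le (Real.rpow_nonneg hpos.le _)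
  have hq := hs.abs_pressure_le ha hγ1 hγ2 ht (hb x hx)
  have hab : 0 ≤ a * (b + 1) := by positivity
  have hqQ : |a * (η t x ^ γ - 1)| ≤ a * (b + 1) * b :=
    hq.trans (mul_le_mul_of_nonneg_left
      (abs_le.2 ⟨by linarith, by linarith [hb x hx]⟩) hab)
  have hv := hs.sq_velocity_le ht hx
  have hbx := hb x hx
  rw [show a * η t x ^ γ = a * (η t x ^ γ - 1) + a by ring] at hP ⊢
  rw [fluctConst]
  generalize a * (η t x ^ γ - 1) = q at *
  generalize pt w t x + w t x * px w t x = N at *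
  generalize px w t x = d at *
  generalize w t x = v at *
  generalize dissip w t = Y at *
  generalize η t x = e at *
  generalize a * (b + 1) = K at *
  have hq2 : q ^ 2 ≤ K ^ 2 * (e - 1) ^ 2 := by
    rw [← mul_pow, ← sq_abs q, ← sq_abs (K * (e - 1)), abs_mul, abs_of_nonneg hab]
    exact pow_le_pow_left₀ (abs_nonneg _) hq 2
  have hq2' : q ^ 2 ≤ (K * b) ^ 2 := by
    rw [← sq_abs q]
    exact pow_le_pow_left₀ (abs_nonneg _) hqQ 2
  have hY : 0 ≤ Y := (sq_nonneg v).trans hv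
  have s1 : e * N * (v * d) ≤ 1 / 4 * (e * N ^ 2) + b * Y * d ^ 2 := by
    have h1 := mul_nonneg hpos.le (sq_nonneg (N / 2 - v * d))
    have h2 := mul_le_mul_of_nonneg_right
      (mul_le_mul hbx hv (sq_nonneg _) (hpos.le.trans hbx)) (sq_nonneg d)
    linarith
  have s2 : -(1 / ν * (q * v * (e * N)))
      ≤ 1 / 4 * (e * N ^ 2) + b * (K * b) ^ 2 / ν ^ 2 * Y := by
    have h1 := mul_nonneg hpos.le (sq_nonneg (N / 2 + q * v / ν))
    have h2 := mul_le_mul (mul_le_mul hbx hq2' (sq_nonneg _) (hpos.le.trans hbx)) hv (sq_nonneg _)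
      (by positivity)
    have h3 := div_le_div_of_nonneg_right h2 (sq_nonneg ν)
    have h4 : e * (N / 2 + q * v / ν) ^ 2
        = 1 / 4 * (e * N ^ 2) + 1 / ν * (q * v * (e * N)) + e * q ^ 2 * v ^ 2 / ν ^ 2 := by
      field_simp; ring
    rw [h4] at h1
    have h5 : b * (K * b) ^ 2 / ν ^ 2 * Y = b * (K * b) ^ 2 * Y / ν ^ 2 := by ring
    linarith
  have s3 : 1 / (2 * ν) * (d * q ^ 2)
      ≤ 1 / (4 * ν) * d ^ 2 + (K * b) ^ 2 * K ^ 2 / (4 * ν) * (e - 1) ^ 2 := by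
    have h1 := mul_nonneg (inv_pos.2 (mul_pos four_pos hν)).le (sq_nonneg (d - q ^ 2))
    have h2 := div_le_div_of_nonneg_right
      (mul_le_mul hq2' hq2 (sq_nonneg _) (sq_nonneg _)) (mul_pos four_pos hν).le
    have h4 : (4 * ν)⁻¹ * (d - q ^ 2) ^ 2
        = 1 / (4 * ν) * d ^ 2 - 1 / (2 * ν) * (d * q ^ 2) + q ^ 2 * q ^ 2 / (4 * ν) := by
      field_simp; ring
    rw [h4] at h1
    have h5 : (K * b) ^ 2 * K ^ 2 / (4 * ν) * (e - 1) ^ 2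
      = (K * b) ^ 2 * (K ^ 2 * (e - 1) ^ 2) / (4 * ν) := by ring
    linarith
  have s4 : -(q * d ^ 2) + γ * (q + a) * d ^ 2 ≤ (3 * (K * b) + 2 * a) * d ^ 2 := by
    have h1 : -q + γ * (q + a) ≤ 3 * (K * b) + 2 * a := by
      have := abs_le.1 hqQ
      have := mul_le_mul_of_nonneg_right hγ2 hP
      linarith
    have := mul_le_mul_of_nonneg_right h1 (sq_nonneg d)
    linarith
  have s5 : 0 ≤ e * N ^ 2 := mul_nonneg hpos.le (sq_nonneg N)
  linarith

lemma le_gradFunctional (hs : IsSol a γ ν η w) (ha : 0 < a) (hγ1 : 1 ≤ γ) (hγ2 : γ ≤ 2)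
    (hν : 0 < ν) {b t : ℝ} (ht : 0 ≤ t) (hb : ∀ x ∈ Icc (0:ℝ) 1, η t x ≤ b) :
    ν / 4 * dissip w t - (a * (b + 1)) ^ 2 / ν * fluct η t ≤ gradFunctional a γ ν η w t := by
  have c1 := continuous_slice hs.smooth_η.continuous t
  have c3 := continuous_slice (contDiff_px hs.smooth_w).continuous t
  have c4 := hs.slice_pow γ ht
  have h := hs.integral_le_of_pointwise (t := t) (α := -(ν / 4)) (β := (a * (b + 1)) ^ 2 / ν)
    (δ := 0) (F := fun x => -(ν / 2 * px w t x ^ 2 - a * (η t x ^ γ - 1) * px w t x))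
    (by fun_prop) fun x hx => ?_
  · rw [intervalIntegral.integral_neg] at h
    rw [gradFunctional]
    linarith
  · have hq := pow_le_pow_left₀ (abs_nonneg _) (hs.abs_pressure_le ha hγ1 hγ2 ht (hb x hx)) 2
    rw [mul_pow, sq_abs, sq_abs] at hq
    have h2 := div_le_div_of_nonneg_right hq hν.le
    have h3 := mul_nonneg hν.le (sq_nonneg (px w t x / 2 - a * (η t x ^ γ - 1) / ν))
    have h4 : ν * (px w t x / 2 - a * (η t x ^ γ - 1) / ν) ^ 2 = ν / 4 * px w t x ^ 2
        - a * (η t x ^ γ - 1) * px w t x + (a * (η t x ^ γ - 1)) ^ 2 / ν := by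
      field_simp; ring
    have h5 : (a * (b + 1)) ^ 2 / ν * (η t x - 1) ^ 2
      = (a * (b + 1)) ^ 2 * (η t x - 1) ^ 2 / ν := by ring
    linarith

lemma gradFunctional_le (hs : IsSol a γ ν η w) (ha : 0 < a) (hγ1 : 1 ≤ γ) (hγ2 : γ ≤ 2)
    {b t : ℝ} (ht : 0 ≤ t) (hb : ∀ x ∈ Icc (0:ℝ) 1, η t x ≤ b) :
    gradFunctional a γ ν η w t
      ≤ (ν / 2 + 1 / 2) * dissip w t + 1 / 2 * (a * (b + 1)) ^ 2 * fluct η t := by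
  have c1 := continuous_slice hs.smooth_η.continuous t
  have c3 := continuous_slice (contDiff_px hs.smooth_w).continuous t
  have c4 := hs.slice_pow γ ht
  refine (hs.integral_le_of_pointwise (α := ν / 2 + 1 / 2) (β := 1 / 2 * (a * (b + 1)) ^ 2)
    (δ := 0) (by fun_prop) fun x hx => ?_).trans_eq (add_zero _)
  have hq := pow_le_pow_left₀ (abs_nonneg _) (hs.abs_pressure_le ha hγ1 hγ2 ht (hb x hx)) 2
  rw [mul_pow, sq_abs, sq_abs] at hq
  linarith [sq_nonneg (px w t x + a * (η t x ^ γ - 1))]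

lemma le_energy (hs : IsSol a γ ν η w) (ha : 0 < a) (hγ1 : 1 ≤ γ) {b c t : ℝ} (ht : 0 ≤ t)
    (hb1 : 1 ≤ b) (hcb : ∀ x ∈ Icc (0:ℝ) 1, η t x ∈ Icc c b) :
    c * (a / (2 * b ^ 2)) * fluct η t ≤ energy a γ η w t := by
  have c1 := continuous_slice hs.smooth_η.continuous t
  have c2 := continuous_slice hs.smooth_w.continuous t
  have c4 := hs.slice_relPot ht
  rw [fluct, ← intervalIntegral.integral_const_mul]
  refine intervalIntegral.integral_mono_on zero_le_one
    ((by fun_prop : Continuous _).intervalIntegrable _ _)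
    ((by fun_prop : Continuous _).intervalIntegrable _ _) fun x hx => ?_
  obtain ⟨h1, h2⟩ := hcb x hx
  have hpos := hs.pos t x ht
  have h3 := mul_le_mul h1 (relPot_lower ha hγ1 hb1 hpos h2) (by positivity) hpos.le
  have h4 := mul_nonneg hpos.le (sq_nonneg (w t x))
  linarith

lemma energy_nonneg (hs : IsSol a γ ν η w) (ha : 0 < a) (hγ1 : 1 ≤ γ) {t : ℝ} (ht : 0 ≤ t) :
    0 ≤ energy a γ η w t := by
  refine intervalIntegral.integral_nonneg zero_le_one fun x _ => ?_
  have hpos := hs.pos t x ht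
  have := relPot_nonneg ha hγ1 hpos
  positivity

lemma energy_le (hs : IsSol a γ ν η w) (ha : 0 < a) (hγ1 : 1 ≤ γ) (hγ2 : γ ≤ 2)
    {b c t : ℝ} (ht : 0 ≤ t) (hc0 : 0 < c) (hc : c ≤ 1) (hb1 : 1 ≤ b)
    (hcb : ∀ x ∈ Icc (0:ℝ) 1, η t x ∈ Icc c b) :
    energy a γ η w t
      ≤ 1 / 2 * b * dissip w t + b * (a * (b + 1) / (2 * c ^ 2)) * fluct η t := by
  have c1 := continuous_slice hs.smooth_η.continuous t
  have c2 := continuous_slice hs.smooth_w.continuous t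
  have c4 := hs.slice_relPot ht
  refine (hs.integral_le_of_pointwise (α := 0) (β := b * (a * (b + 1) / (2 * c ^ 2)))
    (δ := 1 / 2 * b * dissip w t) (by fun_prop) fun x hx => ?_).trans_eq (by ring)
  obtain ⟨h1, h2⟩ := hcb x hx
  have hpos := hs.pos t x ht
  have h3 := mul_le_mul h2 (relPot_upper ha hγ1 hγ2 hc0 hc hb1 ⟨h1, h2⟩)
    (relPot_nonneg ha hγ1 hpos) (hpos.le.trans h2)
  have h4 := mul_le_mul h2 (hs.sq_velocity_le ht hx) (sq_nonneg _) (hpos.le.trans h2)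
  linarith

lemma neg_corrector_le (hs : IsSol a γ ν η w) {t δ : ℝ} (ht : 0 ≤ t) (hδ : 0 < δ) :
    -corrector η w t ≤ δ / 2 * dissip w t + 1 / (2 * δ) * fluct η t := by
  have c1 := continuous_slice hs.smooth_η.continuous t
  have c2 := hs.slice_phi t
  rw [corrector, ← intervalIntegral.integral_neg]
  refine (hs.integral_le_of_pointwise (α := 0) (β := 1 / (2 * δ))
    (δ := δ / 2 * dissip w t) (by fun_prop) fun x hx => ?_).trans_eq (by ring)
  have h1 := mul_le_mul_of_nonneg_left (hs.sq_phi_le ht hx) hδ.le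
  have h2 := mul_nonneg (inv_pos.2 (mul_pos two_pos hδ)).le
    (sq_nonneg (δ * phi η w t x + (η t x - 1)))
  have h3 : (2 * δ)⁻¹ * (δ * phi η w t x + (η t x - 1)) ^ 2
      = δ / 2 * phi η w t x ^ 2 + phi η w t x * (η t x - 1)
        + 1 / (2 * δ) * (η t x - 1) ^ 2 := by
    field_simp; ring
  linarith

lemma corrector_le (hs : IsSol a γ ν η w) {t : ℝ} (ht : 0 ≤ t) :
    corrector η w t ≤ 1 / 2 * dissip w t + 1 / 2 * fluct η t := by
  have c1 := continuous_slice hs.smooth_η.continuous t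
  have c2 := hs.slice_phi t
  refine (hs.integral_le_of_pointwise (α := 0) (β := 1 / 2)
    (δ := 1 / 2 * dissip w t) (by fun_prop) fun x hx => ?_).trans_eq (by ring)
  linarith [hs.sq_phi_le ht hx, sq_nonneg (phi η w t x - (η t x - 1))]

end IsSol

open IsSol

/-! ### Exponential decay -/

/-- Decay of a nonnegative functional `Z` satisfying `Z' ≤ -κ Z + β Y Z`, where `ν Y` is the
dissipation rate of a nonnegative energy `E`. -/
lemma le_exp_of_deriv_le {Z Z' E Y : ℝ → ℝ} {κ β ν : ℝ} (hν : 0 < ν) (hβ : 0 ≤ β)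
    (hZ : ∀ t, 0 ≤ t → HasDerivAt Z (Z' t) t)
    (hE : ∀ t, 0 ≤ t → HasDerivAt E (-(ν * Y t)) t)
    (hZ' : ∀ t, 0 ≤ t → Z' t ≤ -κ * Z t + β * Y t * Z t)
    (hZ0 : ∀ t, 0 ≤ t → 0 ≤ Z t) (hE0 : ∀ t, 0 ≤ t → 0 ≤ E t) {t : ℝ} (ht : 0 ≤ t) :
    Z t ≤ Z 0 * Real.exp (β / ν * E 0) * Real.exp (-κ * t) := by
  have h := le_initial_of_hasDerivAt_nonpos
    (f := fun t => Z t * Real.exp (κ * t + β / ν * E t))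
    (fun t ht => (hZ t ht).mul
      ((((hasDerivAt_id t).const_mul κ).add ((hE t ht).const_mul (β / ν))).exp))
    (fun t ht => ?_) ht
  · simp only [mul_zero, zero_add] at h
    have h1 : Z t * Real.exp (κ * t) ≤ Z 0 * Real.exp (β / ν * E 0) := by
      refine le_trans (mul_le_mul_of_nonneg_left (Real.exp_le_exp.2 ?_) (hZ0 t ht)) h
      linarith [mul_nonneg (div_nonneg hβ hν.le) (hE0 t ht)]
    rw [neg_mul, Real.exp_neg, ← div_eq_mul_inv, le_div_iff₀ (Real.exp_pos _)]
    exact h1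
  · have h2 : β / ν * -(ν * Y t) = -(β * Y t) := by field_simp
    have h3 := mul_nonneg (sub_nonneg.2 (hZ' t ht)) (Real.exp_pos (κ * t + β / ν * E t)).le
    simp only [id, Pi.add_apply, h2]
    linarith

/-- Given uniform bounds on the density, a combination of the energy, the corrector and the
gradient functional is a Lyapunov functional, so that the dissipation decays exponentially. -/
lemma exists_dissip_decay {a γ ν b c E₀ : ℝ} (ha : 0 < a) (hγ1 : 1 ≤ γ) (hγ2 : γ ≤ 2)
    (hν : 0 < ν) (hc0 : 0 < c) (hc : c ≤ 1) (hb1 : 1 ≤ b) :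
    ∃ M κ : ℝ, 0 < M ∧ 0 < κ ∧ ∀ η w : ℝ → ℝ → ℝ, IsSol a γ ν η w →
      (∀ t, 0 ≤ t → ∀ x ∈ Icc (0:ℝ) 1, η t x ∈ Icc c b) → energy a γ η w 0 ≤ E₀ →
      ∀ t, 0 ≤ t → dissip w t ≤ M * (dissip w 0 + fluct η 0) * Real.exp (-κ * t) := by
  have hb0 : 0 < b := zero_lt_one.trans_le hb1
  obtain ⟨C₁, hC₁⟩ : ∃ C, C = dissipConst a ν b := ⟨_, rfl⟩
  obtain ⟨C₂, hC₂⟩ : ∃ C, C = fluctConst a ν b := ⟨_, rfl⟩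
  obtain ⟨C₃, hC₃⟩ : ∃ C, C = (a * (b + 1)) ^ 2 / ν := ⟨_, rfl⟩
  obtain ⟨m, hm⟩ : ∃ m, m = c * (a / (2 * b ^ 2)) := ⟨_, rfl⟩
  obtain ⟨k₂, hk₂⟩ : ∃ k, k = 2 * (C₂ + 1) / a := ⟨_, rfl⟩
  obtain ⟨k₁, hk₁⟩ : ∃ k, k = (C₁ + k₂ * (ν ^ 2 / (2 * a) + b) + 1) / ν
    + (C₃ + 2 * k₂ ^ 2 / ν + 1) / m := ⟨_, rfl⟩
  obtain ⟨C₄, hC₄⟩ : ∃ C, C = ν / 2 + 1 / 2 + 1 / 2 * (a * (b + 1)) ^ 2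
    + k₁ * (1 / 2 * b + b * (a * (b + 1) / (2 * c ^ 2))) + k₂ := ⟨_, rfl⟩
  have hC₁0 : 0 < C₁ := by rw [hC₁, dissipConst]; positivity
  have hC₂0 : 0 < C₂ := by rw [hC₂, fluctConst]; positivity
  have hC₃0 : 0 < C₃ := by rw [hC₃]; positivity
  have hm0 : 0 < m := by rw [hm]; positivity
  have hk₂0 : 0 < k₂ := by rw [hk₂]; positivity
  have hk₁0 : 0 < k₁ := by rw [hk₁]; positivity
  have hC₄0 : 0 < C₄ := by rw [hC₄]; positivity
  have hk₁ν : C₁ + k₂ * (ν ^ 2 / (2 * a) + b) + 1 ≤ k₁ * ν := by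
    rw [hk₁, add_mul, div_mul_cancel₀ _ hν.ne']
    exact le_add_of_nonneg_right (by positivity)
  have hk₁m : C₃ + 2 * k₂ ^ 2 / ν + 1 ≤ k₁ * m := by
    rw [hk₁, add_mul, div_mul_cancel₀ _ hm0.ne']
    exact le_add_of_nonneg_left (by positivity)
  have hk₂a : k₂ * (a / 2) = C₂ + 1 := by rw [hk₂]; field_simp
  refine ⟨8 / ν * C₄ * Real.exp (8 * b / ν / ν * E₀), 1 / C₄, by positivity, by positivity,
    fun η w hs hcb hE₀ t ht => ?_⟩
  obtain ⟨Z, hZ⟩ : ∃ Z : ℝ → ℝ, ∀ t, Z t = gradFunctional a γ ν η w t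
    + k₁ * energy a γ η w t + k₂ * corrector η w t := ⟨_, fun _ => rfl⟩
  have hub : ∀ t, 0 ≤ t → ∀ x ∈ Icc (0:ℝ) 1, η t x ≤ b := fun t ht x hx => (hcb t ht x hx).2
  have hlow : ∀ t, 0 ≤ t → ν / 8 * dissip w t + fluct η t ≤ Z t := fun t ht => by
    have h1 := hs.le_gradFunctional ha hγ1 hγ2 hν ht (hub t ht)
    have h2 := mul_le_mul_of_nonneg_left (hs.le_energy ha hγ1 ht hb1 (hcb t ht)) hk₁0.le
    have h3 := mul_le_mul_of_nonneg_left
      (hs.neg_corrector_le ht (δ := ν / (4 * k₂)) (by positivity)) hk₂0.le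
    have h4 : k₂ * (ν / (4 * k₂) / 2 * dissip w t + 1 / (2 * (ν / (4 * k₂))) * fluct η t)
        = ν / 8 * dissip w t + 2 * k₂ ^ 2 / ν * fluct η t := by field_simp; ring
    have h5 := mul_le_mul_of_nonneg_right hk₁m (fluct_nonneg η t)
    rw [← hm] at h2
    rw [← hC₃] at h1
    rw [h4] at h3
    rw [hZ]
    linarith
  have hupp : ∀ t, 0 ≤ t → Z t ≤ C₄ * (dissip w t + fluct η t) := fun t ht => by
    have h1 := hs.gradFunctional_le (ν := ν) ha hγ1 hγ2 ht (hub t ht)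
    have h2 := mul_le_mul_of_nonneg_left
      (hs.energy_le ha hγ1 hγ2 ht hc0 hc hb1 (hcb t ht)) hk₁0.le
    have h3 := mul_le_mul_of_nonneg_left (hs.corrector_le ht) hk₂0.le
    have hY := dissip_nonneg w t
    have hA := fluct_nonneg η t
    rw [hZ, hC₄]
    have p1 : 0 ≤ (1 / 2 * (a * (b + 1)) ^ 2 + k₁ * (b * (a * (b + 1) / (2 * c ^ 2)))
      + 1 / 2 * k₂) * dissip w t := by positivity
    have p2 : 0 ≤ (ν / 2 + 1 / 2 + k₁ * (1 / 2 * b) + 1 / 2 * k₂) * fluct η t := by positivity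
    linarith
  have hZ0 : ∀ t, 0 ≤ t → 0 ≤ Z t := fun t ht => by
    have := mul_nonneg hν.le (dissip_nonneg w t)
    linarith [hlow t ht, fluct_nonneg η t]
  have hE := fun t (ht : 0 ≤ t) => (hs.hasDerivAt_energy ht).congr_deriv
    (show _ = -(ν * dissip w t) by rw [intervalIntegral.integral_const_mul, dissip]; ring)
  have hdecay := le_exp_of_deriv_le (Z := Z) (κ := 1 / C₄) (β := 8 * b / ν) hν (by positivity)
    (fun t ht => (((hs.hasDerivAt_gradFunctional hν ht).add ((hE t ht).const_mul k₁)).add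
      ((hs.hasDerivAt_corrector ht).const_mul k₂)).congr_of_eventuallyEq
      (Eventually.of_forall hZ)) hE (fun t ht => ?_) hZ0
    (fun t ht => hs.energy_nonneg ha hγ1 ht) ht
  · have h1 : Real.exp (8 * b / ν / ν * energy a γ η w 0) ≤ Real.exp (8 * b / ν / ν * E₀) :=
      Real.exp_le_exp.2 (mul_le_mul_of_nonneg_left hE₀ (by positivity))
    have h2 : dissip w t ≤ 8 / ν * Z t := by
      have h := mul_le_mul_of_nonneg_left (hlow t ht) (show 0 ≤ 8 / ν by positivity)
      have h' : 8 / ν * (ν / 8 * dissip w t + fluct η t)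
        = dissip w t + 8 / ν * fluct η t := by field_simp
      have h'' := mul_nonneg (show 0 ≤ 8 / ν by positivity) (fluct_nonneg η t)
      linarith
    have hYA : 0 ≤ dissip w 0 + fluct η 0 := add_nonneg (dissip_nonneg _ _) (fluct_nonneg _ _)
    calc dissip w t ≤ 8 / ν * (Z 0 * Real.exp (8 * b / ν / ν * energy a γ η w 0)
          * Real.exp (-(1 / C₄) * t)) := h2.trans (by gcongr)
      _ ≤ 8 / ν * (C₄ * (dissip w 0 + fluct η 0) * Real.exp (8 * b / ν / ν * E₀)
          * Real.exp (-(1 / C₄) * t)) := by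
        gcongr
        exact hupp 0 le_rfl
      _ = _ := by ring
  · have h1 := hs.deriv_gradFunctional_le ha hγ1 hγ2 hν ht hb1 (hub t ht)
    have h2 := mul_le_mul_of_nonneg_left
      (hs.deriv_corrector_le ha hγ1 ht (hub t ht)) hk₂0.le
    have hY := dissip_nonneg w t
    have h3 := mul_le_mul_of_nonneg_right hk₁ν hY
    have h4 : 1 / C₄ * Z t ≤ dissip w t + fluct η t := by
      rw [one_div, inv_mul_le_iff₀ hC₄0]
      exact hupp t ht
    have h5 : b * dissip w t ^ 2 ≤ 8 * b / ν * dissip w t * Z t := by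
      have h := mul_le_mul_of_nonneg_left (hlow t ht)
        (show 0 ≤ 8 * b / ν * dissip w t by positivity)
      have h' : 8 * b / ν * dissip w t * (ν / 8 * dissip w t + fluct η t)
        = b * dissip w t ^ 2 + 8 * b / ν * dissip w t * fluct η t := by field_simp
      have h'' := mul_nonneg (show 0 ≤ 8 * b / ν * dissip w t by positivity) (fluct_nonneg η t)
      linarith
    have h6 : k₂ * (a / 2 * fluct η t) = (C₂ + 1) * fluct η t := by rw [← hk₂a]; ring
    rw [← hC₁, ← hC₂] at h1
    linarith

/-! ### Norms of the velocity -/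

lemma HSq_one (f : ℝ → ℝ) :
    HSq 1 f = (∫ x in (0:ℝ)..1, f x ^ 2) + ∫ x in (0:ℝ)..1, deriv f x ^ 2 := by
  simp [HSq, Finset.sum_range_succ]

lemma dissip_add_fluct_le {η w : ℝ → ℝ → ℝ} (t : ℝ) :
    dissip w t + fluct η t ≤ HSq 1 (fun x => η t x - 1) + HSq 1 (w t) := by
  have h1 : 0 ≤ ∫ x in (0:ℝ)..1, deriv (fun x => η t x - 1) x ^ 2 :=
    intervalIntegral.integral_nonneg zero_le_one fun _ _ => sq_nonneg _
  have h2 : 0 ≤ ∫ x in (0:ℝ)..1, w t x ^ 2 :=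
    intervalIntegral.integral_nonneg zero_le_one fun _ _ => sq_nonneg _
  rw [HSq_one, HSq_one]
  simp only [dissip, fluct, px]
  linarith

lemma IsSol.norm_velocity_le {a γ ν : ℝ} {η w : ℝ → ℝ → ℝ} (hs : IsSol a γ ν η w) {t : ℝ}
    (ht : 0 ≤ t) : √(HSq 1 (w t)) + holderHalfNorm (w t) ≤ 4 * √(dissip w t) := by
  have c2 := continuous_slice hs.smooth_w.continuous t
  have c3 := continuous_slice (contDiff_px hs.smooth_w).continuous t
  have hY := dissip_nonneg w t
  have h1 : ∫ x in (0:ℝ)..1, w t x ^ 2 ≤ dissip w t := by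
    refine (intervalIntegral.integral_mono_on zero_le_one
      ((by fun_prop : Continuous _).intervalIntegrable _ _) intervalIntegrable_const
      fun x hx => hs.sq_velocity_le ht hx).trans_eq ?_
    simp
  have h2 : √(HSq 1 (w t)) ≤ 2 * √(dissip w t) := by
    refine Real.sqrt_le_iff.2 ⟨by positivity, ?_⟩
    rw [mul_pow, Real.sq_sqrt hY, HSq_one]
    simp only [dissip, px] at *
    linarith
  have h3 : holderHalfNorm (w t) ≤ √(dissip w t) + √(dissip w t) :=
    holderHalfNorm_le (hasDerivAt_px hs.smooth_w t) c3 (hs.per_w t)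
      (px_periodic hs.per_w t) (fun x hx => hs.abs_velocity_le ht hx) (Real.sqrt_nonneg _)
  linarith

end NavierStokesDecay

/-- **Exponential decay of `‖w‖_{H¹}` and `‖w‖_{C^{0,1/2}}`** (Proposition
`prop-decay-exp-H1`): there are `C, α > 0`, depending only on
`(a, γ, ν, ς̄₀, ς̲₀, Ē)`, such that every global smooth solution of the 1D
isentropic compressible Navier–Stokes system on `[0,∞) × 𝕋` with
`ς̲₀ ≤ η₀ ≤ ς̄₀`, `∫_𝕋 η₀ = 1`, `∫_𝕋 η₀ w₀ = 0` and initial energy `E₀₀ ≤ Ē`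
satisfies `‖w(t)‖_{H¹} + ‖w(t)‖_{C^{0,1/2}} ≤ C E₁₀^{1/2} e^{-α t}` for all
`t ≥ 0`, where `E₁₀ = ‖η₀ - 1‖²_{H¹} + ‖w₀‖²_{H¹}`. -/
theorem velocity_H1_decay (a γ ν ςlow ςbar Ebar : ℝ)
    (ha : 0 < a) (hγ1 : 1 ≤ γ) (hγ2 : γ ≤ 2) (hν : 0 < ν)
    (hςlow : 0 < ςlow) (hςord : ςlow ≤ ςbar) (hEbar : 0 < Ebar) :
    ∃ C α : ℝ, 0 < C ∧ 0 < α ∧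
      ∀ η w : ℝ → ℝ → ℝ,
        ContDiff ℝ (⊤ : ℕ∞) (Function.uncurry η) →
        ContDiff ℝ (⊤ : ℕ∞) (Function.uncurry w) →
        (∀ t x : ℝ, η t (x + 1) = η t x) →
        (∀ t x : ℝ, w t (x + 1) = w t x) →
        (∀ t x : ℝ, 0 ≤ t → 0 < η t x) →
        (∀ t x : ℝ, 0 ≤ t →
          deriv (fun s => η s x) t + deriv (fun y => η t y * w t y) x = 0) →
        (∀ t x : ℝ, 0 ≤ t →
          η t x * (deriv (fun s => w s x) t + w t x * deriv (w t) x)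
            - ν * deriv (deriv (w t)) x + deriv (fun y => a * η t y ^ γ) x = 0) →
        (∀ x : ℝ, ςlow ≤ η 0 x) →
        (∀ x : ℝ, η 0 x ≤ ςbar) →
        (∫ x in (0:ℝ)..1, η 0 x) = 1 →
        (∫ x in (0:ℝ)..1, η 0 x * w 0 x) = 0 →
        (∫ x in (0:ℝ)..1, ((1 / 2) * η 0 x * (w 0 x) ^ 2 + Ppot a γ (η 0 x))) ≤ Ebar →
        ∀ t : ℝ, 0 ≤ t →
          Real.sqrt (HSq 1 (w t)) + holderHalfNorm (w t)
            ≤ C * Real.sqrt (HSq 1 (fun x => η 0 x - 1) + HSq 1 (w 0))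
                * Real.exp (-α * t) := by
  obtain ⟨c₀, hc₀⟩ : ∃ c, c = min ςlow 1 := ⟨_, rfl⟩
  obtain ⟨b₀, hb₀⟩ : ∃ b, b = max ςbar 1 := ⟨_, rfl⟩
  obtain ⟨E₀, hE₀⟩ : ∃ E, E = Ebar + b₀ * (a * (b₀ + 1) / (2 * c₀ ^ 2) * b₀ ^ 2) := ⟨_, rfl⟩
  obtain ⟨b₁, hb₁⟩ : ∃ b, b = max b₀ (3 + 2 * E₀ / a) := ⟨_, rfl⟩
  have hc₀0 : 0 < c₀ := hc₀ ▸ lt_min hςlow one_pos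
  have hc₀1 : c₀ ≤ 1 := hc₀ ▸ min_le_right _ _
  have hb₀1 : 1 ≤ b₀ := hb₀ ▸ le_max_right _ _
  have hb₁1 : 1 ≤ b₁ := hb₁ ▸ hb₀1.trans (le_max_left _ _)
  obtain ⟨M, κ, hM, hκ, H⟩ := NavierStokesDecay.exists_dissip_decay (E₀ := E₀) ha hγ1 hγ2 hν
    (lt_min (Real.exp_pos ((ν * Real.log c₀ - 2 * (1 + E₀)) / ν)) one_pos)
    (min_le_right _ _) (le_max_right (Real.exp ((ν * Real.log b₁ + 2 * (1 + E₀)) / ν)) 1)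
  refine ⟨4 * √M, κ / 2, by positivity, by positivity, ?_⟩
  intro η w hη hw pη pw hpos hmass hmom hlow hbar hunit hzero hE t ht
  have hs : NavierStokesDecay.IsSol a γ ν η w :=
    ⟨hη, hw, pη, pw, hpos, hmass, hmom, hunit, hzero⟩
  have hE' : NavierStokesDecay.IsSol.energy a γ η w 0 ≤ E₀ :=
    (hs.energy_initial_le ha hγ1 hγ2 hc₀0 hc₀1 hb₀1
      (fun x => ⟨hc₀ ▸ (min_le_left _ _).trans (hlow x),
        hb₀ ▸ (hbar x).trans (le_max_left _ _)⟩) hE).trans_eq hE₀.symm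
  have hY := H η w hs (fun t ht x hx =>
    ⟨(min_le_left _ _).trans (hs.density_lower ha hγ1 hν hE' hc₀0 hc₀1
        (fun x => hc₀ ▸ (min_le_left _ _).trans (hlow x)) ht hx),
      (hs.density_upper ha hγ1 hγ2 hν hE' hb₁1 (hb₁ ▸ le_max_right _ _)
        (fun x => hb₁ ▸ ((hbar x).trans (hb₀ ▸ le_max_left _ _)).trans (le_max_left _ _))
        ht hx).trans (le_max_left _ _)⟩) hE' t ht
  have hinit := NavierStokesDecay.dissip_add_fluct_le (η := η) (w := w) 0
  have hexp : Real.exp (-κ * t) = Real.exp (-(κ / 2) * t) ^ 2 := by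
    rw [← Real.exp_nat_mul]
    congr 1
    push_cast
    ring
  calc √(HSq 1 (w t)) + holderHalfNorm (w t)
      ≤ 4 * √(NavierStokesDecay.IsSol.dissip w t) := hs.norm_velocity_le ht
    _ ≤ 4 * √(M * (HSq 1 (fun x => η 0 x - 1) + HSq 1 (w 0)) * Real.exp (-(κ / 2) * t) ^ 2) := by
        rw [← hexp]
        gcongr
        exact hY.trans (by gcongr)
    _ = 4 * √M * √(HSq 1 (fun x => η 0 x - 1) + HSq 1 (w 0)) * Real.exp (-(κ / 2) * t) := by
        rw [Real.sqrt_mul' _ (sq_nonneg _), Real.sqrt_sq (Real.exp_pos _).le,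
          Real.sqrt_mul hM.le]
        ring
end

section
/- Fix a > 0, γ ∈ [1,2], ν > 0, constants 0 < ς̲₀ ≤ ς̄₀ and Ē > 0. There exist positive constants C and α, depending only on (a, γ, ν, ς̄₀, ς̲₀, Ē), with the following property: for every global smooth solution (η, w) of the 1D isentropic compressible Navier–Stokes system on [0,∞) × T whose initial data satisfy ς̲₀ ≤ η₀ ≤ ς̄₀, ∫_T η₀ dx = 1, ∫_T η₀ w₀ dx = 0 and E₀₀ := ∫_T ( (1/2) η₀ w₀² + P(η₀) ) dx ≤ Ē, one has for all t ≥ 0: ( ∫_T (∂_x η)²(t,x) dx )^{1/2} ≤ C E₁₀^{1/2} e^{−α t}, where E₁₀ := ‖η₀ − 1‖²_{H¹(T)} + ‖w₀‖²_{H¹(T)}. -/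
open MeasureTheory

/-- Partial derivative in the first variable. -/
noncomputable def dt (F : ℝ → ℝ → ℝ) (t x : ℝ) : ℝ := deriv (fun s => F s x) t

/-- Partial derivative in the second variable. -/
noncomputable def dx (F : ℝ → ℝ → ℝ) (t x : ℝ) : ℝ := deriv (F t) x

/-- Joint smoothness of a function of two real variables. -/
def Sm (F : ℝ → ℝ → ℝ) : Prop :=
  ContDiff ℝ (⊤ : ℕ∞) (fun p : ℝ × ℝ => F p.1 p.2)

/-- A function of two variables that is `1`-periodic in the second one. -/
def Per (F : ℝ → ℝ → ℝ) : Prop := ∀ t x, F t (x + 1) = F t x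

namespace Sm

variable {F G : ℝ → ℝ → ℝ}

lemma const (c : ℝ) : Sm (fun _ _ => c) := contDiff_const

lemma add (hF : Sm F) (hG : Sm G) : Sm (fun t x => F t x + G t x) := ContDiff.add hF hG

lemma sub (hF : Sm F) (hG : Sm G) : Sm (fun t x => F t x - G t x) := ContDiff.sub hF hG

lemma mul (hF : Sm F) (hG : Sm G) : Sm (fun t x => F t x * G t x) := ContDiff.mul hF hG

lemma pow (hF : Sm F) (n : ℕ) : Sm (fun t x => F t x ^ n) := ContDiff.pow hF n

lemma inv (hF : Sm F) (h : ∀ t x, F t x ≠ 0) : Sm (fun t x => (F t x)⁻¹) :=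
  ContDiff.inv hF fun p => h p.1 p.2

lemma rpow (hF : Sm F) (r : ℝ) (h : ∀ t x, F t x ≠ 0) : Sm (fun t x => F t x ^ r) :=
  ContDiff.rpow_const_of_ne hF fun p => h p.1 p.2

lemma log (hF : Sm F) (h : ∀ t x, F t x ≠ 0) : Sm (fun t x => Real.log (F t x)) :=
  ContDiff.log hF fun p => h p.1 p.2

lemma hasFDerivAt (hF : Sm F) (p : ℝ × ℝ) :
    HasFDerivAt (fun p : ℝ × ℝ => F p.1 p.2) (fderiv ℝ (fun p : ℝ × ℝ => F p.1 p.2) p) p :=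
  (ContDiff.differentiable hF (by simp) p).hasFDerivAt

lemma dt_eq_fderiv (hF : Sm F) (t x : ℝ) :
    HasDerivAt (fun s => F s x) (fderiv ℝ (fun p : ℝ × ℝ => F p.1 p.2) (t, x) (1, 0)) t := by
  have h : HasDerivAt (fun s : ℝ => (s, x)) ((1 : ℝ), (0 : ℝ)) t :=
    (hasDerivAt_id t).prodMk (hasDerivAt_const t x)
  exact (hF.hasFDerivAt (t, x)).comp_hasDerivAt t h

lemma dx_eq_fderiv (hF : Sm F) (t x : ℝ) :
    HasDerivAt (F t) (fderiv ℝ (fun p : ℝ × ℝ => F p.1 p.2) (t, x) (0, 1)) x := by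
  have h : HasDerivAt (fun y : ℝ => (t, y)) ((0 : ℝ), (1 : ℝ)) x :=
    (hasDerivAt_const x t).prodMk (hasDerivAt_id x)
  exact (hF.hasFDerivAt (t, x)).comp_hasDerivAt x h

lemma hasDerivAt_t (hF : Sm F) (t x : ℝ) : HasDerivAt (fun s => F s x) (dt F t x) t :=
  (hF.dt_eq_fderiv t x).differentiableAt.hasDerivAt

lemma hasDerivAt_x (hF : Sm F) (t x : ℝ) : HasDerivAt (F t) (dx F t x) x :=
  (hF.dx_eq_fderiv t x).differentiableAt.hasDerivAt

lemma smooth_fderiv_apply (hF : Sm F) (v : ℝ × ℝ) :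
    ContDiff ℝ (⊤ : ℕ∞) (fun p => fderiv ℝ (fun p : ℝ × ℝ => F p.1 p.2) p v) :=
  (ContDiff.fderiv_right (m := (⊤ : ℕ∞)) hF (by simp)).clm_apply contDiff_const

lemma dt (hF : Sm F) : Sm (dt F) := by
  have h := hF.smooth_fderiv_apply (1, 0)
  rwa [← funext fun p : ℝ × ℝ => (hF.dt_eq_fderiv p.1 p.2).deriv] at h

lemma dx (hF : Sm F) : Sm (dx F) := by
  have h := hF.smooth_fderiv_apply (0, 1)
  rwa [← funext fun p : ℝ × ℝ => (hF.dx_eq_fderiv p.1 p.2).deriv] at h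

lemma dt_dx (hF : Sm F) (t x : ℝ) : _root_.dt (_root_.dx F) t x = _root_.dx (_root_.dt F) t x := by
  set f := fun p : ℝ × ℝ => F p.1 p.2 with hf
  have hsymm : IsSymmSndFDerivAt ℝ f (t, x) :=
    ContDiffAt.isSymmSndFDerivAt (ContDiff.contDiffAt hF)
      (by simpa using (WithTop.coe_le_coe.2 le_top : ((2 : ℕ∞) : WithTop ℕ∞) ≤ ((⊤ : ℕ∞) : WithTop ℕ∞)))
  have hd : Differentiable ℝ (fderiv ℝ f) :=
    (ContDiff.fderiv_right (m := (⊤ : ℕ∞)) hF (by simp)).differentiable (by simp)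
  have e1 : (fun s => _root_.dx F s x) = fun s => fderiv ℝ f (s, x) (0, 1) :=
    funext fun s => (hF.dx_eq_fderiv s x).deriv
  have e2 : _root_.dt F t = fun y => fderiv ℝ f (t, y) (1, 0) :=
    funext fun y => (hF.dt_eq_fderiv t y).deriv
  have h1 : HasDerivAt (fun s : ℝ => fderiv ℝ f (s, x) (0, 1))
      (fderiv ℝ (fderiv ℝ f) (t, x) (1, 0) (0, 1)) t := by
    have h : HasDerivAt (fun s : ℝ => (s, x)) ((1 : ℝ), (0 : ℝ)) t :=
      (hasDerivAt_id t).prodMk (hasDerivAt_const t x)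
    have := (hd (t, x)).hasFDerivAt.comp_hasDerivAt t h
    simpa using this.clm_apply (hasDerivAt_const t ((0 : ℝ), (1 : ℝ)))
  have h2 : HasDerivAt (fun y : ℝ => fderiv ℝ f (t, y) (1, 0))
      (fderiv ℝ (fderiv ℝ f) (t, x) (0, 1) (1, 0)) x := by
    have h : HasDerivAt (fun y : ℝ => (t, y)) ((0 : ℝ), (1 : ℝ)) x :=
      (hasDerivAt_const x t).prodMk (hasDerivAt_id x)
    have := (hd (t, x)).hasFDerivAt.comp_hasDerivAt x h
    simpa using this.clm_apply (hasDerivAt_const x ((1 : ℝ), (0 : ℝ)))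
  calc _root_.dt (_root_.dx F) t x
      = fderiv ℝ (fderiv ℝ f) (t, x) (1, 0) (0, 1) := by rw [← h1.deriv, ← e1]; rfl
    _ = fderiv ℝ (fderiv ℝ f) (t, x) (0, 1) (1, 0) := hsymm.eq _ _
    _ = _root_.dx (_root_.dt F) t x := by rw [← h2.deriv, ← e2]; rfl

lemma cont (hF : Sm F) : Continuous (fun p : ℝ × ℝ => F p.1 p.2) := ContDiff.continuous hF

lemma cont_x (hF : Sm F) (t : ℝ) : Continuous (F t) :=
  hF.cont.comp (Continuous.prodMk_right t)

lemma intervalIntegrable (hF : Sm F) (t a b : ℝ) :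
    IntervalIntegrable (F t) volume a b := (hF.cont_x t).intervalIntegrable a b

/-- Differentiation under the integral sign. -/
lemma hasDerivAt_integral (hF : Sm F) (a b t : ℝ) :
    HasDerivAt (fun s => ∫ x in a..b, F s x) (∫ x in a..b, _root_.dt F t x) t := by
  obtain ⟨K, hK⟩ := ((isCompact_Icc (a := t - 1) (b := t + 1)).prod
    (isCompact_uIcc (a := a) (b := b))).exists_bound_of_continuousOn hF.dt.cont.continuousOn
  refine (intervalIntegral.hasDerivAt_integral_of_dominated_loc_of_deriv_le
    (bound := fun _ => K) (s := Set.Icc (t - 1) (t + 1))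
    (Icc_mem_nhds (by linarith) (by linarith))
    (Filter.Eventually.of_forall fun s => (hF.cont_x s).aestronglyMeasurable)
    (hF.intervalIntegrable t a b) (hF.dt.cont_x t).aestronglyMeasurable
    (Filter.Eventually.of_forall fun x hx s hs => ?_) intervalIntegrable_const
    (Filter.Eventually.of_forall fun x _ s _ => hF.hasDerivAt_t s x)).2
  exact hK (s, x) ⟨hs, Set.uIoc_subset_uIcc hx⟩

lemma integral_dx_zero (hF : Sm F) (hp : Per F) (t : ℝ) :
    ∫ x in (0 : ℝ)..1, _root_.dx F t x = 0 := by
  rw [intervalIntegral.integral_eq_sub_of_hasDerivAt (fun x _ => hF.hasDerivAt_x t x)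
    (hF.dx.intervalIntegrable t 0 1)]
  have := hp t 0
  rw [zero_add] at this
  rw [this, sub_self]

end Sm

lemma Per.dx {F : ℝ → ℝ → ℝ} (hp : Per F) : Per (dx F) := by
  intro t x
  have h : (fun y => F t (y + 1)) = F t := funext fun y => hp t y
  unfold _root_.dx
  rw [← deriv_comp_add_const, h]

/-- A maximum principle for transport inequalities on the torus. -/
lemma transport_max_principle {f ft fx b : ℝ → ℝ → ℝ} {M : ℝ}
    (hc : Continuous (fun p : ℝ × ℝ => f p.1 p.2))
    (hft : ∀ t x, HasDerivAt (fun s => f s x) (ft t x) t)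
    (hfx : ∀ t x, HasDerivAt (f t) (fx t x) x) (hp : Per f) (h0 : ∀ x, f 0 x ≤ M)
    (h : ∀ t x, 0 ≤ t → M < f t x → ft t x + b t x * fx t x ≤ 0)
    (t x : ℝ) (ht : 0 ≤ t) : f t x ≤ M := by
  by_contra! hM
  obtain ⟨ε, hε, hεM⟩ : ∃ ε > 0, M < f t x - ε * t := by
    refine ⟨(f t x - M) / (2 * (t + 1)), by apply div_pos <;> linarith, ?_⟩
    have : (f t x - M) / (2 * (t + 1)) * t = (f t x - M) * (t / (2 * (t + 1))) := by ring
    have h2 : t / (2 * (t + 1)) < 1 := by rw [div_lt_one] <;> linarith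
    nlinarith
  obtain ⟨⟨t₀, x₀⟩, ⟨ht₀, -⟩, hmax⟩ :=
    ((isCompact_Icc (a := (0 : ℝ)) (b := t)).prod
      (isCompact_Icc (a := (0 : ℝ)) (b := 1))).exists_isMaxOn
      ⟨(0, 0), by simp [ht]⟩
      (f := fun p : ℝ × ℝ => f p.1 p.2 - ε * p.1) (by fun_prop)
  have hmax' : ∀ s ∈ Set.Icc 0 t, ∀ y, f s y - ε * s ≤ f t₀ x₀ - ε * t₀ := by
    intro s hs y
    obtain ⟨z, hz, hyz⟩ := Function.Periodic.exists_mem_Ico₀ (f := f s) (fun y => hp s y)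
      one_pos y
    rw [hyz]
    exact hmax (a := (s, z)) ⟨hs, Set.Ico_subset_Icc_self hz⟩
  have hgt : M < f t₀ x₀ - ε * t₀ := hεM.trans_le (hmax' t ⟨ht, le_rfl⟩ x)
  have ht₀pos : 0 < t₀ := by
    rcases ht₀.1.lt_or_eq with h' | h'
    · exact h'
    · dsimp only at h'
      subst h'
      linarith [h0 x₀]
  have hx0 : fx t₀ x₀ = 0 := by
    refine IsLocalMax.hasDerivAt_eq_zero (Filter.Eventually.of_forall fun y => ?_) (hfx t₀ x₀)
    linarith [hmax' t₀ ht₀ y]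
  have hslope : 0 ≤ ft t₀ x₀ - ε := by
    have hd : HasDerivAt (fun s => f s x₀ - ε * s) (ft t₀ x₀ - ε) t₀ := by
      simpa using (hft t₀ x₀).fun_sub ((hasDerivAt_id t₀).const_mul ε)
    have hd' := (hasDerivWithinAt_iff_tendsto_slope' (s := Set.Iio t₀) (by simp)).1
      hd.hasDerivWithinAt
    refine ge_of_tendsto hd' ?_
    filter_upwards [Ioo_mem_nhdsLT ht₀pos] with s hs
    rw [slope_def_field]
    exact div_nonneg_of_nonpos (by linarith [hmax' s ⟨hs.1.le, hs.2.le.trans ht₀.2⟩ x₀])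
      (by linarith [hs.2])
  have := h t₀ x₀ ht₀pos.le (by nlinarith)
  rw [hx0] at this
  linarith

/-- Poincaré's inequality for a function with a zero in the unit interval. -/
lemma sq_le_integral_sq_deriv {g g' : ℝ → ℝ} (hg : ∀ x, HasDerivAt g (g' x) x)
    (hc : Continuous g') {y : ℝ} (hy : y ∈ Set.Icc (0 : ℝ) 1) (hgy : g y = 0) {x : ℝ}
    (hx : x ∈ Set.Icc (0 : ℝ) 1) : g x ^ 2 ≤ ∫ z in (0 : ℝ)..1, g' z ^ 2 := by
  set A := ∫ z in (0 : ℝ)..1, |g' z| with hA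
  have h1 : |g x| ≤ A := by
    have : g x = ∫ z in y..x, g' z := by
      rw [intervalIntegral.integral_eq_sub_of_hasDerivAt (fun z _ => hg z)
        (hc.intervalIntegrable y x), hgy, sub_zero]
    rw [this]
    refine (intervalIntegral.norm_integral_le_abs_integral_norm (f := g')).trans ?_
    refine (intervalIntegral.abs_integral_mono_interval ?_ ?_ ?_).trans_eq (abs_of_nonneg ?_)
    · rw [Set.uIoc_of_le zero_le_one]
      intro z hz
      rcases Set.mem_uIoc.1 hz with h | h
      · exact ⟨hy.1.trans_lt h.1, h.2.trans hx.2⟩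
      · exact ⟨hx.1.trans_lt h.1, h.2.trans hy.2⟩
    · exact Filter.Eventually.of_forall fun z => abs_nonneg _
    · exact hc.abs.intervalIntegrable 0 1
    · exact intervalIntegral.integral_nonneg zero_le_one fun z _ => abs_nonneg _
  have h2 : A ^ 2 ≤ ∫ z in (0 : ℝ)..1, g' z ^ 2 := by
    have h3 : 0 ≤ ∫ z in (0 : ℝ)..1, (g' z ^ 2 - 2 * A * |g' z| + A ^ 2) := by
      refine intervalIntegral.integral_nonneg zero_le_one fun z _ => ?_
      nlinarith [sq_nonneg (|g' z| - A), sq_abs (g' z)]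
    rw [intervalIntegral.integral_add, intervalIntegral.integral_sub,
      intervalIntegral.integral_const_mul, ← hA] at h3
    · simp at h3
      nlinarith
    all_goals exact Continuous.intervalIntegrable (by fun_prop) _ _
  rw [← sq_abs]
  exact (pow_le_pow_left₀ (abs_nonneg _) h1 2).trans h2

/-- A continuous function with a vanishing positively weighted mean has a zero. -/
lemma exists_zero_of_integral_eq_zero {f g : ℝ → ℝ} (hf : Continuous f) (hg : Continuous g)
    (hpos : ∀ x, 0 < f x) (h : ∫ x in (0 : ℝ)..1, f x * g x = 0) :
    ∃ y ∈ Set.Icc (0 : ℝ) 1, g y = 0 := by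
  have hd : ∀ x, HasDerivAt (fun x => ∫ y in (0 : ℝ)..x, f y * g y) (f x * g x) x := fun x =>
    ((hf.mul hg).integral_hasStrictDerivAt 0 x).hasDerivAt
  obtain ⟨c, hc, hc0⟩ := exists_hasDerivAt_eq_zero (f := fun x => ∫ y in (0 : ℝ)..x, f y * g y)
    zero_lt_one (fun x _ => (hd x).continuousAt.continuousWithinAt) (by simp [h])
    (fun x _ => hd x)
  exact ⟨c, Set.Ioo_subset_Icc_self hc, (mul_eq_zero.1 hc0).resolve_left (hpos c).ne'⟩

/-- Slope at `1` of the pressure potential. -/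
noncomputable def potSlope (a γ : ℝ) : ℝ := if γ = 1 then a else a * γ / (γ - 1)

/-- The pressure potential relative to the constant state `1`. -/
noncomputable def relPot (a γ s : ℝ) : ℝ := Ppot a γ s - Ppot a γ 1 - potSlope a γ * (s - 1)

/-- Derivative of the relative pressure potential. -/
noncomputable def relPot' (a γ s : ℝ) : ℝ :=
  if γ = 1 then a * Real.log s else a * γ / (γ - 1) * (s ^ (γ - 1) - 1)

lemma relPot_one (a γ : ℝ) : relPot a γ 1 = 0 := by simp [relPot]

lemma relPot'_one (a γ : ℝ) : relPot' a γ 1 = 0 := by simp [relPot']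

lemma Ppot_one_nonneg {a γ : ℝ} (ha : 0 < a) (hγ : 1 ≤ γ) : 0 ≤ Ppot a γ 1 := by
  unfold Ppot
  split_ifs
  · simpa using ha.le
  · rw [Real.one_rpow]
    exact div_nonneg (by linarith) (by linarith)

lemma hasDerivAt_relPot {a γ s : ℝ} (hs : 0 < s) :
    HasDerivAt (relPot a γ) (relPot' a γ s) s := by
  by_cases h : γ = 1
  · have h1 : HasDerivAt (fun s => a * (s * Real.log s + 1) - Ppot a γ 1 - a * (s - 1))
        (a * (Real.log s + 1) - a * 1) s :=
      ((((Real.hasDerivAt_mul_log hs.ne').add_const 1).const_mul a).sub_const _).fun_sub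
        (((hasDerivAt_id s).sub_const 1).const_mul a)
    have e1 : relPot a γ = fun s => a * (s * Real.log s + 1) - Ppot a γ 1 - a * (s - 1) := by
      funext s; simp [relPot, Ppot, potSlope, h]
    rw [e1]
    refine h1.congr_deriv ?_
    simp only [relPot', h, if_true]; ring
  · have hγ : γ - 1 ≠ 0 := sub_ne_zero.2 h
    have h1 : HasDerivAt (fun s => a * s ^ γ / (γ - 1) - Ppot a γ 1 - a * γ / (γ - 1) * (s - 1))
        (a * (γ * s ^ (γ - 1)) / (γ - 1) - a * γ / (γ - 1) * 1) s :=
      ((((Real.hasDerivAt_rpow_const (Or.inl hs.ne')).const_mul a).div_const _).sub_const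
        _).fun_sub (((hasDerivAt_id s).sub_const 1).const_mul _)
    have e1 : relPot a γ =
        fun s => a * s ^ γ / (γ - 1) - Ppot a γ 1 - a * γ / (γ - 1) * (s - 1) := by
      funext s; simp [relPot, Ppot, potSlope, h]
    rw [e1]
    refine h1.congr_deriv ?_
    simp only [relPot', h, if_false]; ring

lemma hasDerivAt_relPot' {a γ s : ℝ} (hs : 0 < s) :
    HasDerivAt (relPot' a γ) (a * γ * s ^ (γ - 2)) s := by
  by_cases h : γ = 1
  · have e1 : relPot' a γ = fun s => a * Real.log s := by funext s; simp [relPot', h]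
    rw [e1]
    refine ((Real.hasDerivAt_log hs.ne').const_mul a).congr_deriv ?_
    rw [h, show (1 : ℝ) - 2 = -1 by norm_num, Real.rpow_neg_one, mul_one]
  · have hγ : γ - 1 ≠ 0 := sub_ne_zero.2 h
    have e1 : relPot' a γ = fun s => a * γ / (γ - 1) * (s ^ (γ - 1) - 1) := by
      funext s; simp [relPot', h]
    rw [e1]
    refine (((Real.hasDerivAt_rpow_const (p := γ - 1) (Or.inl hs.ne')).sub_const 1).const_mul
      (a * γ / (γ - 1))).congr_deriv ?_
    rw [show γ - 1 - 1 = γ - 2 by ring]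
    field_simp

/-- The pressure in terms of the relative potential. -/
lemma pressure_eq (a γ s : ℝ) :
    a * s ^ γ = (γ - 1) * relPot a γ s + a + a * γ * (s - 1) := by
  by_cases h : γ = 1
  · simp only [h, Real.rpow_one]; ring
  · have hγ : γ - 1 ≠ 0 := sub_ne_zero.2 h
    simp only [relPot, Ppot, potSlope, h, if_false, Real.one_rpow]
    field_simp
    ring

/-- Second-order Taylor expansion of the relative potential at `1`. -/
lemma exists_relPot_eq {a γ s : ℝ} (hs : 0 < s) :
    ∃ ζ θ : ℝ, min 1 s ≤ ζ ∧ ζ ≤ max 1 s ∧ 0 ≤ θ ∧ θ ≤ (s - 1) ^ 2 ∧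
      relPot a γ s = a * γ * ζ ^ (γ - 2) * θ := by
  have mvt : ∀ (f f' : ℝ → ℝ) (r : ℝ), 0 < r → f 1 = 0 →
      (∀ x, 0 < x → HasDerivAt f (f' x) x) →
      ∃ ξ ∈ Set.Icc (min 1 r) (max 1 r), f r = f' ξ * (r - 1) := by
    intro f f' r hr h1 hf
    rcases lt_trichotomy r 1 with h | h | h
    · obtain ⟨c, hc, e⟩ := exists_hasDerivAt_eq_slope f f' h
        (fun x hx => (hf x (hr.trans_le hx.1)).continuousAt.continuousWithinAt)
        (fun x hx => hf x (hr.trans hx.1))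
      refine ⟨c, by rw [min_eq_right h.le, max_eq_left h.le]; exact Set.Ioo_subset_Icc_self hc, ?_⟩
      rw [e, h1]
      have : 1 - r ≠ 0 := by linarith
      field_simp
      ring
    · subst h
      exact ⟨1, by simp, by simp [h1]⟩
    · obtain ⟨c, hc, e⟩ := exists_hasDerivAt_eq_slope f f' h
        (fun x hx => (hf x (one_pos.trans_le hx.1)).continuousAt.continuousWithinAt)
        (fun x hx => hf x (one_pos.trans hx.1))
      refine ⟨c, by rw [min_eq_left h.le, max_eq_right h.le]; exact Set.Ioo_subset_Icc_self hc, ?_⟩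
      rw [e, h1]
      have : r - 1 ≠ 0 := by linarith
      field_simp
      ring
  obtain ⟨ξ, hξ, e1⟩ := mvt (relPot a γ) (relPot' a γ) s hs (relPot_one a γ)
    fun x hx => hasDerivAt_relPot hx
  have hξ0 : 0 < ξ := (lt_min one_pos hs).trans_le hξ.1
  obtain ⟨ζ, hζ, e2⟩ := mvt (relPot' a γ) (fun s => a * γ * s ^ (γ - 2)) ξ hξ0 (relPot'_one a γ)
    fun x hx => hasDerivAt_relPot' hx
  refine ⟨ζ, (ξ - 1) * (s - 1), ?_, ?_, ?_, ?_, by rw [e1, e2]; ring⟩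
  · exact (le_min (min_le_left _ _) hξ.1).trans hζ.1
  · exact hζ.2.trans (max_le (le_max_left _ _) hξ.2)
  · rcases le_total 1 s with h | h
    · rw [min_eq_left h, max_eq_right h] at hξ
      nlinarith [hξ.1]
    · rw [min_eq_right h, max_eq_left h] at hξ
      nlinarith [hξ.2]
  · rcases le_total 1 s with h | h
    · rw [min_eq_left h, max_eq_right h] at hξ
      nlinarith [hξ.1, hξ.2]
    · rw [min_eq_right h, max_eq_left h] at hξ
      nlinarith [hξ.1, hξ.2]

lemma relPot_nonneg {a γ s : ℝ} (ha : 0 < a) (hγ : 1 ≤ γ) (hs : 0 < s) : 0 ≤ relPot a γ s := by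
  obtain ⟨ζ, θ, hζ, -, hθ, -, e⟩ := exists_relPot_eq (a := a) (γ := γ) hs
  have hζ0 : 0 < ζ := (lt_min one_pos hs).trans_le hζ
  rw [e]
  positivity

lemma Sm.relPot {F : ℝ → ℝ → ℝ} (hF : Sm F) (h : ∀ t x, F t x ≠ 0) (a γ : ℝ) :
    Sm (fun t x => relPot a γ (F t x)) := by
  have hlin := (hF.sub (Sm.const 1)).mul (Sm.const (potSlope a γ))
  by_cases hγ : γ = 1
  · have := ((((hF.mul (hF.log h)).add (Sm.const 1)).mul (Sm.const a)).sub
      (Sm.const (Ppot a γ 1))).sub hlin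
    convert this using 3
    simp only [_root_.relPot, Ppot, hγ, if_true]; ring
  · have := (((hF.rpow γ h).mul (Sm.const (a / (γ - 1)))).sub (Sm.const (Ppot a γ 1))).sub hlin
    convert this using 3
    simp only [_root_.relPot, Ppot, hγ, if_false]; ring

lemma Sm.relPot' {F : ℝ → ℝ → ℝ} (hF : Sm F) (h : ∀ t x, F t x ≠ 0) (a γ : ℝ) :
    Sm (fun t x => relPot' a γ (F t x)) := by
  by_cases hγ : γ = 1
  · convert (hF.log h).mul (Sm.const a) using 3
    simp only [_root_.relPot', hγ, if_true]; ring
  · convert ((hF.rpow (γ - 1) h).sub (Sm.const 1)).mul (Sm.const (a * γ / (γ - 1))) using 3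
    simp only [_root_.relPot', hγ, if_false]; ring

/-- If the density `e` satisfies the balance law `∂ₜ e = 2t (∂ₓ J - D)` on the torus, then its
integral decays at the rate `2t ∫ D`. -/
lemma hasDerivAt_integral_of_balance {e J D : ℝ → ℝ → ℝ} (he : Sm e) (hJ : Sm J) (hD : Sm D)
    (hJp : Per J) (h : ∀ t x, dt e t x = 2 * t * (dx J t x - D t x)) (t : ℝ) :
    HasDerivAt (fun s => ∫ x in (0 : ℝ)..1, e s x) (-(2 * t) * ∫ x in (0 : ℝ)..1, D t x) t := by
  refine (he.hasDerivAt_integral 0 1 t).congr_deriv ?_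
  simp_rw [h]
  rw [intervalIntegral.integral_const_mul, intervalIntegral.integral_sub
    (hJ.dx.intervalIntegrable t 0 1) (hD.intervalIntegrable t 0 1), hJ.integral_dx_zero hJp]
  ring

/-- Smooth positive periodic solutions of the compressible Navier–Stokes system after the time
change `t ↦ t²`, which makes the system hold for all real times. -/
structure IsSquaredTimeSol (a γ ν : ℝ) (ρ u : ℝ → ℝ → ℝ) : Prop where
  smρ : Sm ρ
  smu : Sm u
  perρ : Per ρ
  peru : Per u
  pos : ∀ t x, 0 < ρ t x
  mass : ∀ t x, dt ρ t x = -(2 * t) * (dx ρ t x * u t x + ρ t x * dx u t x)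
  mom : ∀ t x, ρ t x * dt u t x = 2 * t * (-(ρ t x * u t x * dx u t x) + ν * dx (dx u) t x
    - ρ t x * (a * γ * ρ t x ^ (γ - 2)) * dx ρ t x)

/-- The energy density relative to the constant state. -/
noncomputable def enDens (a γ : ℝ) (ρ u : ℝ → ℝ → ℝ) (t x : ℝ) : ℝ :=
  1 / 2 * (ρ t x * u t x ^ 2) + relPot a γ (ρ t x)

/-- The effective velocity `u - ν ∂ₓ(1/ρ)`. -/
noncomputable def effVel (ν : ℝ) (ρ u : ℝ → ℝ → ℝ) (t x : ℝ) : ℝ :=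
  u t x - ν * dx (fun t x => (ρ t x)⁻¹) t x

namespace IsSquaredTimeSol

variable {a γ ν : ℝ} {ρ u : ℝ → ℝ → ℝ} (S : IsSquaredTimeSol a γ ν ρ u)
include S

lemma ne (t x : ℝ) : ρ t x ≠ 0 := (S.pos t x).ne'

lemma smπ : Sm (fun t x => a * γ * ρ t x ^ (γ - 2)) := (Sm.const _).mul (S.smρ.rpow _ S.ne)

lemma smq : Sm (fun t x => (ρ t x)⁻¹) := S.smρ.inv S.ne

lemma perq : Per (fun t x => (ρ t x)⁻¹) := fun t x => by simp only [S.perρ t x]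

lemma smH : Sm (fun t x => relPot a γ (ρ t x)) := S.smρ.relPot S.ne a γ

lemma smh : Sm (fun t x => relPot' a γ (ρ t x)) := S.smρ.relPot' S.ne a γ

lemma smV : Sm (effVel ν ρ u) := S.smu.sub ((Sm.const ν).mul S.smq.dx)

lemma perV : Per (effVel ν ρ u) := fun t x => by
  simp only [effVel, S.peru t x, S.perq.dx t x]

lemma dx_inv (t x : ℝ) : dx (fun t x => (ρ t x)⁻¹) t x = -dx ρ t x / ρ t x ^ 2 :=
  ((S.smρ.hasDerivAt_x t x).fun_inv (S.ne t x)).deriv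

lemma dt_relPot (t x : ℝ) :
    HasDerivAt (fun s => relPot a γ (ρ s x)) (relPot' a γ (ρ t x) * dt ρ t x) t :=
  HasDerivAt.comp t (h := fun s => ρ s x) (hasDerivAt_relPot (S.pos t x)) (S.smρ.hasDerivAt_t t x)

lemma dx_relPot' (t x : ℝ) :
    HasDerivAt (fun y => relPot' a γ (ρ t y)) (a * γ * ρ t x ^ (γ - 2) * dx ρ t x) x :=
  HasDerivAt.comp x (h := fun y => ρ t y) (hasDerivAt_relPot' (S.pos t x))
    (S.smρ.hasDerivAt_x t x)

lemma smEn {v : ℝ → ℝ → ℝ} (hv : Sm v) : Sm (enDens a γ ρ v) :=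
  ((Sm.const _).mul (S.smρ.mul (hv.pow 2))).add S.smH

lemma dt_enDens {v : ℝ → ℝ → ℝ} (hv : Sm v) (t x : ℝ) : dt (enDens a γ ρ v) t x =
    1 / 2 * (dt ρ t x * v t x ^ 2 + ρ t x * (2 * v t x * dt v t x))
      + relPot' a γ (ρ t x) * dt ρ t x := by
  have := (((S.smρ.hasDerivAt_t t x).fun_mul ((hv.hasDerivAt_t t x).fun_pow 2)).const_mul
    (1 / 2)).fun_add (S.dt_relPot t x)
  refine this.deriv.trans ?_
  norm_num

lemma energy_hasDerivAt (t : ℝ) :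
    HasDerivAt (fun s => ∫ x in (0 : ℝ)..1, enDens a γ ρ u s x)
      (-(2 * t) * ∫ x in (0 : ℝ)..1, ν * dx u t x ^ 2) t := by
  refine hasDerivAt_integral_of_balance (S.smEn S.smu)
    (J := fun t x => -(1 / 2) * (ρ t x * u t x ^ 3) + ν * (u t x * dx u t x)
      - relPot' a γ (ρ t x) * (ρ t x * u t x))
    (((Sm.const _).mul (S.smρ.mul (S.smu.pow 3))).add ((Sm.const _).mul (S.smu.mul S.smu.dx))
      |>.sub (S.smh.mul (S.smρ.mul S.smu)))
    ((Sm.const _).mul (S.smu.dx.pow 2))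
    (fun t x => by simp only [S.perρ t x, S.peru t x, S.peru.dx t x]) (fun t x => ?_) t
  have hρ := S.smρ.hasDerivAt_x t x
  have hu := S.smu.hasDerivAt_x t x
  have hJ := (((hρ.fun_mul (hu.fun_pow 3)).const_mul (-(1 / 2))).fun_add
    ((hu.fun_mul (S.smu.dx.hasDerivAt_x t x)).const_mul ν)).fun_sub
    ((S.dx_relPot' t x).fun_mul (hρ.fun_mul hu))
  rw [S.dt_enDens S.smu]
  unfold dx at hJ ⊢
  rw [hJ.deriv]
  have h1 := S.mass t x
  have h2 := S.mom t x
  unfold dx at h1 h2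
  norm_num
  linear_combination (1 / 2 * u t x ^ 2 + relPot' a γ (ρ t x)) * h1 + u t x * h2

lemma dt_effVel (t x : ℝ) : ρ t x * dt (effVel ν ρ u) t x =
    2 * t * (-(ρ t x * u t x * dx (effVel ν ρ u) t x)
      - ρ t x * (a * γ * ρ t x ^ (γ - 2)) * dx ρ t x) := by
  set q : ℝ → ℝ → ℝ := fun t x => (ρ t x)⁻¹ with hq
  have smq : Sm q := S.smq
  have hqt : dt q = fun t x => 2 * t * (dx u t x * q t x - u t x * dx q t x) := by
    funext t x
    have h1 : dt q t x = -dt ρ t x / ρ t x ^ 2 :=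
      ((S.smρ.hasDerivAt_t t x).fun_inv (S.ne t x)).deriv
    have h2 : dx q t x = -dx ρ t x / ρ t x ^ 2 := S.dx_inv t x
    have := S.ne t x
    rw [h1, h2, S.mass t x]
    simp only [hq]
    field_simp
    ring
  have hqx : dt (dx q) t x = 2 * t * (dx (dx u) t x * q t x - u t x * dx (dx q) t x) := by
    rw [smq.dt_dx, hqt]
    refine ((((S.smu.dx.hasDerivAt_x t x).fun_mul (smq.hasDerivAt_x t x)).fun_sub
      ((S.smu.hasDerivAt_x t x).fun_mul (smq.dx.hasDerivAt_x t x))).const_mul (2 * t)).deriv.trans ?_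
    ring
  have h1 : dt (effVel ν ρ u) t x = dt u t x - ν * dt (dx q) t x :=
    ((S.smu.hasDerivAt_t t x).fun_sub ((smq.dx.hasDerivAt_t t x).const_mul ν)).deriv
  have h2 : dx (effVel ν ρ u) t x = dx u t x - ν * dx (dx q) t x :=
    ((S.smu.hasDerivAt_x t x).fun_sub ((smq.dx.hasDerivAt_x t x).const_mul ν)).deriv
  have h3 : ρ t x * q t x = 1 := mul_inv_cancel₀ (S.ne t x)
  rw [h1, h2, hqx]
  linear_combination S.mom t x - ν * 2 * t * dx (dx u) t x * h3

lemma bd_hasDerivAt (t : ℝ) :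
    HasDerivAt (fun s => ∫ x in (0 : ℝ)..1, enDens a γ ρ (effVel ν ρ u) s x)
      (-(2 * t) * ∫ x in (0 : ℝ)..1,
        ν * (a * γ * ρ t x ^ (γ - 2)) * (dx ρ t x ^ 2 * (ρ t x)⁻¹)) t := by
  refine hasDerivAt_integral_of_balance (S.smEn S.smV)
    (J := fun t x => -(1 / 2) * (ρ t x * u t x * effVel ν ρ u t x ^ 2)
      - relPot' a γ (ρ t x) * (ρ t x * u t x))
    (((Sm.const _).mul ((S.smρ.mul S.smu).mul (S.smV.pow 2))).sub
      (S.smh.mul (S.smρ.mul S.smu)))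
    (((Sm.const ν).mul S.smπ).mul ((S.smρ.dx.pow 2).mul S.smq))
    (fun t x => by simp only [S.perρ t x, S.peru t x, S.perV t x]) (fun t x => ?_) t
  have hρ := S.smρ.hasDerivAt_x t x
  have hu := S.smu.hasDerivAt_x t x
  have hJ := ((((hρ.fun_mul hu).fun_mul ((S.smV.hasDerivAt_x t x).fun_pow 2)).const_mul
    (-(1 / 2)))).fun_sub ((S.dx_relPot' t x).fun_mul (hρ.fun_mul hu))
  rw [S.dt_enDens S.smV]
  have h1 := S.mass t x
  have h2 := S.dt_effVel t x
  have h3 : effVel ν ρ u t x - u t x = ν * dx ρ t x * ((ρ t x)⁻¹) ^ 2 := by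
    rw [effVel, S.dx_inv]
    have := S.ne t x
    field_simp
    ring
  have h4 : ρ t x * (ρ t x)⁻¹ = 1 := mul_inv_cancel₀ (S.ne t x)
  refine Eq.trans ?_ (congrArg (fun z => 2 * t * (z - _)) hJ.deriv.symm)
  norm_num
  linear_combination (1 / 2 * effVel ν ρ u t x ^ 2 + relPot' a γ (ρ t x)) * h1
    + effVel ν ρ u t x * h2
    - 2 * t * ρ t x * (a * γ * ρ t x ^ (γ - 2)) * dx ρ t x * h3
    - 2 * t * (a * γ * ρ t x ^ (γ - 2)) * dx ρ t x ^ 2 * ν * (ρ t x)⁻¹ * h4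

end IsSquaredTimeSol

/-- The zero-mean primitive of a zero-mean function `m`. -/
noncomputable def primitive (m : ℝ → ℝ → ℝ) (t x : ℝ) : ℝ :=
  (∫ y in (0 : ℝ)..x, m t y) - ∫ y in (0 : ℝ)..1, (1 - y) * m t y

section primitive

variable {m Q : ℝ → ℝ → ℝ}

lemma continuous_primitive (hm : Sm m) :
    Continuous (fun p : ℝ × ℝ => primitive m p.1 p.2) := by
  have hc := hm.cont
  refine Continuous.sub (intervalIntegral.continuous_parametric_primitive_of_continuous hc)
    (Continuous.comp (g := fun t : ℝ => ∫ y in (0 : ℝ)..1, (1 - y) * m t y) ?_ continuous_fst)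
  refine intervalIntegral.continuous_parametric_intervalIntegral_of_continuous' ?_ 0 1
  exact (continuous_const.sub continuous_snd).mul hc

lemma hasDerivAt_primitive_x (hm : Sm m) (t x : ℝ) :
    HasDerivAt (primitive m t) (m t x) x :=
  ((hm.cont_x t).integral_hasStrictDerivAt 0 x).hasDerivAt.sub_const _

lemma per_primitive (hm : Sm m) (hp : Per m) (h0 : ∀ t, ∫ x in (0 : ℝ)..1, m t x = 0) :
    Per (primitive m) := by
  intro t x
  have h : ∫ y in x..x + 1, m t y = 0 := by
    rw [Function.Periodic.intervalIntegral_add_eq (f := m t) (hp t) x 0, zero_add, h0]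
  unfold primitive
  rw [← intervalIntegral.integral_add_adjacent_intervals (hm.intervalIntegrable t 0 x)
    (hm.intervalIntegrable t x (x + 1)), h, add_zero]

lemma hasDerivAt_primitive_t (hm : Sm m) (hQ : Sm Q)
    (h : ∀ t x, dt m t x = -(2 * t) * dx Q t x) (t x : ℝ) :
    HasDerivAt (fun s => primitive m s x)
      (-(2 * t) * (Q t x - ∫ y in (0 : ℝ)..1, Q t y)) t := by
  have hw : Sm (fun _ y : ℝ => 1 - y) := contDiff_const.sub contDiff_snd
  refine ((hm.hasDerivAt_integral 0 x t).fun_sub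
    ((hw.mul hm).hasDerivAt_integral 0 1 t)).congr_deriv ?_
  have h1 : ∀ y, dt (fun t x => (1 - x) * m t x) t y = -(2 * t) * ((1 - y) * dx Q t y) := by
    intro y
    refine ((hm.hasDerivAt_t t y).const_mul (1 - y)).deriv.trans ?_
    rw [h]; ring
  simp_rw [h1, h]
  rw [intervalIntegral.integral_const_mul, intervalIntegral.integral_const_mul,
    intervalIntegral.integral_eq_sub_of_hasDerivAt (fun y _ => hQ.hasDerivAt_x t y)
      (hQ.dx.intervalIntegrable t 0 x),
    intervalIntegral.integral_mul_deriv_eq_deriv_mul (u := fun y => 1 - y) (u' := fun _ => -1)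
      (fun y _ => by simpa using (hasDerivAt_id y).const_sub 1)
      (fun y _ => hQ.hasDerivAt_x t y) intervalIntegrable_const
      (hQ.dx.intervalIntegrable t 0 1)]
  simp only [intervalIntegral.integral_neg, neg_mul, one_mul]
  ring

lemma abs_primitive_le (hm : Sm m) (hp : Per m) (h0 : ∀ t, ∫ x in (0 : ℝ)..1, m t x = 0)
    (t x : ℝ) : |primitive m t x| ≤ 2 * ∫ y in (0 : ℝ)..1, |m t y| := by
  obtain ⟨z, hz, hxz⟩ := Function.Periodic.exists_mem_Ico₀ (f := primitive m t)
    (fun y => per_primitive hm hp h0 t y) one_pos x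
  rw [hxz]
  have hc := hm.cont_x t
  have h1 : |∫ y in (0 : ℝ)..z, m t y| ≤ ∫ y in (0 : ℝ)..1, |m t y| := by
    refine (intervalIntegral.abs_integral_le_integral_abs hz.1).trans ?_
    exact intervalIntegral.integral_mono_interval le_rfl hz.1 hz.2.le
      (Filter.Eventually.of_forall fun y => abs_nonneg _) (hc.abs.intervalIntegrable 0 1)
  have h2 : |∫ y in (0 : ℝ)..1, (1 - y) * m t y| ≤ ∫ y in (0 : ℝ)..1, |m t y| := by
    refine (intervalIntegral.abs_integral_le_integral_abs zero_le_one).trans ?_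
    refine intervalIntegral.integral_mono_on zero_le_one
      (Continuous.intervalIntegrable (by fun_prop) 0 1) (hc.abs.intervalIntegrable 0 1) ?_
    intro y hy
    rw [abs_mul]
    refine mul_le_of_le_one_left (abs_nonneg _) ?_
    rw [abs_le]
    constructor <;> linarith [hy.1, hy.2]
  refine (abs_sub _ _).trans ?_
  linarith

end primitive

namespace IsSquaredTimeSol

variable {a γ ν : ℝ} {ρ u : ℝ → ℝ → ℝ} (S : IsSquaredTimeSol a γ ν ρ u)
include S

lemma sm_mom : Sm (fun t x => ρ t x * u t x) := S.smρ.mul S.smu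

lemma per_mom : Per (fun t x => ρ t x * u t x) := fun t x => by
  simp only [S.perρ t x, S.peru t x]

lemma smp : Sm (fun t x => a * ρ t x ^ γ) := (Sm.const a).mul (S.smρ.rpow γ S.ne)

/-- The momentum flux. -/
lemma smQ : Sm (fun t x => ρ t x * u t x ^ 2 + a * ρ t x ^ γ - ν * dx u t x) :=
  ((S.smρ.mul (S.smu.pow 2)).add S.smp).sub ((Sm.const ν).mul S.smu.dx)

lemma perQ : Per (fun t x => ρ t x * u t x ^ 2 + a * ρ t x ^ γ - ν * dx u t x) := fun t x => by
  simp only [S.perρ t x, S.peru t x, S.peru.dx t x]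

lemma dt_mom (t x : ℝ) : dt (fun t x => ρ t x * u t x) t x =
    -(2 * t) * dx (fun t x => ρ t x * u t x ^ 2 + a * ρ t x ^ γ - ν * dx u t x) t x := by
  have hρ := S.smρ.hasDerivAt_x t x
  have hu := S.smu.hasDerivAt_x t x
  have h1 : dt (fun t x => ρ t x * u t x) t x = dt ρ t x * u t x + ρ t x * dt u t x :=
    ((S.smρ.hasDerivAt_t t x).fun_mul (S.smu.hasDerivAt_t t x)).deriv
  have h2 := (((hρ.fun_mul (hu.fun_pow 2)).fun_add ((hρ.rpow_const (p := γ)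
    (Or.inl (S.ne t x))).const_mul a)).fun_sub ((S.smu.dx.hasDerivAt_x t x).const_mul ν)).deriv
  have h3 : ρ t x ^ (γ - 1) = ρ t x * ρ t x ^ (γ - 2) := by
    rw [show γ - 1 = 1 + (γ - 2) by ring, Real.rpow_add (S.pos t x), Real.rpow_one]
  refine Eq.trans ?_ (congrArg (fun z => -(2 * t) * z) h2.symm)
  rw [h1, h3]
  norm_num
  linear_combination u t x * S.mass t x + S.mom t x

lemma integral_mom (h0 : ∫ x in (0 : ℝ)..1, ρ 0 x * u 0 x = 0) (t : ℝ) :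
    ∫ x in (0 : ℝ)..1, ρ t x * u t x = 0 := by
  have hd : ∀ t, HasDerivAt (fun s => ∫ x in (0 : ℝ)..1, ρ s x * u s x) 0 t := by
    intro t
    refine (S.sm_mom.hasDerivAt_integral 0 1 t).congr_deriv ?_
    simp_rw [S.dt_mom]
    rw [intervalIntegral.integral_const_mul, S.smQ.integral_dx_zero S.perQ, mul_zero]
  exact (is_const_of_deriv_eq_zero (fun t => (hd t).differentiableAt) (fun t => (hd t).deriv)
    t 0).trans h0

lemma integral_mass (h0 : ∫ x in (0 : ℝ)..1, ρ 0 x = 1) (t : ℝ) :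
    ∫ x in (0 : ℝ)..1, ρ t x = 1 := by
  have hd : ∀ t, HasDerivAt (fun s => ∫ x in (0 : ℝ)..1, ρ s x) 0 t := by
    intro t
    refine (S.smρ.hasDerivAt_integral 0 1 t).congr_deriv ?_
    have h : ∀ x, dt ρ t x = -(2 * t) * dx (fun t x => ρ t x * u t x) t x := fun x =>
      (S.mass t x).trans (congrArg (fun z => -(2 * t) * z)
        ((S.smρ.hasDerivAt_x t x).fun_mul (S.smu.hasDerivAt_x t x)).deriv.symm)
    simp_rw [h]
    rw [intervalIntegral.integral_const_mul, S.sm_mom.integral_dx_zero S.per_mom, mul_zero]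
  exact (is_const_of_deriv_eq_zero (fun t => (hd t).differentiableAt) (fun t => (hd t).deriv)
    t 0).trans h0

lemma energy_le (hν : 0 ≤ ν) {t : ℝ} (ht : 0 ≤ t) :
    ∫ x in (0 : ℝ)..1, enDens a γ ρ u t x ≤ ∫ x in (0 : ℝ)..1, enDens a γ ρ u 0 x := by
  refine antitoneOn_of_deriv_nonpos (convex_Ici 0)
    (fun s _ => (S.energy_hasDerivAt s).continuousAt.continuousWithinAt)
    (fun s _ => (S.energy_hasDerivAt s).differentiableAt.differentiableWithinAt)
    (fun s hs => ?_) Set.self_mem_Ici ht ht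
  rw [interior_Ici, Set.mem_Ioi] at hs
  rw [(S.energy_hasDerivAt s).deriv]
  have : 0 ≤ ∫ x in (0 : ℝ)..1, ν * dx u s x ^ 2 :=
    intervalIntegral.integral_nonneg zero_le_one fun x _ => by positivity
  nlinarith

end IsSquaredTimeSol

namespace IsSquaredTimeSol

variable {a γ ν : ℝ} {ρ u : ℝ → ℝ → ℝ} (S : IsSquaredTimeSol a γ ν ρ u)
include S

/-- Consequences of the energy inequality: a bound on the kinetic energy, on the primitive of
the momentum and on the mean of the momentum flux. -/
lemma energy_consequences {E : ℝ} (ha : 0 < a) (hγ1 : 1 ≤ γ) (hγ2 : γ ≤ 2) (hν : 0 < ν)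
    (hmass : ∫ x in (0 : ℝ)..1, ρ 0 x = 1) (hmom : ∫ x in (0 : ℝ)..1, ρ 0 x * u 0 x = 0)
    (hE : ∫ x in (0 : ℝ)..1, enDens a γ ρ u 0 x ≤ E) {t : ℝ} (ht : 0 ≤ t) :
    (∀ x, |primitive (fun t x => ρ t x * u t x) t x| ≤ 1 + 2 * E) ∧
    a ≤ (∫ x in (0 : ℝ)..1, (ρ t x * u t x ^ 2 + a * ρ t x ^ γ - ν * dx u t x)) ∧
    (∫ x in (0 : ℝ)..1, (ρ t x * u t x ^ 2 + a * ρ t x ^ γ - ν * dx u t x)) ≤ a + 3 * E := by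
  have smK := S.smρ.mul (S.smu.pow 2)
  have iK := smK.intervalIntegrable t 0 1
  have iH := S.smH.intervalIntegrable t 0 1
  have iρ := S.smρ.intervalIntegrable t 0 1
  have ip := S.smp.intervalIntegrable t 0 1
  have hm := S.integral_mass hmass t
  set K := ∫ x in (0 : ℝ)..1, ρ t x * u t x ^ 2 with hK
  set H := ∫ x in (0 : ℝ)..1, relPot a γ (ρ t x) with hH
  have hK0 : 0 ≤ K := intervalIntegral.integral_nonneg zero_le_one fun x _ =>
    mul_nonneg (S.pos t x).le (sq_nonneg _)
  have hH0 : 0 ≤ H := intervalIntegral.integral_nonneg zero_le_one fun x _ =>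
    relPot_nonneg ha hγ1 (S.pos t x)
  have hsum : 1 / 2 * K + H ≤ E := by
    refine le_trans (le_of_eq ?_) ((S.energy_le hν.le ht).trans hE)
    simp only [enDens]
    rw [intervalIntegral.integral_add (iK.const_mul _) iH, intervalIntegral.integral_const_mul]
  have hp : ∫ x in (0 : ℝ)..1, a * ρ t x ^ γ = (γ - 1) * H + a := by
    simp_rw [pressure_eq a γ]
    rw [intervalIntegral.integral_add ((iH.const_mul _).add intervalIntegrable_const)
      ((iρ.sub intervalIntegrable_const).const_mul _),
      intervalIntegral.integral_add (iH.const_mul _) intervalIntegrable_const,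
      intervalIntegral.integral_const_mul, intervalIntegral.integral_const_mul,
      intervalIntegral.integral_sub iρ intervalIntegrable_const, hm]
    simp [hH]
  have hQ : (∫ x in (0 : ℝ)..1, (ρ t x * u t x ^ 2 + a * ρ t x ^ γ - ν * dx u t x)) =
      K + ((γ - 1) * H + a) := by
    rw [intervalIntegral.integral_sub (iK.add ip) ((S.smu.dx.intervalIntegrable t 0 1).const_mul _),
      intervalIntegral.integral_add iK ip, hp, intervalIntegral.integral_const_mul,
      S.smu.integral_dx_zero S.peru]
    ring
  refine ⟨fun x => ?_, ?_, ?_⟩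
  · refine (abs_primitive_le S.sm_mom S.per_mom (S.integral_mom hmom) t x).trans ?_
    have h1 : ∫ y in (0 : ℝ)..1, |ρ t y * u t y| ≤
        ∫ y in (0 : ℝ)..1, 1 / 2 * (ρ t y + ρ t y * u t y ^ 2) := by
      refine intervalIntegral.integral_mono_on zero_le_one
        ((S.sm_mom.cont_x t).abs.intervalIntegrable 0 1) ((iρ.add iK).const_mul _) fun y _ => ?_
      have hpos := S.pos t y
      rw [abs_mul, abs_of_pos hpos, ← sq_abs (u t y)]
      nlinarith [mul_nonneg hpos.le (sq_nonneg (|u t y| - 1))]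
    rw [intervalIntegral.integral_const_mul, intervalIntegral.integral_add iρ iK, hm] at h1
    linarith
  · rw [hQ]
    nlinarith
  · rw [hQ]
    nlinarith

/-- Uniform-in-time bounds on the density. -/
lemma density_bounds {lo hi E : ℝ} (ha : 0 < a) (hγ1 : 1 ≤ γ) (hγ2 : γ ≤ 2) (hν : 0 < ν)
    (hE0 : 0 < E) (hlo : 0 < lo) (hlow : ∀ x, lo ≤ ρ 0 x) (hhi : ∀ x, ρ 0 x ≤ hi)
    (hmass : ∫ x in (0 : ℝ)..1, ρ 0 x = 1) (hmom : ∫ x in (0 : ℝ)..1, ρ 0 x * u 0 x = 0)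
    (hE : ∫ x in (0 : ℝ)..1, enDens a γ ρ u 0 x ≤ E) {t : ℝ} (ht : 0 ≤ t) (x : ℝ) :
    Real.exp ((min (ν * Real.log lo) 0 - 2 * (1 + 2 * E)) / ν) ≤ ρ t x ∧
    ρ t x ≤ Real.exp ((max (ν * Real.log hi) (ν * Real.log ((a + 3 * E) / a))
      + 2 * (1 + 2 * E)) / ν) := by
  set Φ := 1 + 2 * E with hΦ
  set φ := primitive (fun t x => ρ t x * u t x) with hφ
  set Q : ℝ → ℝ → ℝ := fun t x => ρ t x * u t x ^ 2 + a * ρ t x ^ γ - ν * dx u t x with hQ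
  set c : ℝ → ℝ := fun t => ∫ x in (0 : ℝ)..1, Q t x with hc
  have hen := fun {t : ℝ} (ht : 0 ≤ t) => S.energy_consequences ha hγ1 hγ2 hν hmass hmom hE ht
  set f : ℝ → ℝ → ℝ := fun t x => ν * Real.log (ρ t x) + φ t x with hf
  set ft : ℝ → ℝ → ℝ := fun t x => ν * (dt ρ t x / ρ t x) + -(2 * t) * (Q t x - c t) with hft
  set fx : ℝ → ℝ → ℝ := fun t x => ν * (dx ρ t x / ρ t x) + ρ t x * u t x with hfx
  have hfc : Continuous (fun p : ℝ × ℝ => f p.1 p.2) :=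
    (((Sm.const ν).mul (S.smρ.log S.ne)).cont).add (continuous_primitive S.sm_mom)
  have hdt : ∀ t x, HasDerivAt (fun s => f s x) (ft t x) t := fun t x =>
    (((S.smρ.hasDerivAt_t t x).log (S.ne t x)).const_mul ν).fun_add
      (hasDerivAt_primitive_t S.sm_mom S.smQ S.dt_mom t x)
  have hdx : ∀ t x, HasDerivAt (f t) (fx t x) x := fun t x =>
    (((S.smρ.hasDerivAt_x t x).log (S.ne t x)).const_mul ν).fun_add
      (hasDerivAt_primitive_x S.sm_mom t x)
  have hper : Per f := fun t x => by
    simp only [hf, S.perρ t x, per_primitive S.sm_mom S.per_mom (S.integral_mom hmom) t x, hφ]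
  have htr : ∀ t x, ft t x + 2 * t * u t x * fx t x = 2 * t * (c t - a * ρ t x ^ γ) := by
    intro t x
    have := S.ne t x
    simp only [hft, hfx, S.mass t x, hQ]
    field_simp
    ring
  have hmono : ∀ {r s : ℝ}, 0 < r → r ≤ s → ν * Real.log r ≤ ν * Real.log s := fun hr hrs =>
    mul_le_mul_of_nonneg_left (Real.log_le_log hr hrs) hν.le
  constructor
  · have key : -f t x ≤ -(min (ν * Real.log lo) 0 - Φ) := by
      refine transport_max_principle (f := fun t x => -f t x) (ft := fun t x => -ft t x)
        (fx := fun t x => -fx t x) (b := fun t x => 2 * t * u t x) hfc.neg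
        (fun t x => (hdt t x).fun_neg) (fun t x => (hdx t x).fun_neg)
        (fun t x => congrArg Neg.neg (hper t x)) (fun x => ?_) (fun t x ht hM => ?_) t x ht
      · have h1 := abs_le.1 ((hen le_rfl).1 x)
        have h2 := hmono hlo (hlow x)
        have h3 := min_le_left (ν * Real.log lo) 0
        simp only [hf]
        linarith [h1.1]
      · have h1 := abs_le.1 ((hen ht).1 x)
        have h3 := min_le_right (ν * Real.log lo) 0
        have h4 : ν * Real.log (ρ t x) < 0 := by
          simp only [hf] at hM
          linarith [h1.1]
        have h5 : ρ t x ≤ 1 := by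
          by_contra! h
          exact absurd h4 (not_lt.2 (mul_nonneg hν.le (Real.log_nonneg h.le)))
        have h6 : ρ t x ^ γ ≤ 1 := Real.rpow_le_one (S.pos t x).le h5 (by linarith)
        have h7 : a ≤ c t := (hen ht).2.1
        have h8 : 0 ≤ 2 * t * (c t - a * ρ t x ^ γ) :=
          mul_nonneg (by linarith) (by nlinarith)
        have h9 := htr t x
        linarith
    rw [← Real.le_log_iff_exp_le (S.pos t x), div_le_iff₀ hν]
    have h1 := abs_le.1 ((hen ht).1 x)
    simp only [hf] at key
    linarith [h1.2]
  · set M := max (ν * Real.log hi) (ν * Real.log ((a + 3 * E) / a)) with hMdef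
    have hR1 : 1 ≤ (a + 3 * E) / a := by rw [le_div_iff₀ ha]; linarith
    have key : f t x ≤ M + Φ := by
      refine transport_max_principle (b := fun t x => 2 * t * u t x) hfc hdt hdx hper
        (fun x => ?_) (fun t x ht hM => ?_) t x ht
      · have h1 := abs_le.1 ((hen le_rfl).1 x)
        have h2 := hmono (S.pos 0 x) (hhi x)
        have h3 := le_max_left (ν * Real.log hi) (ν * Real.log ((a + 3 * E) / a))
        simp only [hf]
        linarith [h1.2]
      · have h1 := abs_le.1 ((hen ht).1 x)
        have h3 := le_max_right (ν * Real.log hi) (ν * Real.log ((a + 3 * E) / a))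
        have h4 : ν * Real.log ((a + 3 * E) / a) < ν * Real.log (ρ t x) := by
          simp only [hf] at hM
          linarith [h1.2]
        have h5 : (a + 3 * E) / a ≤ ρ t x := by
          by_contra! h
          exact absurd h4 (not_lt.2 (hmono (S.pos t x) h.le))
        have h6 : ρ t x ≤ ρ t x ^ γ := by
          simpa using Real.rpow_le_rpow_of_exponent_le (hR1.trans h5) hγ1
        have h7 : c t ≤ a + 3 * E := (hen ht).2.2
        have h8 : a + 3 * E ≤ a * ρ t x := by
          rw [div_le_iff₀ ha] at h5
          linarith
        have h9 : 0 ≤ 2 * t * (a * ρ t x ^ γ - c t) :=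
          mul_nonneg (by linarith) (by nlinarith)
        have h10 := htr t x
        linarith
    rw [← Real.log_le_iff_le_exp (S.pos t x), le_div_iff₀ hν]
    have h1 := abs_le.1 ((hen ht).1 x)
    simp only [hf] at key
    linarith [h1.1]

end IsSquaredTimeSol

namespace IsSquaredTimeSol

variable {a γ ν : ℝ} {ρ u : ℝ → ℝ → ℝ} (S : IsSquaredTimeSol a γ ν ρ u)
include S

/-- The sum of the energy and of the Bresch–Desjardins entropy controls `∂ₓ ρ`. -/
lemma integral_sq_dx_le {hi : ℝ} (ha : 0 < a) (hγ1 : 1 ≤ γ) (hν : 0 < ν) {t : ℝ}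
    (hb : ∀ x, ρ t x ≤ hi) :
    ∫ x in (0 : ℝ)..1, dx ρ t x ^ 2 ≤ 4 * hi ^ 3 / ν ^ 2 *
      ((∫ x in (0 : ℝ)..1, enDens a γ ρ u t x)
        + ∫ x in (0 : ℝ)..1, enDens a γ ρ (effVel ν ρ u) t x) := by
  have i1 := (S.smEn S.smu).intervalIntegrable t 0 1
  have i2 := (S.smEn S.smV).intervalIntegrable t 0 1
  rw [← intervalIntegral.integral_add i1 i2, ← intervalIntegral.integral_const_mul]
  refine intervalIntegral.integral_mono_on zero_le_one
    ((S.smρ.dx.pow 2).intervalIntegrable t 0 1) ((i1.add i2).const_mul _) fun x _ => ?_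
  have hpos := S.pos t x
  have hH := relPot_nonneg ha hγ1 hpos
  have hV : ν * dx ρ t x = ρ t x ^ 2 * (effVel ν ρ u t x - u t x) := by
    rw [effVel, S.dx_inv]
    field_simp
    ring
  have h1 : (ν * dx ρ t x) ^ 2 ≤
      ρ t x ^ 3 * (2 * (ρ t x * effVel ν ρ u t x ^ 2) + 2 * (ρ t x * u t x ^ 2)) := by
    rw [hV]
    nlinarith [mul_nonneg (pow_pos hpos 4).le (sq_nonneg (effVel ν ρ u t x + u t x))]
  have h2 : ρ t x ^ 3 ≤ hi ^ 3 := pow_le_pow_left₀ hpos.le (hb x) 3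
  have h3 : 0 ≤ ρ t x * effVel ν ρ u t x ^ 2 := by positivity
  have h4 : 0 ≤ ρ t x * u t x ^ 2 := by positivity
  have h5 : 0 ≤ hi ^ 3 := (pow_pos hpos 3).le.trans h2
  rw [div_mul_eq_mul_div, le_div_iff₀ (by positivity)]
  simp only [enDens]
  calc dx ρ t x ^ 2 * ν ^ 2 = (ν * dx ρ t x) ^ 2 := by ring
    _ ≤ ρ t x ^ 3 * (2 * (ρ t x * effVel ν ρ u t x ^ 2) + 2 * (ρ t x * u t x ^ 2)) := h1
    _ ≤ hi ^ 3 * (2 * (ρ t x * effVel ν ρ u t x ^ 2) + 2 * (ρ t x * u t x ^ 2)) :=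
      mul_le_mul_of_nonneg_right h2 (by positivity)
    _ ≤ _ := by nlinarith [mul_nonneg h5 hH]

/-- The energy and the Bresch–Desjardins entropy are controlled by `∂ₓ u` and `∂ₓ ρ`. -/
lemma energy_add_bd_le {lo hi : ℝ} (ha : 0 < a) (hγ1 : 1 ≤ γ) (hγ2 : γ ≤ 2)
    (hmass : ∫ x in (0 : ℝ)..1, ρ 0 x = 1) (hmom : ∫ x in (0 : ℝ)..1, ρ 0 x * u 0 x = 0)
    (hlo : 0 < lo) (hlo1 : lo ≤ 1) {t : ℝ}
    (hbl : ∀ x, lo ≤ ρ t x) (hb : ∀ x, ρ t x ≤ hi) :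
    (∫ x in (0 : ℝ)..1, enDens a γ ρ u t x)
        + ∫ x in (0 : ℝ)..1, enDens a γ ρ (effVel ν ρ u) t x ≤
      (3 / 2 * hi + 2 * (a * γ * lo ^ (γ - 2)) + ν ^ 2 / lo ^ 3) *
      ((∫ x in (0 : ℝ)..1, dx u t x ^ 2) + ∫ x in (0 : ℝ)..1, dx ρ t x ^ 2) := by
  have i1 := (S.smEn S.smu).intervalIntegrable t 0 1
  have i2 := (S.smEn S.smV).intervalIntegrable t 0 1
  have i3 := (S.smρ.dx.pow 2).intervalIntegrable t 0 1
  set U := ∫ x in (0 : ℝ)..1, dx u t x ^ 2 with hU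
  set R := ∫ x in (0 : ℝ)..1, dx ρ t x ^ 2 with hR
  have hU0 : 0 ≤ U := intervalIntegral.integral_nonneg zero_le_one fun x _ => sq_nonneg _
  have hR0 : 0 ≤ R := intervalIntegral.integral_nonneg zero_le_one fun x _ => sq_nonneg _
  have hhi : 0 < hi := (S.pos t 0).trans_le (hb 0)
  set k := a * γ * lo ^ (γ - 2) with hk
  have hk0 : 0 < k := by positivity
  obtain ⟨y, hy, huy⟩ := exists_zero_of_integral_eq_zero (S.smρ.cont_x t) (S.smu.cont_x t)
    (S.pos t) (S.integral_mom hmom t)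
  obtain ⟨z, hz, hρz⟩ := exists_zero_of_integral_eq_zero (f := fun _ => 1)
    (g := fun x => ρ t x - 1) continuous_const
    ((S.smρ.cont_x t).sub continuous_const) (fun _ => one_pos) (by
      simp only [one_mul]
      rw [intervalIntegral.integral_sub (S.smρ.intervalIntegrable t 0 1)
        intervalIntegrable_const, S.integral_mass hmass t]
      simp)
  have hpt : ∀ x ∈ Set.Icc (0 : ℝ) 1, enDens a γ ρ u t x + enDens a γ ρ (effVel ν ρ u) t x ≤
      (3 / 2 * hi * U + 2 * k * R) + ν ^ 2 / lo ^ 3 * dx ρ t x ^ 2 := by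
    intro x hx
    have hpos := S.pos t x
    have hu2 : u t x ^ 2 ≤ U :=
      sq_le_integral_sq_deriv (S.smu.hasDerivAt_x t) (S.smu.dx.cont_x t) hy huy hx
    have hρ2 : (ρ t x - 1) ^ 2 ≤ R := sq_le_integral_sq_deriv (g := fun x => ρ t x - 1)
      (fun x => (S.smρ.hasDerivAt_x t x).sub_const 1) (S.smρ.dx.cont_x t) hz hρz hx
    have hH : relPot a γ (ρ t x) ≤ k * R := by
      obtain ⟨ζ, θ, hζ, -, hθ0, hθ, e⟩ := exists_relPot_eq (a := a) (γ := γ) hpos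
      rw [e]
      have hζl : lo ≤ ζ := (le_min hlo1 (hbl x)).trans hζ
      have h1 : ζ ^ (γ - 2) ≤ lo ^ (γ - 2) :=
        Real.rpow_le_rpow_of_nonpos hlo hζl (by linarith)
      exact mul_le_mul (mul_le_mul_of_nonneg_left h1 (by positivity)) (hθ.trans hρ2) hθ0 hk0.le
    have hKu : ρ t x * u t x ^ 2 ≤ hi * U := mul_le_mul (hb x) hu2 (sq_nonneg _) hhi.le
    have hKV : 1 / 2 * (ρ t x * effVel ν ρ u t x ^ 2) ≤
        ρ t x * u t x ^ 2 + ν ^ 2 / lo ^ 3 * dx ρ t x ^ 2 := by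
      have hq : ρ t x * (ν * dx (fun t x => (ρ t x)⁻¹) t x) ^ 2 ≤
          ν ^ 2 / lo ^ 3 * dx ρ t x ^ 2 := by
        have h1 : ρ t x * (ν * dx (fun t x => (ρ t x)⁻¹) t x) ^ 2 =
            ν ^ 2 / ρ t x ^ 3 * dx ρ t x ^ 2 := by
          rw [S.dx_inv]
          field_simp
        rw [h1]
        have h2 := hbl x
        gcongr
      rw [effVel]
      nlinarith [mul_nonneg hpos.le
        (sq_nonneg (u t x + ν * dx (fun t x => (ρ t x)⁻¹) t x))]
    simp only [enDens]
    linarith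
  rw [← intervalIntegral.integral_add i1 i2]
  have hint := intervalIntegral.integral_mono_on zero_le_one (i1.add i2)
    (intervalIntegrable_const.add (i3.const_mul _)) hpt
  rw [intervalIntegral.integral_add intervalIntegrable_const (i3.const_mul _),
    intervalIntegral.integral_const_mul, ← hR] at hint
  simp only [intervalIntegral.integral_const, sub_zero, one_smul] at hint
  have h1 : 0 ≤ ν ^ 2 / lo ^ 3 := by positivity
  nlinarith [mul_nonneg hhi.le hR0, mul_nonneg hk0.le hU0, mul_nonneg h1 hU0]

/-- Exponential decay of `∂ₓ ρ`, given uniform bounds on the density. -/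
lemma integral_sq_dx_decay {lo hi : ℝ} (ha : 0 < a) (hγ1 : 1 ≤ γ) (hγ2 : γ ≤ 2) (hν : 0 < ν)
    (hmass : ∫ x in (0 : ℝ)..1, ρ 0 x = 1) (hmom : ∫ x in (0 : ℝ)..1, ρ 0 x * u 0 x = 0)
    (hlo : 0 < lo) (hlo1 : lo ≤ 1) (hhi : 0 < hi)
    (hb : ∀ t x, 0 ≤ t → lo ≤ ρ t x ∧ ρ t x ≤ hi) {A α : ℝ}
    (hA : A = 3 / 2 * hi + 2 * (a * γ * lo ^ (γ - 2)) + ν ^ 2 / lo ^ 3)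
    (hα : α = min ν (ν * (a * γ * hi ^ (γ - 2)) / hi) / A) {t : ℝ} (ht : 0 ≤ t) :
    ∫ x in (0 : ℝ)..1, dx ρ t x ^ 2 ≤ 4 * hi ^ 3 / ν ^ 2 * A *
      ((∫ x in (0 : ℝ)..1, dx u 0 x ^ 2) + ∫ x in (0 : ℝ)..1, dx ρ 0 x ^ 2)
        * Real.exp (-α * t ^ 2) := by
  have hA0 : 0 < A := by rw [hA]; positivity
  set G : ℝ → ℝ := fun t => (∫ x in (0 : ℝ)..1, enDens a γ ρ u t x)
    + ∫ x in (0 : ℝ)..1, enDens a γ ρ (effVel ν ρ u) t x with hG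
  have hGle := fun {t : ℝ} (ht : 0 ≤ t) => S.energy_add_bd_le ha hγ1 hγ2 hmass hmom hlo hlo1
    (fun x => (hb t x ht).1) (fun x => (hb t x ht).2)
  rw [← hA] at hGle
  set D : ℝ → ℝ := fun t => (∫ x in (0 : ℝ)..1, ν * dx u t x ^ 2) + ∫ x in (0 : ℝ)..1,
        ν * (a * γ * ρ t x ^ (γ - 2)) * (dx ρ t x ^ 2 * (ρ t x)⁻¹) with hD
  have hdG : ∀ t, HasDerivAt G (-(2 * t) * D t) t := fun t =>
    ((S.energy_hasDerivAt t).fun_add (S.bd_hasDerivAt t)).congr_deriv (by simp only [hD]; ring)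
  have hDG : ∀ t, 0 ≤ t → α * G t ≤ D t := by
    intro t ht
    set U := ∫ x in (0 : ℝ)..1, dx u t x ^ 2 with hU
    set R := ∫ x in (0 : ℝ)..1, dx ρ t x ^ 2 with hR
    have hU0 : 0 ≤ U := intervalIntegral.integral_nonneg zero_le_one fun x _ => sq_nonneg _
    have hR0 : 0 ≤ R := intervalIntegral.integral_nonneg zero_le_one fun x _ => sq_nonneg _
    set d := ν * (a * γ * hi ^ (γ - 2)) / hi with hd
    have hd0 : 0 < d := by positivity
    have h1 : d * R ≤ ∫ x in (0 : ℝ)..1,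
        ν * (a * γ * ρ t x ^ (γ - 2)) * (dx ρ t x ^ 2 * (ρ t x)⁻¹) := by
      rw [hR, ← intervalIntegral.integral_const_mul]
      refine intervalIntegral.integral_mono_on zero_le_one
        (((S.smρ.dx.pow 2).intervalIntegrable t 0 1).const_mul _)
        ((((Sm.const ν).mul S.smπ).mul ((S.smρ.dx.pow 2).mul S.smq)).intervalIntegrable t 0 1)
        fun x _ => ?_
      have hpos := S.pos t x
      have h2 : hi ^ (γ - 2) ≤ ρ t x ^ (γ - 2) :=
        Real.rpow_le_rpow_of_nonpos hpos (hb t x ht).2 (by linarith)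
      have h3 : hi⁻¹ ≤ (ρ t x)⁻¹ := inv_anti₀ hpos (hb t x ht).2
      calc d * dx ρ t x ^ 2 = ν * (a * γ * hi ^ (γ - 2)) * (dx ρ t x ^ 2 * hi⁻¹) := by
            rw [hd]; ring
        _ ≤ _ := by gcongr
    have h2 : min ν d * (U + R) ≤ D t := by
      simp only [hD]
      rw [intervalIntegral.integral_const_mul, ← hU]
      nlinarith [mul_le_mul_of_nonneg_right (min_le_left ν d) hU0,
        mul_le_mul_of_nonneg_right (min_le_right ν d) hR0]
    have hm0 : 0 ≤ min ν d := (lt_min hν hd0).le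
    refine le_trans ?_ h2
    rw [hα, div_mul_eq_mul_div, div_le_iff₀ hA0, mul_assoc]
    refine mul_le_mul_of_nonneg_left ?_ hm0
    rw [mul_comm]
    exact hGle ht
  have hanti : G t * Real.exp (α * t ^ 2) ≤ G 0 := by
    have hd : ∀ s, HasDerivAt (fun s => G s * Real.exp (α * s ^ 2))
        (2 * s * Real.exp (α * s ^ 2) * (α * G s - D s)) s := by
      intro s
      have he : HasDerivAt (fun s : ℝ => α * s ^ 2) (α * (2 * s)) s := by
        simpa using (hasDerivAt_pow 2 s).const_mul α
      exact ((hdG s).fun_mul he.exp).congr_deriv (by ring)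
    have := antitoneOn_of_deriv_nonpos (convex_Ici 0)
      (fun s _ => (hd s).continuousAt.continuousWithinAt)
      (fun s _ => (hd s).differentiableAt.differentiableWithinAt)
      (fun s hs => ?_) Set.self_mem_Ici ht ht
    · simpa using this
    · rw [interior_Ici, Set.mem_Ioi] at hs
      rw [(hd s).deriv]
      exact mul_nonpos_of_nonneg_of_nonpos (by positivity) (by linarith [hDG s hs.le])
  have hexp : G t ≤ G 0 * Real.exp (-α * t ^ 2) := by
    rw [neg_mul, Real.exp_neg, ← div_eq_mul_inv, le_div_iff₀ (Real.exp_pos _)]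
    exact hanti
  have hc : 0 ≤ 4 * hi ^ 3 / ν ^ 2 := by positivity
  calc ∫ x in (0 : ℝ)..1, dx ρ t x ^ 2 ≤ 4 * hi ^ 3 / ν ^ 2 * G t :=
        S.integral_sq_dx_le ha hγ1 hν fun x => (hb t x ht).2
    _ ≤ 4 * hi ^ 3 / ν ^ 2 * (G 0 * Real.exp (-α * t ^ 2)) := mul_le_mul_of_nonneg_left hexp hc
    _ ≤ 4 * hi ^ 3 / ν ^ 2 * (A * ((∫ x in (0 : ℝ)..1, dx u 0 x ^ 2)
          + ∫ x in (0 : ℝ)..1, dx ρ 0 x ^ 2) * Real.exp (-α * t ^ 2)) := by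
        gcongr
        exact hGle le_rfl
    _ = _ := by ring

end IsSquaredTimeSol

lemma Sm.comp_sq {F : ℝ → ℝ → ℝ} (hF : Sm F) : Sm (fun t x => F (t ^ 2) x) :=
  ContDiff.comp (g := fun p : ℝ × ℝ => F p.1 p.2) hF
    ((contDiff_fst.pow 2).prodMk contDiff_snd)

lemma Sm.dt_comp_sq {F : ℝ → ℝ → ℝ} (hF : Sm F) (t x : ℝ) :
    _root_.dt (fun t x => F (t ^ 2) x) t x = 2 * t * _root_.dt F (t ^ 2) x := by
  have h : HasDerivAt (fun t : ℝ => t ^ 2) (2 * t) t := by simpa using hasDerivAt_pow 2 t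
  have := HasDerivAt.comp t (h₂ := fun s => F s x) (hF.hasDerivAt_t (t ^ 2) x) h
  exact this.deriv.trans (mul_comm _ _)

/-- The time change `t ↦ t²` turns a solution on `[0, ∞)` into one defined for all times. -/
lemma isSquaredTimeSol_comp_sq {a γ ν : ℝ} {η w : ℝ → ℝ → ℝ} (hη : Sm η) (hw : Sm w)
    (hηp : Per η) (hwp : Per w) (hpos : ∀ t x : ℝ, 0 ≤ t → 0 < η t x)
    (hmass : ∀ t x : ℝ, 0 ≤ t →
      deriv (fun s => η s x) t + deriv (fun y => η t y * w t y) x = 0)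
    (hmom : ∀ t x : ℝ, 0 ≤ t →
      η t x * (deriv (fun s => w s x) t + w t x * deriv (w t) x)
        - ν * deriv (deriv (w t)) x + deriv (fun y => a * η t y ^ γ) x = 0) :
    IsSquaredTimeSol a γ ν (fun t x => η (t ^ 2) x) (fun t x => w (t ^ 2) x) where
  smρ := hη.comp_sq
  smu := hw.comp_sq
  perρ t x := hηp (t ^ 2) x
  peru t x := hwp (t ^ 2) x
  pos t x := hpos (t ^ 2) x (sq_nonneg t)
  mass t x := by
    have h := hmass (t ^ 2) x (sq_nonneg t)
    rw [((hη.hasDerivAt_x (t ^ 2) x).fun_mul (hw.hasDerivAt_x (t ^ 2) x)).deriv] at h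
    change dt η (t ^ 2) x + _ = 0 at h
    rw [hη.dt_comp_sq]
    change _ = -(2 * t) * (dx η (t ^ 2) x * w (t ^ 2) x + η (t ^ 2) x * dx w (t ^ 2) x)
    linear_combination 2 * t * h
  mom t x := by
    have h := hmom (t ^ 2) x (sq_nonneg t)
    have hp := hpos (t ^ 2) x (sq_nonneg t)
    have h3 : η (t ^ 2) x ^ (γ - 1) = η (t ^ 2) x * η (t ^ 2) x ^ (γ - 2) := by
      rw [show γ - 1 = 1 + (γ - 2) by ring, Real.rpow_add hp, Real.rpow_one]
    rw [(((hη.hasDerivAt_x (t ^ 2) x).rpow_const (p := γ) (Or.inl hp.ne')).const_mul a).deriv,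
      h3] at h
    change η (t ^ 2) x * (dt w (t ^ 2) x + w (t ^ 2) x * dx w (t ^ 2) x)
      - ν * dx (dx w) (t ^ 2) x + _ = 0 at h
    rw [hw.dt_comp_sq]
    change _ = 2 * t * (-(η (t ^ 2) x * w (t ^ 2) x * dx w (t ^ 2) x)
      + ν * dx (dx w) (t ^ 2) x
      - η (t ^ 2) x * (a * γ * η (t ^ 2) x ^ (γ - 2)) * dx η (t ^ 2) x)
    linear_combination 2 * t * h

lemma integral_enDens_le {a γ E : ℝ} (ha : 0 < a) (hγ1 : 1 ≤ γ) {ρ u : ℝ → ℝ → ℝ}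
    (hρ : Sm ρ) (hu : Sm u) (hne : ∀ t x, ρ t x ≠ 0) {t : ℝ}
    (hmass : ∫ x in (0 : ℝ)..1, ρ t x = 1)
    (hE : (∫ x in (0 : ℝ)..1, ((1 / 2) * ρ t x * (u t x) ^ 2 + Ppot a γ (ρ t x))) ≤ E) :
    ∫ x in (0 : ℝ)..1, enDens a γ ρ u t x ≤ E := by
  have i1 : IntervalIntegrable (enDens a γ ρ u t) volume 0 1 :=
    (((Sm.const (1 / 2)).mul (hρ.mul (hu.pow 2))).add
      (hρ.relPot hne a γ)).intervalIntegrable t 0 1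
  have i2 := hρ.intervalIntegrable t 0 1
  have e : ∀ x, (1 / 2) * ρ t x * (u t x) ^ 2 + Ppot a γ (ρ t x) =
      enDens a γ ρ u t x + (Ppot a γ 1 + potSlope a γ * (ρ t x - 1)) := fun x => by
    simp only [enDens, relPot]; ring
  simp_rw [e] at hE
  rw [intervalIntegral.integral_add i1 (intervalIntegrable_const.add
    ((i2.sub intervalIntegrable_const).const_mul _)),
    intervalIntegral.integral_add intervalIntegrable_const
      ((i2.sub intervalIntegrable_const).const_mul _),
    intervalIntegral.integral_const_mul,
    intervalIntegral.integral_sub i2 intervalIntegrable_const, hmass] at hE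
  simp only [intervalIntegral.integral_const, sub_zero, one_smul, sub_self, mul_zero,
    add_zero] at hE
  linarith [Ppot_one_nonneg ha hγ1]

lemma integral_sq_deriv_le_HSq_one (f : ℝ → ℝ) :
    ∫ x in (0 : ℝ)..1, deriv f x ^ 2 ≤ HSq 1 f := by
  have : 0 ≤ ∫ x in (0 : ℝ)..1, f x ^ 2 :=
    intervalIntegral.integral_nonneg zero_le_one fun x _ => sq_nonneg _
  simp only [HSq, Finset.sum_range_succ, Finset.sum_range_zero, Function.iterate_one,
    Function.iterate_zero, id]
  linarith

/-- **Exponential decay of `‖∂ₓ η‖_{L²}`** (Proposition `prop-decay-exp-rx`):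
there are `C, α > 0`, depending only on `(a, γ, ν, ς̄₀, ς̲₀, Ē)`, such that
every global smooth solution of the 1D isentropic compressible Navier–Stokes
system on `[0,∞) × 𝕋` with `ς̲₀ ≤ η₀ ≤ ς̄₀`, `∫_𝕋 η₀ = 1`, `∫_𝕋 η₀ w₀ = 0` and
initial energy `E₀₀ ≤ Ē` satisfies
`‖∂ₓ η(t)‖_{L²(𝕋)} ≤ C E₁₀^{1/2} e^{-α t}` for all `t ≥ 0`, where
`E₁₀ = ‖η₀ - 1‖²_{H¹} + ‖w₀‖²_{H¹}`. -/
theorem density_gradient_decay (a γ ν ςlow ςbar Ebar : ℝ)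
    (ha : 0 < a) (hγ1 : 1 ≤ γ) (hγ2 : γ ≤ 2) (hν : 0 < ν)
    (hςlow : 0 < ςlow) (hςord : ςlow ≤ ςbar) (hEbar : 0 < Ebar) :
    ∃ C α : ℝ, 0 < C ∧ 0 < α ∧
      ∀ η w : ℝ → ℝ → ℝ,
        ContDiff ℝ (⊤ : ℕ∞) (Function.uncurry η) →
        ContDiff ℝ (⊤ : ℕ∞) (Function.uncurry w) →
        (∀ t x : ℝ, η t (x + 1) = η t x) →
        (∀ t x : ℝ, w t (x + 1) = w t x) →
        (∀ t x : ℝ, 0 ≤ t → 0 < η t x) →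
        (∀ t x : ℝ, 0 ≤ t →
          deriv (fun s => η s x) t + deriv (fun y => η t y * w t y) x = 0) →
        (∀ t x : ℝ, 0 ≤ t →
          η t x * (deriv (fun s => w s x) t + w t x * deriv (w t) x)
            - ν * deriv (deriv (w t)) x + deriv (fun y => a * η t y ^ γ) x = 0) →
        (∀ x : ℝ, ςlow ≤ η 0 x) →
        (∀ x : ℝ, η 0 x ≤ ςbar) →
        (∫ x in (0:ℝ)..1, η 0 x) = 1 →
        (∫ x in (0:ℝ)..1, η 0 x * w 0 x) = 0 →
        (∫ x in (0:ℝ)..1, ((1 / 2) * η 0 x * (w 0 x) ^ 2 + Ppot a γ (η 0 x))) ≤ Ebar →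
        ∀ t : ℝ, 0 ≤ t →
          Real.sqrt (∫ x in (0:ℝ)..1, (deriv (η t) x) ^ 2)
            ≤ C * Real.sqrt (HSq 1 (fun x => η 0 x - 1) + HSq 1 (w 0))
                * Real.exp (-α * t) := by
  have hγ0 : 0 < γ := by linarith
  obtain ⟨lo, hlo⟩ : ∃ lo, lo = Real.exp
    ((min (ν * Real.log ςlow) 0 - 2 * (1 + 2 * Ebar)) / ν) := ⟨_, rfl⟩
  obtain ⟨hi, hhi⟩ : ∃ hi, hi = Real.exp ((max (ν * Real.log ςbar)
    (ν * Real.log ((a + 3 * Ebar) / a)) + 2 * (1 + 2 * Ebar)) / ν) := ⟨_, rfl⟩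
  have hlo0 : 0 < lo := hlo ▸ Real.exp_pos _
  have hhi0 : 0 < hi := hhi ▸ Real.exp_pos _
  have hlo1 : lo ≤ 1 := by
    rw [hlo, Real.exp_le_one_iff]
    refine div_nonpos_of_nonpos_of_nonneg ?_ hν.le
    linarith [min_le_right (ν * Real.log ςlow) 0]
  obtain ⟨A, hA⟩ : ∃ A, A = 3 / 2 * hi + 2 * (a * γ * lo ^ (γ - 2)) + ν ^ 2 / lo ^ 3 := ⟨_, rfl⟩
  have hA0 : 0 < A := by rw [hA]; positivity
  obtain ⟨α, hα⟩ : ∃ α, α = min ν (ν * (a * γ * hi ^ (γ - 2)) / hi) / A := ⟨_, rfl⟩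
  have hα0 : 0 < α := by
    rw [hα]
    exact div_pos (lt_min hν (by positivity)) hA0
  have hB0 : 0 < 4 * hi ^ 3 / ν ^ 2 * A := by positivity
  refine ⟨Real.sqrt (4 * hi ^ 3 / ν ^ 2 * A), α / 2, Real.sqrt_pos.2 hB0, half_pos hα0, ?_⟩
  intro η w hη hw hηp hwp hpos hmass hmom hlow hbar hm0 hw0 hE t ht
  have smη : Sm η := hη
  have smw : Sm w := hw
  have S := isSquaredTimeSol_comp_sq smη smw hηp hwp hpos hmass hmom
  have z : (0 : ℝ) ^ 2 = 0 := by norm_num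
  have hm0' : ∫ x in (0 : ℝ)..1, η (0 ^ 2) x = 1 := by rw [z]; exact hm0
  have hw0' : ∫ x in (0 : ℝ)..1, η (0 ^ 2) x * w (0 ^ 2) x = 0 := by rw [z]; exact hw0
  have hE' := integral_enDens_le (t := 0) (E := Ebar) ha hγ1 S.smρ S.smu S.ne hm0'
    (by rw [z]; exact hE)
  have hb : ∀ s x, 0 ≤ s → lo ≤ η (s ^ 2) x ∧ η (s ^ 2) x ≤ hi := by
    intro s x hs
    rw [hlo, hhi]
    exact S.density_bounds ha hγ1 hγ2 hν hEbar hςlow (by rw [z]; exact hlow)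
      (by rw [z]; exact hbar) hm0' hw0' hE' hs x
  have hdecay := S.integral_sq_dx_decay ha hγ1 hγ2 hν hm0' hw0' hlo0 hlo1 hhi0 hb hA hα
    (Real.sqrt_nonneg t)
  simp only [dx, z, Real.sq_sqrt ht] at hdecay
  have hR := integral_sq_deriv_le_HSq_one (fun x => η 0 x - 1)
  have hU := integral_sq_deriv_le_HSq_one (w 0)
  simp only [deriv_sub_const_fun] at hR
  have hexp : Real.exp (-α * t) = Real.exp (-(α / 2) * t) ^ 2 := by
    rw [← Real.exp_nat_mul]
    congr 1
    push_cast
    ring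
  calc Real.sqrt (∫ x in (0:ℝ)..1, (deriv (η t) x) ^ 2)
      ≤ Real.sqrt (4 * hi ^ 3 / ν ^ 2 * A * (HSq 1 (fun x => η 0 x - 1) + HSq 1 (w 0))
          * Real.exp (-(α / 2) * t) ^ 2) := by
        refine Real.sqrt_le_sqrt (hdecay.trans ?_)
        rw [hexp]
        refine mul_le_mul_of_nonneg_right (mul_le_mul_of_nonneg_left ?_ hB0.le) (sq_nonneg _)
        linarith
    _ = _ := by
        rw [Real.sqrt_mul' _ (sq_nonneg _), Real.sqrt_mul hB0.le,
          Real.sqrt_sq (Real.exp_pos _).le]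
end
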